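/- Under the standing assumptions, for every r ∈ (0, 1) the fourth moment of the spherical average is given by E[(h_r(0))⁴] = lim_{a→0} ∬_{(∂(r𝔹))⁴ ∩ {|zᵢ−zⱼ|>a for all i≠j}} k₄(z₁, z₂, z₃, z₄) ρ(dz₁)ρ(dz₂)ρ(dz₃)ρ(dz₄), where ρ is the uniform probability measure on ∂(r𝔹); in particular this limit exists and is finite. -/

import Mathlib

open MeasureTheory ProbabilityTheory Metric Filter Topology Set

noncomputable section

abbrev Euc (d : ℕ) : Type := EuclideanSpace ℝ (Fin d)

/-- The scaling function `s`: `s(r) = -log r` if `d = 2`, and `s(r) = r^(2-d)` if `d ≥ 3`. -/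
noncomputable def sFun (d : ℕ) (r : ℝ) : ℝ :=
  if d = 2 then -Real.log r else r ^ ((2 : ℝ) - (d : ℝ))

open Classical in
/-- The zero boundary Green's function of the open unit ball in `ℝ^d`:
`G(x,y) = s(|x-y|) - s(|x|·|y - x/|x|²|)`, interpreted by continuity at `x = 0`. -/
noncomputable def greenBall (d : ℕ) (x y : Euc d) : ℝ :=
  if x = 0 then sFun d ‖y‖ - sFun d 1
  else sFun d ‖x - y‖ - sFun d (‖x‖ * ‖y - (‖x‖ ^ 2)⁻¹ • x‖)

/-- Smooth compactly supported test functions. -/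
def IsTestFun {d : ℕ} (f : Euc d → ℝ) : Prop :=
  ContDiff ℝ (⊤ : ℕ∞) f ∧ HasCompactSupport f

/-- The Laplacian of `u : ℝ^d → ℝ` at `x`, as the sum of pure second derivatives in the
coordinate directions. -/
noncomputable def lap {d : ℕ} (u : Euc d → ℝ) (x : Euc d) : ℝ :=
  ∑ i : Fin d, iteratedFDeriv ℝ 2 u x ![EuclideanSpace.single i 1, EuclideanSpace.single i 1]

/-- A function is harmonic on a set if it is twice continuously differentiable there with
vanishing Laplacian. -/
def IsHarmonicOn {d : ℕ} (u : Euc d → ℝ) (s : Set (Euc d)) : Prop :=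
  ContDiffOn ℝ 2 u s ∧ ∀ x ∈ s, lap u x = 0

/-- A real random variable is a (possibly degenerate) centered Gaussian. -/
def IsCenteredGaussianRV {Ω : Type} [MeasurableSpace Ω] (P : Measure Ω) (Y : Ω → ℝ) : Prop :=
  ∃ v : NNReal, Measure.map Y P = ProbabilityTheory.gaussianReal 0 v

/-- The standing assumptions: a collection of stochastic processes `h a r` (thought of as
`h^{a + r𝔹}`) indexed by test functions, which is centered, a.s. linear, zero outside the ball,
translation/scaling covariant, satisfies the domain Markov property (with the decomposition
recorded as data `H`, `Φ`, `φharm`), has fourth moments, a (sequentially) continuous covariance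
bilinear form on `C_c^∞(𝔹)`, and zero boundary conditions. -/
structure GFF (d : ℕ) (Ω : Type) [MeasurableSpace Ω] where
  P : Measure Ω
  prob : IsProbabilityMeasure P
  /-- the field `h^{a+r𝔹}` tested against `f` -/
  h : Euc d → ℝ → (Euc d → ℝ) → Ω → ℝ
  meas_h : ∀ a r f, Measurable (h a r f)
  integrable_h : ∀ a r f, IsTestFun f → Integrable (h a r f) P
  /-- centered -/
  centered : ∀ a r f, IsTestFun f → ∫ ω, h a r f ω ∂P = 0
  /-- (1) a.s. linearity in the test function -/
  lin_add : ∀ f g : Euc d → ℝ, IsTestFun f → IsTestFun g →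
    ∀ᵐ ω ∂P, h 0 1 (f + g) ω = h 0 1 f ω + h 0 1 g ω
  lin_smul : ∀ (c : ℝ) (f : Euc d → ℝ), IsTestFun f →
    ∀ᵐ ω ∂P, h 0 1 (c • f) ω = c * h 0 1 f ω
  /-- (2) the field vanishes on test functions supported outside the ball -/
  zero_outside : ∀ f : Euc d → ℝ, IsTestFun f → tsupport f ⊆ (ball (0 : Euc d) 1)ᶜ →
    ∀ᵐ ω ∂P, h 0 1 f ω = 0
  /-- (3) translation and scaling: `(h^{a+r𝔹}, f((·-a)/r)) = r^{1+d/2} (h^𝔹, f)` in law,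
  as processes (equality of finite dimensional distributions) -/
  scaling : ∀ (a : Euc d) (r : ℝ), 0 < r → ∀ (k : ℕ) (f : Fin k → Euc d → ℝ),
    (∀ i, IsTestFun (f i)) →
    Measure.map (fun ω (i : Fin k) => h a r (fun x => f i (r⁻¹ • (x - a))) ω) P
      = Measure.map (fun ω (i : Fin k) => r ^ (1 + (d : ℝ) / 2) * h 0 1 (f i) ω) P
  /-- (4) domain Markov property: the decomposition data. `H a r` is the independent copy of
  `h^{a+r𝔹}`, `Φ a r` is the harmonic part as a process, `φharm a r ω` is the harmonic function. -/
  H : Euc d → ℝ → (Euc d → ℝ) → Ω → ℝ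
  Φ : Euc d → ℝ → (Euc d → ℝ) → Ω → ℝ
  φharm : Euc d → ℝ → Ω → Euc d → ℝ
  meas_H : ∀ a r f, Measurable (H a r f)
  meas_Φ : ∀ a r f, Measurable (Φ a r f)
  meas_φharm : ∀ a r z, Measurable fun ω => φharm a r ω z
  dmp_decomp : ∀ (a : Euc d) (r : ℝ), 0 < r → ball a r ⊆ ball (0 : Euc d) 1 →
    ∀ f : Euc d → ℝ, IsTestFun f → ∀ᵐ ω ∂P, h 0 1 f ω = H a r f ω + Φ a r f ω
  dmp_indep : ∀ (a : Euc d) (r : ℝ), 0 < r → ball a r ⊆ ball (0 : Euc d) 1 →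
    ProbabilityTheory.Indep
      (⨆ f : {f : Euc d → ℝ // IsTestFun f}, MeasurableSpace.comap (H a r f.1) inferInstance)
      ((⨆ f : {f : Euc d → ℝ // IsTestFun f}, MeasurableSpace.comap (Φ a r f.1) inferInstance) ⊔
        (⨆ z : Euc d, MeasurableSpace.comap (fun ω => φharm a r ω z) inferInstance)) P
  dmp_law : ∀ (a : Euc d) (r : ℝ), 0 < r → ball a r ⊆ ball (0 : Euc d) 1 →
    ∀ (k : ℕ) (f : Fin k → Euc d → ℝ), (∀ i, IsTestFun (f i)) →
    Measure.map (fun ω (i : Fin k) => H a r (f i) ω) P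
      = Measure.map (fun ω (i : Fin k) => h a r (f i) ω) P
  dmp_harm : ∀ (a : Euc d) (r : ℝ), 0 < r → ball a r ⊆ ball (0 : Euc d) 1 →
    ∀ᵐ ω ∂P, IsHarmonicOn (φharm a r ω) (ball a r) ∧
      ∀ f : Euc d → ℝ, IsTestFun f → tsupport f ⊆ ball a r →
        Φ a r f ω = ∫ x in ball a r, φharm a r ω x * f x
  /-- (5) fourth moments -/
  mom4 : ∀ f : Euc d → ℝ, IsTestFun f → Integrable (fun ω => (h 0 1 f ω) ^ 4) P
  /-- (6) sequential continuity of the covariance bilinear form on `C_c^∞(𝔹)` -/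
  K2_cont : ∀ (f : ℕ → Euc d → ℝ) (f₀ g : Euc d → ℝ) (K : Set (Euc d)),
    IsCompact K → K ⊆ ball (0 : Euc d) 1 →
    (∀ n, IsTestFun (f n)) → IsTestFun f₀ → IsTestFun g → tsupport g ⊆ ball (0 : Euc d) 1 →
    (∀ n, tsupport (f n) ⊆ K) → tsupport f₀ ⊆ K →
    (∀ m : ℕ, TendstoUniformly (fun n => iteratedFDeriv ℝ m (f n)) (iteratedFDeriv ℝ m f₀) atTop) →
    Tendsto (fun n => ∫ ω, h 0 1 (f n) ω * h 0 1 g ω ∂P) atTop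
      (𝓝 (∫ ω, h 0 1 f₀ ω * h 0 1 g ω ∂P))
  /-- (7) zero boundary conditions -/
  zero_bdry : ∀ f : ℕ → Euc d → ℝ,
    (∀ n, IsTestFun (f n)) → (∀ n x, 0 ≤ f n x) →
    (∃ C : ℝ, ∀ n, ∫ x, f n x ≤ C) →
    Tendsto (fun n => Metric.infDist (0 : Euc d) (tsupport (f n))) atTop (𝓝 1) →
    (∃ C : ℝ, ∀ (n : ℕ) (x y : Euc d), ‖x‖ = ‖y‖ → ‖x‖ < 1 → f n x ≤ C * f n y) →
    Tendsto (fun n => ∫ ω, (h 0 1 (f n) ω) ^ 2 ∂P) atTop (𝓝 0)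

instance {d : ℕ} {Ω : Type} [MeasurableSpace Ω] (X : GFF d Ω) : IsProbabilityMeasure X.P :=
  X.prob

/-- The spherical average `h_ε(z) = φ^{z+ε𝔹}_𝔹(z)`. -/
noncomputable def GFF.sphAvg {d : ℕ} {Ω : Type} [MeasurableSpace Ω] (X : GFF d Ω) (z : Euc d) (ε : ℝ) (ω : Ω) : ℝ :=
  X.φharm z ε ω z

/-- A valid choice of radii in the definition of the four-point function. -/
noncomputable def k4eps {d : ℕ} (z : Fin 4 → Euc d) (i : Fin 4) : ℝ :=
  min ((⨅ j : {j : Fin 4 // j ≠ i}, dist (z i) (z j.1)) / 2) (1 - ‖z i‖) / 2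

/-- The four-point function `k₄(z₁,...,z₄) = E[∏ᵢ φ^{zᵢ+aᵢ𝔹}_𝔹(zᵢ)]`
(independent of the admissible choices of `aᵢ`, under the standing assumptions). -/
noncomputable def GFF.k4 {d : ℕ} {Ω : Type} [MeasurableSpace Ω] (X : GFF d Ω) (z : Fin 4 → Euc d) : ℝ :=
  ∫ ω, ∏ i, X.φharm (z i) (k4eps z i) ω (z i) ∂X.P

/-- The uniform probability measure on the sphere of radius `r` centered at the origin,
as the normalized `(d-1)`-dimensional Hausdorff measure. -/
noncomputable def sphereUniform (d : ℕ) (r : ℝ) : Measure (Euc d) :=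
  ((μH[((d : ℝ) - 1)] : Measure (Euc d)) (Metric.sphere (0 : Euc d) r))⁻¹ •
    (μH[((d : ℝ) - 1)] : Measure (Euc d)).restrict (Metric.sphere (0 : Euc d) r)

/-- Every point of a sphere has a coordinate of maximal modulus. -/
lemma exists_max_coord {m : ℕ} (x : Euc (m + 1)) :
    ∃ i, ∀ j, |x j| ≤ |x i| := by
  obtain ⟨i, -, hi⟩ := Finset.exists_max_image Finset.univ (fun j => |x j|) ⟨0, Finset.mem_univ _⟩
  exact ⟨i, fun j => hi j (Finset.mem_univ _)⟩

/-- Radial projection of a face of the cube to the sphere of radius `r`. -/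
def faceProj {m : ℕ} (r : ℝ) (i : Fin (m + 1)) (s : ℝ) (v : Fin m → ℝ) : Euc (m + 1) :=
  (r * ‖(WithLp.toLp 2 (Fin.insertNth (α := fun _ => ℝ) i s v) : Euc (m + 1))‖⁻¹) •
    (WithLp.toLp 2 (Fin.insertNth (α := fun _ => ℝ) i s v) : Euc (m + 1))

lemma contDiff_faceProj {m : ℕ} (r : ℝ) (i : Fin (m + 1)) {s : ℝ} (hs : s ≠ 0) :
    ContDiff ℝ 1 (faceProj (m := m) r i s) := by
  have hg : ContDiff ℝ 1 (fun v : Fin m → ℝ =>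
      (WithLp.toLp 2 (Fin.insertNth (α := fun _ => ℝ) i s v) : Euc (m + 1))) := by
    rw [contDiff_euclidean]
    intro j
    refine Fin.succAboveCases i ?_ (fun k => ?_) j
    · simpa using contDiff_const
    · simpa using contDiff_apply ℝ ℝ k
  have hne : ∀ v : Fin m → ℝ,
      (WithLp.toLp 2 (Fin.insertNth (α := fun _ => ℝ) i s v) : Euc (m + 1)) ≠ 0 := by
    intro v h
    have := congrArg (fun y : Euc (m + 1) => y i) h
    simp at this
    exact hs this
  unfold faceProj
  refine ContDiff.smul (contDiff_const.mul (ContDiff.inv (hg.norm ℝ hne) ?_)) hg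
  intro v
  exact norm_ne_zero_iff.2 (hne v)

lemma hausdorff_sphere_lt_top (m : ℕ) (r : ℝ) (hr : 0 < r) :
    (μH[(m : ℝ)] : Measure (Euc (m + 1))) (sphere 0 r) < ⊤ := by
  have hcover : sphere (0 : Euc (m + 1)) r ⊆
      ⋃ i : Fin (m + 1), ⋃ s : Bool,
        faceProj r i (if s then 1 else -1) '' (Set.pi univ fun _ => Icc (-1 : ℝ) 1) := by
    intro x hx
    have hxr : ‖x‖ = r := by simpa using hx
    obtain ⟨i, hi⟩ := exists_max_coord x
    have hxi : x i ≠ 0 := by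
      intro h0
      have : x = 0 := by
        ext j
        have := hi j
        rw [h0, abs_zero] at this
        simpa using le_antisymm this (abs_nonneg _)
      rw [this, norm_zero] at hxr
      exact hr.ne hxr
    have hpos : 0 < |x i| := abs_pos.2 hxi
    simp only [mem_iUnion]
    refine ⟨i, decide (0 < x i), fun k => |x i|⁻¹ * x (i.succAbove k), ?_, ?_⟩
    · intro k _
      rw [mem_Icc, ← abs_le, abs_mul, abs_inv, abs_abs, inv_mul_le_iff₀ hpos, mul_one]
      exact hi _
    · have hy : (WithLp.toLp 2 (Fin.insertNth (α := fun _ => ℝ) i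
          (if decide (0 < x i) = true then (1 : ℝ) else -1)
          (fun k => |x i|⁻¹ * x (i.succAbove k))) : Euc (m + 1)) = |x i|⁻¹ • x := by
        ext j
        refine Fin.succAboveCases i ?_ (fun k => ?_) j
        · simp only [Fin.insertNth_apply_same, PiLp.smul_apply, smul_eq_mul, decide_eq_true_eq]
          split_ifs with h
          · rw [abs_of_pos h, inv_mul_cancel₀ hxi]
          · have : x i < 0 := lt_of_le_of_ne (not_lt.1 h) hxi
            rw [abs_of_neg this]
            field_simp
        · simp
      unfold faceProj
      rw [hy, norm_smul, norm_inv, Real.norm_eq_abs, abs_abs, hxr, smul_smul]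
      have : r * (|x i|⁻¹ * r)⁻¹ * |x i|⁻¹ = 1 := by field_simp
      rw [this, one_smul]
  refine lt_of_le_of_lt (measure_mono hcover) ?_
  refine lt_of_le_of_lt (measure_iUnion_le _) ?_
  rw [tsum_fintype, ENNReal.sum_lt_top]
  intro i _
  refine lt_of_le_of_lt (measure_iUnion_le _) ?_
  rw [tsum_fintype, ENNReal.sum_lt_top]
  intro s _
  have hs : (if s then (1 : ℝ) else -1) ≠ 0 := by split_ifs <;> norm_num
  have hK : IsCompact (Set.pi univ fun _ : Fin m => Icc (-1 : ℝ) 1) :=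
    isCompact_univ_pi fun _ => isCompact_Icc
  obtain ⟨K, hL⟩ := LocallyLipschitzOn.exists_lipschitzOnWith_of_compact hK
    ((contDiff_faceProj (m := m) r i hs).locallyLipschitz.locallyLipschitzOn)
  refine lt_of_le_of_lt (hL.hausdorffMeasure_image_le (Nat.cast_nonneg m)) ?_
  have : (μH[(m : ℝ)] : Measure (Fin m → ℝ)) = volume := by
    simpa using hausdorffMeasure_pi_real (ι := Fin m)
  rw [this]
  exact ENNReal.mul_lt_top (ENNReal.rpow_lt_top_of_nonneg (Nat.cast_nonneg m) ENNReal.coe_ne_top)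
    hK.measure_lt_top

/-- Projection forgetting the first coordinate. -/
def tailProj {m : ℕ} (x : Euc (m + 1)) : Fin m → ℝ := fun j => x j.succ

lemma lipschitz_tailProj {m : ℕ} : LipschitzWith 1 (tailProj (m := m)) := by
  refine LipschitzWith.of_dist_le_mul fun x y => ?_
  rw [NNReal.coe_one, one_mul, dist_pi_le_iff dist_nonneg]
  intro j
  rw [dist_eq_norm, dist_eq_norm]
  exact PiLp.norm_apply_le (x - y) j.succ

/-- A section of `tailProj` with values in the sphere of radius `r`. -/
def sphLift {m : ℕ} (r : ℝ) (v : Fin m → ℝ) : Euc (m + 1) :=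
  WithLp.toLp 2 (Fin.cons (α := fun _ => ℝ) (√(r ^ 2 - ∑ j, v j ^ 2)) v)

lemma tailProj_sphLift {m : ℕ} (r : ℝ) (v : Fin m → ℝ) : tailProj (sphLift r v) = v := by
  ext j; simp [tailProj, sphLift]

lemma continuous_sphLift {m : ℕ} (r : ℝ) : Continuous (sphLift (m := m) r) := by
  unfold sphLift
  refine (PiLp.continuous_toLp 2 _).comp ?_
  refine continuous_pi fun j => ?_
  refine Fin.cases ?_ (fun k => ?_) j
  · simp only [Fin.cons_zero]; fun_prop
  · simp only [Fin.cons_succ]; fun_prop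

lemma norm_sphLift {m : ℕ} {r : ℝ} (hr : 0 < r) {v : Fin m → ℝ}
    (hv : v ∈ closedBall (0 : Fin m → ℝ) (r / (m + 1))) : ‖sphLift r v‖ = r := by
  have hv' : ∀ j, |v j| ≤ r / (m + 1) := by
    intro j
    have := norm_le_pi_norm v j
    rw [Real.norm_eq_abs] at this
    exact this.trans (by simpa using hv)
  have hsum : ∑ j, v j ^ 2 ≤ r ^ 2 := by
    calc ∑ j, v j ^ 2 ≤ ∑ _j : Fin m, (r / (m + 1)) ^ 2 := by
          refine Finset.sum_le_sum fun j _ => ?_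
          rw [← sq_abs]
          exact pow_le_pow_left₀ (abs_nonneg _) (hv' j) 2
      _ = m * (r / (m + 1)) ^ 2 := by simp
      _ ≤ r ^ 2 := by
          rw [div_pow, mul_div_assoc', div_le_iff₀ (by positivity)]
          have : (0 : ℝ) ≤ m := Nat.cast_nonneg m
          nlinarith [sq_nonneg r, mul_nonneg this (sq_nonneg r),
            mul_nonneg (mul_nonneg this this) (sq_nonneg r)]
  rw [EuclideanSpace.norm_eq, Fin.sum_univ_succ]
  simp only [sphLift, Fin.cons_zero, Fin.cons_succ, Real.norm_eq_abs, sq_abs]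
  rw [Real.sq_sqrt (by linarith), sub_add_cancel, Real.sqrt_sq hr.le]

lemma hausdorff_sphere_pos (m : ℕ) (r : ℝ) (hr : 0 < r) :
    0 < (μH[(m : ℝ)] : Measure (Euc (m + 1))) (sphere 0 r) := by
  have hsub : closedBall (0 : Fin m → ℝ) (r / (m + 1)) ⊆ tailProj '' sphere (0 : Euc (m + 1)) r := by
    intro v hv
    exact ⟨sphLift r v, by simpa using norm_sphLift hr hv, tailProj_sphLift r v⟩
  have h1 := (lipschitz_tailProj (m := m)).hausdorffMeasure_image_le (Nat.cast_nonneg m)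
    (sphere (0 : Euc (m + 1)) r)
  have : (μH[(m : ℝ)] : Measure (Fin m → ℝ)) = volume := by
    simpa using hausdorffMeasure_pi_real (ι := Fin m)
  rw [this] at h1
  have h2 : 0 < volume (closedBall (0 : Fin m → ℝ) (r / (m + 1))) :=
    measure_closedBall_pos _ _ (by positivity)
  have h3 := h2.trans_le ((measure_mono hsub).trans h1)
  simpa using h3

lemma sphereUniform_succ (m : ℕ) (r : ℝ) : sphereUniform (m + 1) r =
    ((μH[(m : ℝ)] : Measure (Euc (m + 1))) (sphere 0 r))⁻¹ •
      (μH[(m : ℝ)] : Measure (Euc (m + 1))).restrict (sphere 0 r) := by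
  unfold sphereUniform
  have : (((m + 1 : ℕ) : ℝ) - 1) = m := by push_cast; ring
  rw [this]

lemma isProbabilityMeasure_sphereUniform (m : ℕ) {r : ℝ} (hr : 0 < r) :
    IsProbabilityMeasure (sphereUniform (m + 1) r) := by
  constructor
  rw [sphereUniform_succ, Measure.smul_apply, Measure.restrict_apply_univ, smul_eq_mul]
  exact ENNReal.inv_mul_cancel (hausdorff_sphere_pos m r hr).ne' (hausdorff_sphere_lt_top m r hr).ne

lemma sphereUniform_compl_sphere (m : ℕ) (r : ℝ) :
    sphereUniform (m + 1) r (sphere 0 r)ᶜ = 0 := by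
  rw [sphereUniform_succ, Measure.smul_apply,
    Measure.restrict_apply isClosed_sphere.measurableSet.compl]
  simp

lemma ae_sphereUniform_mem (m : ℕ) (r : ℝ) :
    ∀ᵐ x ∂(sphereUniform (m + 1) r), x ∈ sphere (0 : Euc (m + 1)) r :=
  sphereUniform_compl_sphere m r

lemma nullSingleton_sphereUniform {m : ℕ} (hm : 1 ≤ m) (r : ℝ) (x : Euc (m + 1)) :
    sphereUniform (m + 1) r {x} = 0 := by
  have : NullSingletonClass (μH[(m : ℝ)] : Measure (Euc (m + 1))) :=
    Measure.nullSingletonClass_hausdorff _ (by exact_mod_cast hm)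
  have h0 : (μH[(m : ℝ)] : Measure (Euc (m + 1))).restrict (sphere 0 r) {x} = 0 :=
    le_antisymm ((Measure.restrict_apply_le _ _).trans (measure_singleton x).le) bot_le
  rw [sphereUniform_succ, Measure.smul_apply, h0, smul_zero]

lemma measurePreserving_sphereUniform (m : ℕ) (r : ℝ) (L : Euc (m + 1) ≃ₗᵢ[ℝ] Euc (m + 1)) :
    MeasurePreserving L (sphereUniform (m + 1) r) (sphereUniform (m + 1) r) := by
  have h := L.toIsometryEquiv.measurePreserving_hausdorffMeasure (m : ℝ)
  have h1 := h.restrict_preimage (s := sphere (0 : Euc (m + 1)) r) isClosed_sphere.measurableSet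
  have h2 : (L.toIsometryEquiv) ⁻¹' (sphere (0 : Euc (m + 1)) r) = sphere (0 : Euc (m + 1)) r := by
    ext x; simp
  rw [h2] at h1
  rw [sphereUniform_succ]
  exact h1.smul_measure _

lemma lintegral_riesz_pi_lt_top {m : ℕ} (hm : 1 ≤ m) {β : ℝ} (hβ : β < m) (R : ℝ) :
    ∫⁻ v in ball (0 : Fin m → ℝ) R, edist v 0 ^ (-β) < ⊤ := by
  have : Nonempty (Fin m) := ⟨⟨0, hm⟩⟩
  rcases le_or_gt R 0 with hR | hR
  · rw [ball_eq_empty.2 hR]; simp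
  have h : IntegrableOn (fun x : Fin m → ℝ => ‖x‖ ^ (-β)) (ball 0 R) := by
    rw [integrableOn_fun_norm_addHaar volume (f := fun t : ℝ => t ^ (-β))]
    have h1 : IntegrableOn (fun x : ℝ => x ^ ((m : ℝ) - 1 - β)) (Ioo (0 : ℝ) R) :=
      (intervalIntegral.integrableOn_Ioo_rpow_iff hR).2 (by linarith)
    refine h1.congr_fun (fun x hx => ?_) measurableSet_Ioo
    have hx0 : 0 < x := hx.1
    simp only [Module.finrank_fin_fun, smul_eq_mul]
    rw [← Real.rpow_natCast, ← Real.rpow_add hx0, Nat.cast_sub hm]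
    congr 1
    push_cast
    ring
  have h2 := h.lintegral_lt_top
  refine lt_of_le_of_lt (lintegral_mono_ae ?_) h2
  have h0 : ∀ᵐ v : Fin m → ℝ ∂(volume.restrict (ball 0 R)), v ≠ 0 :=
    ae_restrict_of_ae (by simp [ae_iff])
  filter_upwards [h0] with v hv
  rw [edist_zero_right, ← ofReal_norm, ENNReal.ofReal_rpow_of_pos (norm_pos_iff.2 hv)]

lemma measurable_riesz {E : Type*} [PseudoEMetricSpace E] [MeasurableSpace E]
    [OpensMeasurableSpace E] [SecondCountableTopology E] (β : ℝ) :
    Measurable fun p : E × E => edist p.1 p.2 ^ (-β) :=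
  (measurable_edist).pow_const _

/-- Riesz energies of the uniform measure on the sphere are uniformly bounded. -/
lemma exists_riesz_bound {m : ℕ} (hm : 1 ≤ m) {β : ℝ} (hβ0 : 0 ≤ β) (hβ : β < m) {r : ℝ}
    (hr : 0 < r) :
    ∃ C : ENNReal, C ≠ ⊤ ∧ ∀ y ∈ sphere (0 : Euc (m + 1)) r,
      ∫⁻ x, edist x y ^ (-β) ∂(sphereUniform (m + 1) r) ≤ C := by
  set σ := sphereUniform (m + 1) r with hσ
  have : IsProbabilityMeasure σ := isProbabilityMeasure_sphereUniform m hr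
  set B := closedBall (0 : Fin m → ℝ) (r / (m + 1)) with hB
  set A : ENNReal := ∫⁻ v in ball (0 : Fin m → ℝ) (3 * r), edist v 0 ^ (-β) with hA
  have hAtop : A < ⊤ := lintegral_riesz_pi_lt_top hm hβ _
  have hBpos : volume B ≠ 0 := (measure_closedBall_pos _ _ (by positivity)).ne'
  have hBtop : volume B ≠ ⊤ := measure_closedBall_lt_top.ne
  refine ⟨A / volume B, (ENNReal.div_lt_top hAtop.ne hBpos).ne, ?_⟩
  intro y hy
  set I := ∫⁻ x, edist x y ^ (-β) ∂σ with hI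
  have hconst : ∀ y' ∈ sphere (0 : Euc (m + 1)) r, ∫⁻ x, edist x y' ^ (-β) ∂σ = I := by
    intro y' hy'
    have hn : ‖y‖ = ‖y'‖ := by rw [mem_sphere_zero_iff_norm.1 hy, mem_sphere_zero_iff_norm.1 hy']
    set L := Submodule.reflection (ℝ ∙ (y - y'))ᗮ with hL
    have hLy : L y = y' := Submodule.reflection_sub hn
    have hmp := measurePreserving_sphereUniform m r L
    rw [← hσ] at hmp
    have hmeas : Measurable fun x : Euc (m + 1) => edist x y' ^ (-β) :=
      (measurable_riesz β).comp (measurable_id.prodMk measurable_const)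
    rw [← hmp.lintegral_comp hmeas, hI]
    refine lintegral_congr fun x => ?_
    rw [← hLy, L.isometry.edist_eq]
  have hkey : volume B * I ≤ A := by
    calc volume B * I = ∫⁻ _v in B, I ∂(volume : Measure (Fin m → ℝ)) := by rw [lintegral_const, Measure.restrict_apply_univ, mul_comm]
      _ = ∫⁻ v in B, (∫⁻ x, edist x (sphLift r v) ^ (-β) ∂σ) := by
          refine setLIntegral_congr_fun isClosed_closedBall.measurableSet fun v hv => ?_
          exact (hconst _ (by simpa using norm_sphLift hr hv)).symm
      _ = ∫⁻ x, (∫⁻ v in B, edist x (sphLift r v) ^ (-β)) ∂σ := by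
          rw [lintegral_lintegral_swap]
          refine Measurable.aemeasurable ?_
          exact (measurable_riesz β).comp
            (measurable_snd.prodMk ((continuous_sphLift r).measurable.comp measurable_fst))
      _ ≤ ∫⁻ _x, A ∂σ := by
          refine lintegral_mono_ae ?_
          filter_upwards [ae_sphereUniform_mem m r] with x hx
          have hxr : ‖x‖ = r := by simpa using hx
          calc ∫⁻ v in B, edist x (sphLift r v) ^ (-β)
              ≤ ∫⁻ v in B, edist (tailProj x) v ^ (-β) := by
                refine lintegral_mono fun v => ?_
                rw [ENNReal.rpow_neg, ENNReal.rpow_neg]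
                refine ENNReal.inv_le_inv.2 (ENNReal.rpow_le_rpow ?_ hβ0)
                have := lipschitz_tailProj (m := m) x (sphLift r v)
                rwa [tailProj_sphLift, ENNReal.coe_one, one_mul] at this
            _ ≤ ∫⁻ v in (fun v => v - tailProj x) ⁻¹' ball 0 (3 * r),
                  edist (v - tailProj x) 0 ^ (-β) := by
                have h1 : ∀ v, edist (tailProj x) v = edist (v - tailProj x) 0 := by
                  intro v
                  rw [edist_comm, edist_zero_right, edist_eq_enorm_sub]
                simp_rw [h1]
                refine lintegral_mono_set fun v hv => ?_
                rw [mem_preimage, mem_ball_zero_iff]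
                have h2 : ‖tailProj x‖ ≤ r := by
                  have := (lipschitz_tailProj (m := m)).dist_le_mul x 0
                  have h0 : tailProj (0 : Euc (m + 1)) = 0 := by ext j; simp [tailProj]
                  rw [h0, dist_zero_right, dist_zero_right, NNReal.coe_one, one_mul, hxr] at this
                  exact this
                have h3 : ‖v‖ ≤ r := by
                  have h4 : ‖v‖ ≤ r / (m + 1) := by simpa [hB] using hv
                  refine h4.trans (div_le_self hr.le ?_)
                  have : (0 : ℝ) ≤ m := Nat.cast_nonneg m
                  linarith
                linarith [norm_sub_le v (tailProj x)]
            _ = A := by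
                have hmp := measurePreserving_sub_right (volume : Measure (Fin m → ℝ)) (tailProj x)
                rw [hA]
                refine hmp.setLIntegral_comp_preimage isOpen_ball.measurableSet
                  (f := fun v => edist v 0 ^ (-β)) ?_
                exact (measurable_riesz β).comp (measurable_id.prodMk measurable_const)
      _ = A := by simp
  rw [ENNReal.le_div_iff_mul_le (Or.inl hBpos) (Or.inl hBtop), mul_comm]
  exact hkey

lemma lintegral_pi_riesz_le {n : ℕ} {E : Type*} [PseudoEMetricSpace E] [MeasurableSpace E]
    [OpensMeasurableSpace E] [SecondCountableTopology E] (σ : Measure E) [IsProbabilityMeasure σ]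
    {S : Set E} (hS : ∀ᵐ x ∂σ, x ∈ S) {β : ℝ} {C : ENNReal}
    (hC : ∀ y ∈ S, ∫⁻ x, edist x y ^ (-β) ∂σ ≤ C) (k : Fin (n + 1)) (j : Fin n)
    {F : (Fin n → E) → ENNReal} (hF : Measurable F) :
    ∫⁻ z, F (fun i => z (k.succAbove i)) * edist (z k) (z (k.succAbove j)) ^ (-β)
      ∂(Measure.pi fun _ : Fin (n + 1) => σ) ≤
      C * ∫⁻ y, F y ∂(Measure.pi fun _ : Fin n => σ) := by
  have hmp := measurePreserving_piFinSuccAbove (fun _ : Fin (n + 1) => σ) k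
  have hmeas : Measurable fun p : E × (Fin n → E) => F p.2 * edist p.1 (p.2 j) ^ (-β) :=
    (hF.comp measurable_snd).mul ((measurable_riesz β).comp (g := fun p : E × E => _)
      (f := fun p : E × (Fin n → E) => (p.1, p.2 j))
      (measurable_fst.prodMk ((measurable_pi_apply j).comp measurable_snd)))
  calc _ = ∫⁻ z, (fun p : E × (Fin n → E) => F p.2 * edist p.1 (p.2 j) ^ (-β))
            (MeasurableEquiv.piFinSuccAbove (fun _ => E) k z)
            ∂(Measure.pi fun _ : Fin (n + 1) => σ) := rfl
    _ = ∫⁻ p, F p.2 * edist p.1 (p.2 j) ^ (-β) ∂(σ.prod (Measure.pi fun _ : Fin n => σ)) :=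
        hmp.lintegral_comp hmeas
    _ = ∫⁻ y, ∫⁻ x, F y * edist x (y j) ^ (-β) ∂σ ∂(Measure.pi fun _ : Fin n => σ) :=
        lintegral_prod_symm' _ hmeas
    _ ≤ ∫⁻ y, C * F y ∂(Measure.pi fun _ : Fin n => σ) := by
        refine lintegral_mono_ae ?_
        have : ∀ᵐ y ∂(Measure.pi fun _ : Fin n => σ), y j ∈ S :=
          (measurePreserving_eval (fun _ : Fin n => σ) j).quasiMeasurePreserving.ae hS
        filter_upwards [this] with y hy
        have hm' : Measurable fun x : E => edist x (y j) ^ (-β) := measurable_edist_left.pow_const _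
        rw [lintegral_const_mul _ hm', mul_comm]
        gcongr
        exact hC _ hy
    _ = _ := lintegral_const_mul _ hF

/-- Distance from `z i` to the other points of a configuration. -/
def nnDist {d : ℕ} (z : Fin 4 → Euc d) (i : Fin 4) : ℝ :=
  ⨅ j : {j : Fin 4 // j ≠ i}, dist (z i) (z j.1)

lemma nnDist_le {d : ℕ} (z : Fin 4 → Euc d) {i j : Fin 4} (h : j ≠ i) :
    nnDist z i ≤ dist (z i) (z j) :=
  ciInf_le (f := fun j : {j : Fin 4 // j ≠ i} => dist (z i) (z j.1))
    (Set.finite_range _).bddBelow ⟨j, h⟩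

lemma exists_nnDist_eq {d : ℕ} (z : Fin 4 → Euc d) (i : Fin 4) :
    ∃ j, j ≠ i ∧ nnDist z i = dist (z i) (z j) := by
  have : Nonempty {j : Fin 4 // j ≠ i} := ⟨⟨i + 1, by revert i; decide⟩⟩
  obtain ⟨j, hj⟩ := exists_eq_ciInf_of_finite (f := fun j : {j : Fin 4 // j ≠ i} => dist (z i) (z j.1))
  exact ⟨j.1, j.2, hj.symm⟩

lemma nnDist_nonneg {d : ℕ} (z : Fin 4 → Euc d) (i : Fin 4) : 0 ≤ nnDist z i := by
  obtain ⟨j, -, h⟩ := exists_nnDist_eq z i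
  rw [h]; exact dist_nonneg

lemma nnDist_pos {d : ℕ} {z : Fin 4 → Euc d} (hz : Function.Injective z) (i : Fin 4) :
    0 < nnDist z i := by
  obtain ⟨j, hj, h⟩ := exists_nnDist_eq z i
  rw [h]; exact dist_pos.2 fun h' => hj (hz h').symm

lemma exists_complement_pair : ∀ p q : Fin 4, p ≠ q → ∃ k l : Fin 4,
    k ≠ p ∧ k ≠ q ∧ l ≠ p ∧ l ≠ q ∧ k ≠ l ∧ (Finset.univ : Finset (Fin 4)) = {p, q, k, l} := by
  decide

lemma exists_prod_nnDist_le {d : ℕ} {α : ℝ} (hα : 0 ≤ α) {z : Fin 4 → Euc d}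
    (hz : Function.Injective z) :
    ∃ p q k j : Fin 4, q ≠ p ∧ k ≠ p ∧ k ≠ q ∧ j ≠ k ∧
      ∏ i, nnDist z i ^ (-α) ≤ dist (z p) (z q) ^ (-(2 * α)) * dist (z k) (z j) ^ (-(2 * α)) := by
  obtain ⟨p, -, hp⟩ := Finset.exists_min_image Finset.univ (nnDist z) ⟨0, Finset.mem_univ _⟩
  obtain ⟨q, hqp, hq⟩ := exists_nnDist_eq z p
  obtain ⟨k, l, hkp, hkq, hlp, hlq, hkl, huniv⟩ := exists_complement_pair p q hqp.symm
  have hprod : ∀ f : Fin 4 → ℝ, ∏ i, f i = f p * f q * (f k * f l) := by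
    intro f
    rw [huniv, Finset.prod_insert, Finset.prod_insert, Finset.prod_insert, Finset.prod_singleton,
      mul_assoc]
    all_goals simp [hkl, hqp.symm, hkp.symm, hlp.symm, hkq.symm, hlq.symm]
  have hpos := nnDist_pos hz
  have hmono : ∀ i i', nnDist z i ≤ nnDist z i' → nnDist z i' ^ (-α) ≤ nnDist z i ^ (-α) :=
    fun i i' h => Real.rpow_le_rpow_of_nonpos (hpos i) h (by linarith)
  have hsq : ∀ i, nnDist z i ^ (-α) * nnDist z i ^ (-α) = nnDist z i ^ (-(2 * α)) := by
    intro i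
    rw [← Real.rpow_add (hpos i)]
    congr 1
    ring
  have hnn : ∀ i, 0 ≤ nnDist z i ^ (-α) := fun i => Real.rpow_nonneg (hpos i).le _
  rw [hprod]
  rcases le_total (nnDist z k) (nnDist z l) with h | h
  · obtain ⟨j, hj, hjk⟩ := exists_nnDist_eq z k
    refine ⟨p, q, k, j, hqp, hkp, hkq, hj, ?_⟩
    rw [← hq, ← hjk, ← hsq, ← hsq]
    have h1 := hmono p q (hp q (Finset.mem_univ _))
    have h2 := hmono k l h
    exact mul_le_mul (mul_le_mul_of_nonneg_left h1 (hnn p)) (mul_le_mul_of_nonneg_left h2 (hnn k))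
      (mul_nonneg (hnn _) (hnn _)) (mul_nonneg (hnn _) (hnn _))
  · obtain ⟨j, hj, hjk⟩ := exists_nnDist_eq z l
    refine ⟨p, q, l, j, hqp, hlp, hlq, hj, ?_⟩
    rw [← hq, ← hjk, ← hsq, ← hsq]
    have h1 := hmono p q (hp q (Finset.mem_univ _))
    have h2 := hmono l k h
    exact mul_le_mul (mul_le_mul_of_nonneg_left h1 (hnn p)) (mul_le_mul_of_nonneg_right h2 (hnn l))
      (mul_nonneg (hnn _) (hnn _)) (mul_nonneg (hnn _) (hnn _))

lemma ae_injective_pi {E : Type*} [MetricSpace E] [MeasurableSpace E]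
    [BorelSpace E] [SecondCountableTopology E] (σ : Measure E) [IsProbabilityMeasure σ]
    (hσ : ∀ x, σ {x} = 0) :
    ∀ᵐ z ∂(Measure.pi fun _ : Fin 4 => σ), Function.Injective z := by
  have h : ∀ k : Fin 4, ∀ j : Fin 3, ∀ᵐ z ∂(Measure.pi fun _ : Fin 4 => σ),
      z k ≠ z (k.succAbove j) := by
    intro k j
    have hmp := measurePreserving_piFinSuccAbove (fun _ : Fin 4 => σ) k
    have hms : MeasurableSet {p : E × (Fin 3 → E) | p.1 = p.2 j} :=
      measurableSet_eq_fun measurable_fst ((measurable_pi_apply j).comp measurable_snd)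
    have h0 : σ.prod (Measure.pi fun _ : Fin 3 => σ) {p | p.1 = p.2 j} = 0 := by
      rw [Measure.prod_apply_symm hms]
      refine (lintegral_congr fun y => ?_).trans lintegral_zero
      exact hσ (y j)
    have h1 := hmp.measure_preimage hms.nullMeasurableSet
    rw [ae_iff]
    have h2 : {z : Fin 4 → E | ¬ z k ≠ z (k.succAbove j)} =
        (MeasurableEquiv.piFinSuccAbove (fun _ => E) k) ⁻¹' {p | p.1 = p.2 j} := by
      ext z; simp [Fin.removeNth]
    rw [h2]
    exact h1.trans h0
  have h' := (ae_all_iff.2 fun k => ae_all_iff.2 fun j => h k j)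
  filter_upwards [h'] with z hz i j hij
  by_contra hne
  obtain ⟨jj, rfl⟩ := Fin.exists_succAbove_eq (Ne.symm hne)
  exact hz i jj hij

/-- The product of the inverse nearest-neighbour distances is dominated by an integrable function. -/
lemma exists_integrable_dominating {m : ℕ} (hm : 1 ≤ m) {α : ℝ} (hα : 0 ≤ α) (hα' : 2 * α < m)
    {r : ℝ} (hr : 0 < r) :
    ∃ G : (Fin 4 → Euc (m + 1)) → ℝ,
      Integrable G (Measure.pi fun _ : Fin 4 => sphereUniform (m + 1) r) ∧
      ∀ z, Function.Injective z → ∏ i, nnDist z i ^ (-α) ≤ G z := by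
  have := isProbabilityMeasure_sphereUniform m hr
  set σ := sphereUniform (m + 1) r with hσ
  obtain ⟨C, hC, hCb⟩ := exists_riesz_bound hm (β := 2 * α) (by linarith) hα' hr
  set T : Finset (Fin 4 × Fin 4 × Fin 4 × Fin 4) :=
    Finset.univ.filter fun t => t.2.1 ≠ t.1 ∧ t.2.2.1 ≠ t.1 ∧ t.2.2.1 ≠ t.2.1 ∧ t.2.2.2 ≠ t.2.2.1
    with hT
  set g : Fin 4 × Fin 4 × Fin 4 × Fin 4 → (Fin 4 → Euc (m + 1)) → ENNReal := fun t z =>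
    edist (z t.1) (z t.2.1) ^ (-(2 * α)) * edist (z t.2.2.1) (z t.2.2.2) ^ (-(2 * α)) with hg
  have hmeas1 : ∀ (n : ℕ) (i j : Fin n), Measurable fun z : Fin n → Euc (m + 1) =>
      edist (z i) (z j) ^ (-(2 * α)) := fun n i j =>
    (measurable_riesz (2 * α)).comp ((measurable_pi_apply i).prodMk (measurable_pi_apply j))
  have hgmeas : ∀ t, Measurable (g t) := fun t => (hmeas1 _ _ _).mul (hmeas1 _ _ _)
  have hfin : ∀ t ∈ T, ∫⁻ z, g t z ∂(Measure.pi fun _ : Fin 4 => σ) ≤ C * C := by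
    rintro ⟨p, q, k, j⟩ ht
    simp only [hT, Finset.mem_filter, Finset.mem_univ, true_and] at ht
    obtain ⟨hqp, hkp, hkq, hjk⟩ := ht
    obtain ⟨p', rfl⟩ := Fin.exists_succAbove_eq hkp.symm
    obtain ⟨q', rfl⟩ := Fin.exists_succAbove_eq hkq.symm
    obtain ⟨j', rfl⟩ := Fin.exists_succAbove_eq hjk
    have hqp' : q' ≠ p' := fun h => hqp (by rw [h])
    obtain ⟨q'', rfl⟩ := Fin.exists_succAbove_eq hqp'
    have h1 := lintegral_pi_riesz_le σ (ae_sphereUniform_mem m r) hCb k j'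
      (hmeas1 3 p' (p'.succAbove q''))
    refine h1.trans ?_
    gcongr
    have h2 := lintegral_pi_riesz_le σ (ae_sphereUniform_mem m r) hCb p' q''
      (F := fun _ => 1) measurable_const
    simpa using h2
  have hGmeas : Measurable fun z => ∑ t ∈ T, g t z := Finset.measurable_sum _ fun t _ => hgmeas t
  have hGfin : ∫⁻ z, ∑ t ∈ T, g t z ∂(Measure.pi fun _ : Fin 4 => σ) ≠ ⊤ := by
    rw [lintegral_finsetSum _ fun t _ => hgmeas t]
    refine (ENNReal.sum_lt_top.2 fun t ht => (hfin t ht).trans_lt ?_).ne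
    exact ENNReal.mul_lt_top hC.lt_top hC.lt_top
  refine ⟨fun z => (∑ t ∈ T, g t z).toReal,
    integrable_toReal_of_lintegral_ne_top hGmeas.aemeasurable hGfin, ?_⟩
  intro z hz
  obtain ⟨p, q, k, j, hqp, hkp, hkq, hjk, hle⟩ := exists_prod_nnDist_le hα hz
  have hreal : ∀ a b : Fin 4, a ≠ b → edist (z a) (z b) ^ (-(2 * α)) =
      ENNReal.ofReal (dist (z a) (z b) ^ (-(2 * α))) := by
    intro a b hab
    rw [edist_dist, ENNReal.ofReal_rpow_of_pos (dist_pos.2 fun h => hab (hz h))]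
  have hgt : ∀ t ∈ T, g t z ≠ ⊤ := by
    rintro ⟨p, q, k, j⟩ ht
    simp only [hT, Finset.mem_filter, Finset.mem_univ, true_and] at ht
    obtain ⟨hqp, -, -, hjk⟩ := ht
    simp only [hg]
    rw [hreal _ _ hqp.symm, hreal _ _ hjk.symm]
    exact ENNReal.mul_ne_top ENNReal.ofReal_ne_top ENNReal.ofReal_ne_top
  refine hle.trans ?_
  beta_reduce
  rw [ENNReal.toReal_sum hgt]
  have hmem : (p, q, k, j) ∈ T := by
    simp only [hT, Finset.mem_filter, Finset.mem_univ, true_and]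
    exact ⟨hqp, hkp, hkq, hjk⟩
  refine le_trans ?_ (Finset.single_le_sum (f := fun t => (g t z).toReal)
    (fun t _ => ENNReal.toReal_nonneg) hmem)
  simp only [hg]
  rw [hreal _ _ hqp.symm, hreal _ _ hjk.symm, ENNReal.toReal_mul,
    ENNReal.toReal_ofReal (Real.rpow_nonneg dist_nonneg _),
    ENNReal.toReal_ofReal (Real.rpow_nonneg dist_nonneg _)]

lemma integrable_of_zero_off_ball {m : ℕ} {g : Euc m → ℝ} (hg : Continuous g) (R : ℝ)
    (h0 : ∀ x, R < ‖x‖ → g x = 0) : Integrable g := by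
  refine hg.integrable_of_hasCompactSupport
    (HasCompactSupport.intro (isCompact_closedBall (0 : Euc m) R) fun x hx => h0 x ?_)
  simpa using hx

lemma hasFDerivAt_radial_primitive {m : ℕ} {p : ℝ → ℝ} (hp : Continuous p) (T : ℝ) (x : Euc m) :
    HasFDerivAt (fun x : Euc m => (1 / 2 : ℝ) * ∫ t in T..‖x‖ ^ 2, p t)
      (p (‖x‖ ^ 2) • innerSL ℝ x) x := by
  have h1 : HasDerivAt (fun s => ∫ t in T..s, p t) (p (‖x‖ ^ 2)) (‖x‖ ^ 2) :=
    intervalIntegral.integral_hasDerivAt_right (hp.intervalIntegrable _ _)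
      hp.aestronglyMeasurable.stronglyMeasurableAtFilter hp.continuousAt
  have h2 := (h1.comp_hasFDerivAt x (hasStrictFDerivAt_norm_sq x).hasFDerivAt).const_mul (1 / 2 : ℝ)
  refine h2.congr_fderiv (ContinuousLinearMap.ext fun v => ?_)
  simp
  ring

lemma radial_mvp_of_contDiff {m : ℕ} {U : Euc m → ℝ} (hU : ContDiff ℝ 2 U)
    (hUc : HasCompactSupport U) {ρ : ℝ} (hρ : 0 < ρ) {a : Euc m}
    (hlap : ∀ x ∈ ball a ρ, lap U x = 0) {p : ℝ → ℝ} (hp : Continuous p)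
    {T : ℝ} (hT : T ≤ ρ ^ 2) (hp0 : ∀ t, T ≤ t → p t = 0) :
    ∫ x, U (a + x) * p (‖x‖ ^ 2) = U a * ∫ x : Euc m, p (‖x‖ ^ 2) := by
  set Ψ : Euc m → ℝ := fun x => (1 / 2 : ℝ) * ∫ t in T..‖x‖ ^ 2, p t with hΨ
  have hΨd : ∀ x, HasFDerivAt Ψ (p (‖x‖ ^ 2) • innerSL ℝ x) x := hasFDerivAt_radial_primitive hp T
  have hbig : ∀ x : Euc m, ρ ≤ ‖x‖ → T ≤ ‖x‖ ^ 2 := fun x hx => hT.trans (by gcongr)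
  have hΨ0 : ∀ x, ρ ≤ ‖x‖ → Ψ x = 0 := by
    intro x hx
    have h1 : ∫ t in T..‖x‖ ^ 2, p t = ∫ t in T..‖x‖ ^ 2, (0 : ℝ) :=
      intervalIntegral.integral_congr fun t ht => by
        rw [uIcc_of_le (hbig x hx)] at ht
        exact hp0 t ht.1
    simp [hΨ, h1]
  have hΨc : Continuous Ψ := continuous_iff_continuousAt.2 fun x => (hΨd x).continuousAt
  have hpc : Continuous fun x : Euc m => p (‖x‖ ^ 2) := by fun_prop
  have hU1 : Continuous (fderiv ℝ U) := hU.continuous_fderiv (by norm_num)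
  have hdU : ContDiff ℝ 1 (fderiv ℝ U) := hU.fderiv_right (by norm_num)
  obtain ⟨C, hC⟩ := (hUc.fderiv ℝ).exists_bound_of_continuous hU1
  -- the derivative of `t ↦ ∫ U (a + t x) p (‖x‖²)` vanishes
  have hzero : ∀ t : ℝ, t ∈ Icc (0 : ℝ) 1 →
      ∫ x, fderiv ℝ U (a + t • x) x * p (‖x‖ ^ 2) = 0 := by
    intro t ht
    have hV : ∀ i : Fin m, Differentiable ℝ
        fun x : Euc m => fderiv ℝ U (a + t • x) (EuclideanSpace.single i 1) := by
      intro i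
      have : ContDiff ℝ 1 fun x : Euc m => fderiv ℝ U (a + t • x) (EuclideanSpace.single i 1) :=
        (hdU.comp (by fun_prop : ContDiff ℝ 1 fun x : Euc m => a + t • x)).clm_apply contDiff_const
      exact this.differentiable (by norm_num)
    have hVd : ∀ (i : Fin m) (x : Euc m),
        fderiv ℝ (fun x : Euc m => fderiv ℝ U (a + t • x) (EuclideanSpace.single i 1)) x
          (EuclideanSpace.single i 1) = t * iteratedFDeriv ℝ 2 U (a + t • x)
            ![EuclideanSpace.single i 1, EuclideanSpace.single i 1] := by
      intro i x
      have h1 : HasFDerivAt (fderiv ℝ U) (fderiv ℝ (fderiv ℝ U) (a + t • x)) (a + t • x) :=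
        (hdU.differentiable (by norm_num) _).hasFDerivAt
      have h2 : HasFDerivAt (fun x : Euc m => a + t • x) (t • ContinuousLinearMap.id ℝ (Euc m)) x :=
        ((hasFDerivAt_id x).const_smul t).const_add a
      have h3 := (h1.comp x h2).clm_apply
        (hasFDerivAt_const (EuclideanSpace.single i (1 : ℝ) : Euc m) x)
      have h4 := h3.fderiv
      rw [show (fun x : Euc m => fderiv ℝ U (a + t • x) (EuclideanSpace.single i 1)) =
        fun x => (fderiv ℝ U ∘ fun x => a + t • x) x (EuclideanSpace.single i 1) from rfl, h4,
        iteratedFDeriv_two_apply]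
      simp
    have hcont2 : ∀ i : Fin m, Continuous fun x : Euc m => iteratedFDeriv ℝ 2 U (a + t • x)
        ![EuclideanSpace.single i 1, EuclideanSpace.single i 1] := by
      intro i
      have h1 : Continuous (iteratedFDeriv ℝ 2 U) := hU.continuous_iteratedFDeriv le_rfl
      have h2 : Continuous fun x : Euc m => iteratedFDeriv ℝ 2 U (a + t • x) :=
        h1.comp (by fun_prop)
      exact h2.eval_const _
    have hVc : ∀ i : Fin m, Continuous fun x : Euc m =>
        fderiv ℝ U (a + t • x) (EuclideanSpace.single i 1) := fun i => (hV i).continuous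
    have hΨi : ∀ (i : Fin m) (x : Euc m), fderiv ℝ Ψ x (EuclideanSpace.single i 1) =
        p (‖x‖ ^ 2) * x i := by
      intro i x
      rw [(hΨd x).fderiv]
      simp [EuclideanSpace.inner_single_right]
    have hbp : ∀ i : Fin m, ∫ x : Euc m, fderiv ℝ U (a + t • x) (EuclideanSpace.single i 1) *
        (p (‖x‖ ^ 2) * x i) = - ∫ x : Euc m, (t * iteratedFDeriv ℝ 2 U (a + t • x)
            ![EuclideanSpace.single i 1, EuclideanSpace.single i 1]) * Ψ x := by
      intro i
      have := integral_mul_fderiv_eq_neg_fderiv_mul_of_integrable (μ := volume)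
        (f := fun x : Euc m => fderiv ℝ U (a + t • x) (EuclideanSpace.single i 1)) (g := Ψ)
        (v := EuclideanSpace.single i 1) ?_ ?_ ?_ (fun x _ => hV i x)
        (fun x _ => (hΨd x).differentiableAt)
      · simpa only [hVd, hΨi] using this
      · simp only [hVd]
        refine integrable_of_zero_off_ball (by have := hcont2 i; fun_prop) ρ fun x hx => ?_
        rw [hΨ0 x hx.le, mul_zero]
      · simp only [hΨi]
        refine integrable_of_zero_off_ball (by have := hVc i; fun_prop) ρ fun x hx => ?_
        rw [hp0 _ (hbig x hx.le)]; ring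
      · refine integrable_of_zero_off_ball (by have := hVc i; fun_prop) ρ fun x hx => ?_
        rw [hΨ0 x hx.le, mul_zero]
    have hexp : ∀ x : Euc m, fderiv ℝ U (a + t • x) x * p (‖x‖ ^ 2) =
        ∑ i, fderiv ℝ U (a + t • x) (EuclideanSpace.single i 1) * (p (‖x‖ ^ 2) * x i) := by
      intro x
      have hx : x = ∑ i, x i • (EuclideanSpace.single i (1 : ℝ) : Euc m) := by
        have := (EuclideanSpace.basisFun (Fin m) ℝ).sum_repr x
        simpa using this.symm
      conv_lhs => enter [1, 2]; rw [hx]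
      rw [map_sum, Finset.sum_mul]
      refine Finset.sum_congr rfl fun i _ => ?_
      rw [map_smul, smul_eq_mul]; ring
    simp_rw [hexp]
    rw [integral_finsetSum]
    · simp_rw [hbp]
      rw [Finset.sum_neg_distrib, ← integral_finsetSum]
      · rw [neg_eq_zero]
        refine (integral_congr_ae (ae_of_all _ fun x => ?_)).trans (integral_zero _ _)
        beta_reduce
        rcases lt_or_ge ‖x‖ ρ with hx | hx
        · rw [← Finset.sum_mul, ← Finset.mul_sum]
          have hmem : a + t • x ∈ ball a ρ := by
            rw [mem_ball_iff_norm, add_sub_cancel_left, norm_smul, Real.norm_of_nonneg ht.1]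
            exact (mul_le_of_le_one_left (norm_nonneg _) ht.2).trans_lt hx
          have := hlap _ hmem
          rw [lap] at this
          rw [this]; simp
        · simp [hΨ0 x hx]
      · intro i _
        refine integrable_of_zero_off_ball (by have := hcont2 i; fun_prop) ρ fun x hx => ?_
        rw [hΨ0 x hx.le, mul_zero]
    · intro i _
      refine integrable_of_zero_off_ball (by have := hVc i; fun_prop) ρ fun x hx => ?_
      rw [hp0 _ (hbig x hx.le)]; ring
  have hderiv : ∀ t : ℝ, HasDerivAt (fun t : ℝ => ∫ x, U (a + t • x) * p (‖x‖ ^ 2))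
      (∫ x, fderiv ℝ U (a + t • x) x * p (‖x‖ ^ 2)) t := by
    intro t
    have hUcont := hU.continuous
    have hcF : ∀ t : ℝ, Continuous fun x : Euc m => U (a + t • x) * p (‖x‖ ^ 2) :=
      fun t => by fun_prop
    refine (hasDerivAt_integral_of_dominated_loc_of_deriv_le (μ := volume) (s := univ)
      (F := fun (t : ℝ) (x : Euc m) => U (a + t • x) * p (‖x‖ ^ 2))
      (F' := fun (t : ℝ) (x : Euc m) => fderiv ℝ U (a + t • x) x * p (‖x‖ ^ 2))
      (bound := fun x : Euc m => C * ‖x‖ * |p (‖x‖ ^ 2)|) univ_mem ?_ ?_ ?_ ?_ ?_ ?_).2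
    · exact Eventually.of_forall fun t => (hcF t).aestronglyMeasurable
    · refine integrable_of_zero_off_ball (hcF t) ρ fun x hx => ?_
      rw [hp0 _ (hbig x hx.le), mul_zero]
    · have : Continuous fun x : Euc m => fderiv ℝ U (a + t • x) x * p (‖x‖ ^ 2) := by fun_prop
      exact this.aestronglyMeasurable
    · refine ae_of_all _ fun x s _ => ?_
      rw [norm_mul, Real.norm_eq_abs (p _)]
      gcongr
      exact ((fderiv ℝ U (a + s • x)).le_opNorm x).trans (by gcongr; exact hC _)
    · refine integrable_of_zero_off_ball (by fun_prop) ρ fun x hx => ?_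
      rw [hp0 _ (hbig x hx.le), abs_zero, mul_zero]
    · refine ae_of_all _ fun x s _ => ?_
      have h1 : HasFDerivAt U (fderiv ℝ U (a + s • x)) (a + s • x) :=
        (hU.differentiable (by norm_num) _).hasFDerivAt
      have h2 : HasDerivAt (fun s : ℝ => a + s • x) x s := by
        simpa using ((hasDerivAt_id s).smul_const x).const_add a
      exact (h1.comp_hasDerivAt s h2).mul_const _
  have hconst := constant_of_has_deriv_right_zero (f := fun t : ℝ => ∫ x, U (a + t • x) * p (‖x‖ ^ 2))
    (a := 0) (b := 1) (fun t _ => (hderiv t).continuousAt.continuousWithinAt)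
    (fun t ht => by
      have := (hderiv t).hasDerivWithinAt (s := Ici t)
      rwa [hzero t ⟨ht.1, ht.2.le⟩] at this) 1 ⟨zero_le_one, le_rfl⟩
  simpa [integral_const_mul] using hconst

lemma IsHarmonicOn.exists_contDiff {m : ℕ} {u : Euc m → ℝ} {a : Euc m} {R ρ : ℝ}
    (hu : IsHarmonicOn u (ball a R)) (hρ : 0 < ρ) (hρR : ρ < R) :
    ∃ U : Euc m → ℝ, ContDiff ℝ 2 U ∧ HasCompactSupport U ∧
      (∀ x ∈ ball a ρ, lap U x = 0) ∧ ∀ x ∈ ball a ρ, U x = u x := by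
  set χ : ContDiffBump a := ⟨ρ, (ρ + R) / 2, hρ, by linarith⟩ with hχ
  set U : Euc m → ℝ := fun x => χ x * u x with hU
  have hts : tsupport χ = closedBall a ((ρ + R) / 2) := χ.tsupport_eq
  have hUeq : ∀ x ∈ ball a ρ, U x = u x := fun x hx => by
    rw [hU]; simp only; rw [χ.one_of_mem_closedBall (ball_subset_closedBall hx), one_mul]
  refine ⟨U, ?_, χ.hasCompactSupport.mul_right, ?_, hUeq⟩
  · rw [contDiff_iff_contDiffAt]
    intro x
    by_cases hx : x ∈ ball a R
    · exact χ.contDiff.contDiffAt.mul (hu.1.contDiffAt (isOpen_ball.mem_nhds hx))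
    · have hx' : x ∉ tsupport χ := by
        rw [hts]; intro h; apply hx
        rw [mem_closedBall] at h; rw [mem_ball]; linarith
      have : U =ᶠ[𝓝 x] fun _ => 0 := by
        filter_upwards [notMem_tsupport_iff_eventuallyEq.1 hx'] with y hy
        simp only [hU, hy]; simp
      exact contDiffAt_const.congr_of_eventuallyEq this
  · intro x hx
    rw [← hu.2 x (ball_subset_ball hρR.le hx)]
    have : U =ᶠ[𝓝 x] u := by
      filter_upwards [isOpen_ball.mem_nhds hx] with y hy using hUeq y hy
    simp only [lap]
    rw [this.iteratedFDeriv ℝ 2 |>.eq_of_nhds]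

/-- Mean value property of harmonic functions against radial weights. -/
lemma IsHarmonicOn.integral_mul_radial {m : ℕ} {u : Euc (m + 1) → ℝ} {a : Euc (m + 1)} {R : ℝ}
    (hu : IsHarmonicOn u (ball a R)) {f : Euc (m + 1) → ℝ} (hf : Continuous f) {ρ : ℝ}
    (hρ : 0 < ρ) (hρR : ρ < R) (hsupp : ∀ x, ρ ≤ ‖x - a‖ → f x = 0)
    (hrad : ∀ x y, ‖x - a‖ = ‖y - a‖ → f x = f y) :
    ∫ x in ball a R, u x * f x = u a * ∫ x, f x := by
  obtain ⟨U, hU, hUc, hlap, hUeq⟩ := hu.exists_contDiff hρ hρR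
  set e : Euc (m + 1) := EuclideanSpace.single 0 1 with he
  have hen : ‖e‖ = 1 := by simp [he]
  set p : ℝ → ℝ := fun t => f (a + √t • e) with hp
  have hpc : Continuous p := by rw [hp]; fun_prop
  have hpf : ∀ x, p (‖x‖ ^ 2) = f (a + x) := fun x => hrad _ _ (by
    rw [add_sub_cancel_left, add_sub_cancel_left, norm_smul, hen, mul_one,
      Real.sqrt_sq (norm_nonneg _), norm_norm])
  have hmain := radial_mvp_of_contDiff hU hUc hρ hlap hpc (T := ρ ^ 2) le_rfl (fun t ht => by
    refine hsupp _ ?_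
    rw [add_sub_cancel_left, norm_smul, hen, mul_one, Real.norm_of_nonneg (Real.sqrt_nonneg _)]
    exact Real.le_sqrt_of_sq_le ht)
  simp_rw [hpf] at hmain
  rw [integral_add_left_eq_self (μ := volume) f a,
    integral_add_left_eq_self (μ := volume) (fun x => U x * f x) a, hUeq a (mem_ball_self hρ)] at hmain
  rw [← hmain, setIntegral_eq_integral_of_forall_compl_eq_zero]
  · refine integral_congr_ae (ae_of_all _ fun x => ?_)
    beta_reduce
    rcases lt_or_ge ‖x - a‖ ρ with hx | hx
    · rw [hUeq x (by rwa [mem_ball_iff_norm])]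
    · rw [hsupp x hx, mul_zero, mul_zero]
  · intro x hx
    rw [hsupp x, mul_zero]
    rw [mem_ball_iff_norm, not_lt] at hx
    linarith

instance fact_one_le_four_ennreal : Fact ((1 : ENNReal) ≤ 4) := ⟨by norm_num⟩

section L4

variable {Ω : Type*} [MeasurableSpace Ω] {P : Measure Ω}

lemma memLp_four_iff {f : Ω → ℝ} (hf : AEStronglyMeasurable f P) :
    MemLp f 4 P ↔ Integrable (fun ω => f ω ^ 4) P := by
  rw [← integrable_norm_rpow_iff hf (by norm_num) (by norm_num)]
  refine iff_of_eq ?_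
  congr 1
  ext ω
  rw [show (ENNReal.toReal 4) = ((4 : ℕ) : ℝ) by norm_num, Real.rpow_natCast, Real.norm_eq_abs]
  exact (even_two_mul 2).pow_abs _

lemma integrable_prod_of_memLp_four {f : Fin 4 → Ω → ℝ} (hf : ∀ i, MemLp (f i) 4 P) :
    Integrable (fun ω => ∏ i, f i ω) P := by
  have h := MemLp.prod' (s := Finset.univ) (fun i _ => hf i)
  have : (∑ _i : Fin 4, (4 : ENNReal)⁻¹)⁻¹ = 1 := by
    rw [Finset.sum_const, Finset.card_univ, Fintype.card_fin, nsmul_eq_mul]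
    rw [Nat.cast_ofNat, ENNReal.mul_inv_cancel (by norm_num) (by norm_num), inv_one]
  rw [this] at h
  exact memLp_one_iff_integrable.1 h

lemma norm_integral_prod_le_of_memLp_four {f : Fin 4 → Ω → ℝ} (hf : ∀ i, MemLp (f i) 4 P) :
    ‖∫ ω, ∏ i, f i ω ∂P‖ ≤ ∏ i, (eLpNorm (f i) 4 P).toReal := by
  have h1 : ‖∫ ω, ∏ i, f i ω ∂P‖ₑ ≤ ∏ i, eLpNorm (f i) 4 P := by
    refine (enorm_integral_le_lintegral_enorm _).trans ?_
    have h2 := ENNReal.lintegral_prod_norm_pow_le (μ := P) Finset.univ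
      (f := fun i ω => ‖f i ω‖ₑ ^ (4 : ℝ)) (p := fun _ => (1 / 4 : ℝ))
      (fun i _ => (hf i).aestronglyMeasurable.enorm.pow_const _) (by norm_num)
      (fun _ _ => by norm_num)
    refine le_trans (le_of_eq ?_) (h2.trans (le_of_eq ?_))
    · refine lintegral_congr fun ω => ?_
      rw [show ‖∏ i, f i ω‖ₑ = ∏ i, ‖f i ω‖ₑ by simp [enorm_eq_nnnorm, nnnorm_prod]]
      refine Finset.prod_congr rfl fun i _ => ?_
      rw [← ENNReal.rpow_mul]; norm_num
    · refine Finset.prod_congr rfl fun i _ => ?_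
      rw [eLpNorm_eq_lintegral_rpow_enorm_toReal (by norm_num) (by norm_num)]
      norm_num
  have h3 := ENNReal.toReal_mono (ENNReal.prod_ne_top fun i _ => (hf i).eLpNorm_lt_top.ne) h1
  rwa [toReal_enorm, ENNReal.toReal_prod] at h3

lemma integrable_prod_coeFn (X : Fin 4 → Lp ℝ 4 P) : Integrable (fun ω => ∏ i, X i ω) P :=
  integrable_prod_of_memLp_four fun i => Lp.memLp (X i)

/-- The fourth mixed moment as a continuous multilinear form on `L⁴`. -/
def mixedMoment (P : Measure Ω) : ContinuousMultilinearMap ℝ (fun _ : Fin 4 => Lp ℝ 4 P) ℝ :=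
  MultilinearMap.mkContinuous
    { toFun := fun X => ∫ ω, ∏ i, X i ω ∂P
      map_update_add' := by
        intro inst X i x y
        rw [← integral_add (integrable_prod_coeFn _) (integrable_prod_coeFn _)]
        refine integral_congr_ae ?_
        filter_upwards [Lp.coeFn_add x y] with ω hω
        simp only [← Finset.mul_prod_erase Finset.univ _ (Finset.mem_univ i)]
        simp only [Function.update_self, hω, Pi.add_apply, add_mul]
        congr 1 <;> congr 1 <;>
          exact Finset.prod_congr rfl fun j hj => by
            simp only [Function.update_of_ne (Finset.ne_of_mem_erase hj)]
      map_update_smul' := by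
        intro inst X i c x
        rw [smul_eq_mul, ← integral_const_mul]
        refine integral_congr_ae ?_
        filter_upwards [Lp.coeFn_smul c x] with ω hω
        simp only [← Finset.mul_prod_erase Finset.univ _ (Finset.mem_univ i)]
        simp only [Function.update_self, hω, Pi.smul_apply, smul_eq_mul, mul_assoc]
        congr 2
        exact Finset.prod_congr rfl fun j hj => by
            simp only [Function.update_of_ne (Finset.ne_of_mem_erase hj)] } 1
    (fun X => by
      rw [one_mul]
      exact norm_integral_prod_le_of_memLp_four fun i => Lp.memLp (X i))

lemma mixedMoment_apply (X : Fin 4 → Lp ℝ 4 P) : mixedMoment P X = ∫ ω, ∏ i, X i ω ∂P := rfl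

lemma abs_mixedMoment_le (X : Fin 4 → Lp ℝ 4 P) : |mixedMoment P X| ≤ ∏ i, ‖X i‖ :=
  norm_integral_prod_le_of_memLp_four fun i => Lp.memLp (X i)

lemma mixedMoment_toLp {f : Fin 4 → Ω → ℝ} (hf : ∀ i, MemLp (f i) 4 P) :
    mixedMoment P (fun i => (hf i).toLp (f i)) = ∫ ω, ∏ i, f i ω ∂P := by
  rw [mixedMoment_apply]
  refine integral_congr_ae ?_
  have h := ae_all_iff.2 fun i => (hf i).coeFn_toLp
  filter_upwards [h] with ω hω
  exact Finset.prod_congr rfl fun i _ => hω i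

lemma norm_pow_four (X : Lp ℝ 4 P) : ‖X‖ ^ 4 = ∫ ω, X ω ^ 4 ∂P := by
  rw [Lp.norm_def, eLpNorm_eq_lintegral_rpow_enorm_toReal (by norm_num) (by norm_num),
    ← ENNReal.toReal_pow, ← ENNReal.rpow_natCast, ← ENNReal.rpow_mul,
    integral_eq_lintegral_of_nonneg_ae (f := fun ω => X ω ^ 4) (ae_of_all _ fun ω => by positivity)
      ((Lp.aestronglyMeasurable X).pow 4)]
  norm_num
  congr 1
  refine lintegral_congr fun ω => ?_
  rw [← ofReal_norm, ← ENNReal.ofReal_pow (norm_nonneg _), Real.norm_eq_abs]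
  congr 1
  exact (even_two_mul 2).pow_abs _

lemma mixedMoment_diag (X : Lp ℝ 4 P) : mixedMoment P (fun _ => X) = ‖X‖ ^ 4 := by
  rw [mixedMoment_apply, norm_pow_four]
  simp

end L4

section TestFun

variable {d : ℕ} {f g : Euc d → ℝ}

lemma IsTestFun.add (hf : IsTestFun f) (hg : IsTestFun g) : IsTestFun (f + g) :=
  ⟨hf.1.add hg.1, hf.2.add hg.2⟩

lemma IsTestFun.smul (c : ℝ) (hf : IsTestFun f) : IsTestFun (c • f) :=
  ⟨contDiff_const.smul hf.1, hf.2.smul_left (f := fun _ => c)⟩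

lemma IsTestFun.zero : IsTestFun (0 : Euc d → ℝ) := ⟨contDiff_const, HasCompactSupport.zero⟩

lemma IsTestFun.sub (hf : IsTestFun f) (hg : IsTestFun g) : IsTestFun (f - g) := by
  have h : f - g = f + (-1 : ℝ) • g := by ext x; simp [sub_eq_add_neg]
  rw [h]
  exact hf.add (hg.smul _)

lemma IsTestFun.integrable (hf : IsTestFun f) : Integrable f :=
  hf.1.continuous.integrable_of_hasCompactSupport hf.2

end TestFun

section L2

variable {Ω : Type*} [MeasurableSpace Ω] {P : Measure Ω} [IsProbabilityMeasure P]

/-- The `L²` pairing on `L⁴`. -/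
@[irreducible] def pairing (P : Measure Ω) [IsProbabilityMeasure P] (Y Z : Lp ℝ 4 P) : ℝ :=
  mixedMoment P ![Y, Z, (memLp_const (1 : ℝ)).toLp _, (memLp_const (1 : ℝ)).toLp _]

lemma pairing_apply (Y Z : Lp ℝ 4 P) : pairing P Y Z = ∫ ω, Y ω * Z ω ∂P := by
  rw [pairing, mixedMoment_apply]
  refine integral_congr_ae (ae_of_all _ fun ω => ?_)
  beta_reduce
  rw [Fin.prod_univ_four]
  simp

lemma continuous_pairing : Continuous fun p : Lp ℝ 4 P × Lp ℝ 4 P => pairing P p.1 p.2 := by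
  simp only [pairing]
  refine (mixedMoment P).cont.comp (continuous_pi fun i => ?_)
  fin_cases i
  · exact continuous_fst
  · exact continuous_snd
  · exact continuous_const
  · exact continuous_const

lemma tendsto_pairing {ι : Type*} {l : Filter ι} {u v : ι → Lp ℝ 4 P} {a b : Lp ℝ 4 P}
    (hu : Tendsto u l (𝓝 a)) (hv : Tendsto v l (𝓝 b)) :
    Tendsto (fun n => pairing P (u n) (v n)) l (𝓝 (pairing P a b)) := by
  have h1 := (continuous_pairing (P := P)).tendsto (a, b)
  have h2 := hu.prodMk_nhds hv
  exact Tendsto.comp (g := fun p : Lp ℝ 4 P × Lp ℝ 4 P => pairing P p.1 p.2) h1 h2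

lemma eq_zero_of_pairing_self {Z : Lp ℝ 4 P} (h : pairing P Z Z = 0) : Z = 0 := by
  rw [pairing_apply] at h
  have h_int : Integrable (fun ω => Z ω * Z ω) P := by
    have h2 : MemLp Z 2 P := (Lp.memLp Z).mono_exponent (by norm_num)
    simpa [pow_two] using h2.integrable_sq
  have h0 := (integral_eq_zero_iff_of_nonneg (fun ω => mul_self_nonneg _) h_int).1 h
  rw [Lp.eq_zero_iff_ae_eq_zero]
  filter_upwards [h0] with ω hω
  exact mul_self_eq_zero.1 hω

end L2

section Field

variable {d : ℕ} {Ω : Type} [MeasurableSpace Ω] (X : GFF d Ω)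

lemma GFF.memLp_h {f : Euc d → ℝ} (hf : IsTestFun f) : MemLp (X.h 0 1 f) 4 X.P :=
  (memLp_four_iff (X.meas_h 0 1 f).aestronglyMeasurable).2 (X.mom4 f hf)

open Classical in
/-- The field tested against `f`, as an element of `L⁴`. -/
def GFF.hL (f : Euc d → ℝ) : Lp ℝ 4 X.P :=
  if hf : IsTestFun f then (X.memLp_h hf).toLp _ else 0

variable {X} {f g : Euc d → ℝ}

lemma GFF.hL_of_isTestFun (hf : IsTestFun f) : X.hL f = (X.memLp_h hf).toLp _ := dif_pos hf

lemma GFF.coeFn_hL (hf : IsTestFun f) : X.hL f =ᵐ[X.P] X.h 0 1 f := by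
  rw [hL_of_isTestFun hf]; exact MemLp.coeFn_toLp _

lemma GFF.hL_add (hf : IsTestFun f) (hg : IsTestFun g) : X.hL (f + g) = X.hL f + X.hL g := by
  refine Lp.ext ?_
  filter_upwards [coeFn_hL (X := X) (hf.add hg), coeFn_hL (X := X) hf, coeFn_hL (X := X) hg,
    Lp.coeFn_add (X.hL f) (X.hL g), X.lin_add f g hf hg] with ω h1 h2 h3 h4 h5
  rw [h1, h4, Pi.add_apply, h2, h3, h5]

lemma GFF.hL_smul (c : ℝ) (hf : IsTestFun f) : X.hL (c • f) = c • X.hL f := by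
  refine Lp.ext ?_
  filter_upwards [coeFn_hL (X := X) (hf.smul c), coeFn_hL (X := X) hf,
    Lp.coeFn_smul c (X.hL f), X.lin_smul c f hf] with ω h1 h2 h3 h4
  rw [h1, h3, Pi.smul_apply, h2, h4, smul_eq_mul]

lemma GFF.hL_sub (hf : IsTestFun f) (hg : IsTestFun g) : X.hL (f - g) = X.hL f - X.hL g := by
  have h : f - g = f + (-1 : ℝ) • g := by ext x; simp [sub_eq_add_neg]
  rw [h, hL_add hf (hg.smul _), hL_smul _ hg, neg_one_smul, sub_eq_add_neg]

lemma GFF.hL_zero : X.hL 0 = 0 := by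
  simpa using hL_smul (X := X) 0 IsTestFun.zero

lemma GFF.pairing_hL (hf : IsTestFun f) (hg : IsTestFun g) :
    pairing X.P (X.hL f) (X.hL g) = ∫ ω, X.h 0 1 f ω * X.h 0 1 g ω ∂X.P := by
  rw [pairing_apply]
  refine integral_congr_ae ?_
  filter_upwards [coeFn_hL (X := X) hf, coeFn_hL (X := X) hg] with ω h1 h2
  rw [h1, h2]

end Field

section Superposition

variable {d : ℕ} {M : ℕ → ℝ} {K : Set (Euc d)} {F : ℕ → Euc d → ℝ}

/-- Superposition of a sequence of functions with `ℓ¹` coefficients. -/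
def seqSum (F : ℕ → Euc d → ℝ) (c : lp (fun _ : ℕ => ℝ) 1) (x : Euc d) : ℝ := ∑' n, c n * F n x

lemma summable_abs_lp_one (c : lp (fun _ : ℕ => ℝ) 1) : Summable fun n => |c n| := by
  have h := (memℓp_gen_iff (p := 1) (by norm_num)).1 (lp.memℓp c)
  simpa using h

lemma norm_lp_one (c : lp (fun _ : ℕ => ℝ) 1) : ‖c‖ = ∑' n, |c n| := by
  rw [lp.norm_eq_tsum_rpow (by norm_num)]
  simp

lemma norm_iteratedFDeriv_const_mul_le (hF : ∀ n, IsTestFun (F n))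
    (hM : ∀ n m x, ‖iteratedFDeriv ℝ m (F n) x‖ ≤ M m) (c : ℝ) (k n : ℕ) (x : Euc d) :
    ‖iteratedFDeriv ℝ k (fun x => c * F n x) x‖ ≤ |c| * M k := by
  have h : iteratedFDeriv ℝ k (fun x => c * F n x) x = c • iteratedFDeriv ℝ k (F n) x :=
    iteratedFDeriv_const_smul_apply (f := F n) (a := c) ((hF n).1.contDiffAt.of_le (by exact_mod_cast le_top))
  rw [h, norm_smul, Real.norm_eq_abs]
  gcongr
  exact hM n k x

lemma contDiff_seqSum (hF : ∀ n, IsTestFun (F n))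
    (hM : ∀ n m x, ‖iteratedFDeriv ℝ m (F n) x‖ ≤ M m) (c : lp (fun _ : ℕ => ℝ) 1) :
    ContDiff ℝ (⊤ : ℕ∞) (seqSum F c) :=
  contDiff_tsum (v := fun k n => |c n| * M k) (fun n => contDiff_const.mul (hF n).1)
    (fun _ _ => (summable_abs_lp_one c).mul_right _)
    (fun _ _ _ _ => norm_iteratedFDeriv_const_mul_le hF hM _ _ _ _)

lemma norm_iteratedFDeriv_seqSum_le (hF : ∀ n, IsTestFun (F n))
    (hM : ∀ n m x, ‖iteratedFDeriv ℝ m (F n) x‖ ≤ M m) (c : lp (fun _ : ℕ => ℝ) 1) (k : ℕ)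
    (x : Euc d) : ‖iteratedFDeriv ℝ k (seqSum F c) x‖ ≤ ‖c‖ * M k := by
  have h := iteratedFDeriv_tsum_apply (𝕜 := ℝ) (N := (⊤ : ℕ∞)) (f := fun n x => c n * F n x)
    (v := fun k n => |c n| * M k)
    (fun n => contDiff_const.mul (hF n).1) (fun k _ => (summable_abs_lp_one c).mul_right _)
    (fun k n x _ => norm_iteratedFDeriv_const_mul_le hF hM _ _ _ _) (k := k) le_top x
  rw [show seqSum F c = fun y => ∑' n, c n * F n y from rfl, h, norm_lp_one, ← tsum_mul_right]
  exact tsum_of_norm_bounded ((summable_abs_lp_one c).mul_right _).hasSum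
    fun n => norm_iteratedFDeriv_const_mul_le hF hM _ _ _ _

lemma tsupport_seqSum_subset (hK : IsClosed K) (hFK : ∀ n, tsupport (F n) ⊆ K)
    (c : lp (fun _ : ℕ => ℝ) 1) : tsupport (seqSum F c) ⊆ K := by
  refine closure_minimal (fun x hx => ?_) hK
  by_contra hxK
  refine hx ?_
  have : ∀ n, F n x = 0 := fun n => image_eq_zero_of_notMem_tsupport fun h => hxK (hFK n h)
  simp [seqSum, this]

lemma isTestFun_seqSum (hK : IsCompact K) (hFK : ∀ n, tsupport (F n) ⊆ K)
    (hF : ∀ n, IsTestFun (F n)) (hM : ∀ n m x, ‖iteratedFDeriv ℝ m (F n) x‖ ≤ M m)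
    (c : lp (fun _ : ℕ => ℝ) 1) : IsTestFun (seqSum F c) :=
  ⟨contDiff_seqSum hF hM c,
    hK.of_isClosed_subset (isClosed_tsupport _) (tsupport_seqSum_subset hK.isClosed hFK c)⟩

lemma summable_seqSum (hM : ∀ n m x, ‖iteratedFDeriv ℝ m (F n) x‖ ≤ M m)
    (c : lp (fun _ : ℕ => ℝ) 1) (x : Euc d) : Summable fun n => c n * F n x := by
  refine Summable.of_norm_bounded ((summable_abs_lp_one c).mul_right (M 0)) fun n => ?_
  rw [norm_mul, Real.norm_eq_abs]
  gcongr
  simpa using hM n 0 x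

variable {Ω : Type} [MeasurableSpace Ω] (X : GFF d Ω)

/-- The field tested against superpositions, as a linear map on `ℓ¹`. -/
def GFF.seqMap (hK : IsCompact K) (hFK : ∀ n, tsupport (F n) ⊆ K)
    (hF : ∀ n, IsTestFun (F n)) (hM : ∀ n m x, ‖iteratedFDeriv ℝ m (F n) x‖ ≤ M m) :
    lp (fun _ : ℕ => ℝ) 1 →ₗ[ℝ] Lp ℝ 4 X.P where
  toFun c := X.hL (seqSum F c)
  map_add' c c' := by
    rw [← GFF.hL_add (isTestFun_seqSum hK hFK hF hM c) (isTestFun_seqSum hK hFK hF hM c')]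
    congr 1
    ext x
    rw [Pi.add_apply, seqSum, seqSum, seqSum,
      ← (summable_seqSum hM c x).tsum_add (summable_seqSum hM c' x)]
    simp [add_mul]
  map_smul' a c := by
    rw [RingHom.id_apply, ← GFF.hL_smul a (isTestFun_seqSum hK hFK hF hM c)]
    congr 1
    ext x
    rw [Pi.smul_apply, seqSum, seqSum, smul_eq_mul, ← tsum_mul_left]
    simp [mul_assoc]

lemma GFF.continuous_seqMap (hK : IsCompact K) (hKb : K ⊆ ball 0 1)
    (hFK : ∀ n, tsupport (F n) ⊆ K)
    (hF : ∀ n, IsTestFun (F n)) (hM : ∀ n m x, ‖iteratedFDeriv ℝ m (F n) x‖ ≤ M m) :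
    Continuous (X.seqMap hK hFK hF hM) := by
  refine LinearMap.continuous_of_seq_closed_graph _ fun c c₀ Y hc hY => ?_
  set T := X.seqMap hK hFK hF hM with hT
  have htest := fun c => isTestFun_seqSum hK hFK hF hM c
  have hb : Tendsto (fun n => c n - c₀) atTop (𝓝 0) := by
    simpa using hc.sub_const c₀
  have hZ : Tendsto (fun n => T (c n - c₀)) atTop (𝓝 (Y - T c₀)) := by
    simpa [Function.comp_def] using hY.sub_const (T c₀)
  have hweak : ∀ e, pairing X.P (Y - T c₀) (T e) = 0 := by
    intro e
    have h1 : Tendsto (fun n => pairing X.P (T (c n - c₀)) (T e)) atTop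
        (𝓝 (pairing X.P (Y - T c₀) (T e))) :=
      tendsto_pairing hZ tendsto_const_nhds
    have hs0 : tsupport (0 : Euc d → ℝ) ⊆ K := by
      rw [tsupport_eq_empty_iff.2 rfl]; exact empty_subset K
    have hunif : ∀ m : ℕ, TendstoUniformly (fun n => iteratedFDeriv ℝ m (seqSum F (c n - c₀)))
        (iteratedFDeriv ℝ m (0 : Euc d → ℝ)) atTop := by
        intro m
        rw [Metric.tendstoUniformly_iff]
        intro ε hε
        have h3 : Tendsto (fun n => ‖c n - c₀‖ * M m) atTop (𝓝 0) := by
          simpa using (hb.norm.mul_const (M m))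
        filter_upwards [h3.eventually_lt_const hε] with n hn x
        have h4 : iteratedFDeriv ℝ m (0 : Euc d → ℝ) x = 0 := by
          rw [iteratedFDeriv_zero]; rfl
        rw [h4, dist_zero_left]
        exact (norm_iteratedFDeriv_seqSum_le hF hM _ m x).trans_lt hn
    have h2 := X.K2_cont (fun n => seqSum F (c n - c₀)) 0 (seqSum F e) K hK hKb
      (fun n => htest _) IsTestFun.zero (htest e)
      ((tsupport_seqSum_subset hK.isClosed hFK e).trans hKb)
      (fun n => tsupport_seqSum_subset hK.isClosed hFK _) hs0 hunif
    have h5 : ∀ n, pairing X.P (T (c n - c₀)) (T e) =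
        ∫ ω, X.h 0 1 (seqSum F (c n - c₀)) ω * X.h 0 1 (seqSum F e) ω ∂X.P :=
      fun n => GFF.pairing_hL (htest _) (htest _)
    simp_rw [← h5] at h2
    rw [← GFF.pairing_hL IsTestFun.zero (htest e), GFF.hL_zero] at h2
    refine tendsto_nhds_unique h1 (h2.trans (le_of_eq ?_))
    rw [pairing_apply]
    congr 1
    refine (integral_congr_ae ?_).trans (integral_zero _ _)
    filter_upwards [Lp.coeFn_zero ℝ 4 X.P] with ω hω
    rw [hω]; simp
  have h6 : Tendsto (fun n => pairing X.P (Y - T c₀) (T (c n - c₀))) atTop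
      (𝓝 (pairing X.P (Y - T c₀) (Y - T c₀))) :=
    tendsto_pairing tendsto_const_nhds hZ
  simp_rw [hweak] at h6
  exact sub_eq_zero.1 (eq_zero_of_pairing_self (tendsto_nhds_unique h6 tendsto_const_nhds))

lemma GFF.exists_bound_hL_aux (hK : IsCompact K) (hKb : K ⊆ ball 0 1) (M : ℕ → ℝ) :
    ∃ C, 0 ≤ C ∧ ∀ f, IsTestFun f → tsupport f ⊆ K →
      (∀ m x, ‖iteratedFDeriv ℝ m f x‖ ≤ M m) → ‖X.hL f‖ ≤ C := by
  by_contra! hcon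
  choose F hF hFK hM hbig using fun n : ℕ => hcon n (Nat.cast_nonneg n)
  have hcont := X.continuous_seqMap hK hKb hFK hF hM
  set T : lp (fun _ : ℕ => ℝ) 1 →L[ℝ] Lp ℝ 4 X.P := ⟨X.seqMap hK hFK hF hM, hcont⟩ with hT
  obtain ⟨n, hn⟩ := exists_nat_gt ‖T‖
  have h1 : T (lp.single 1 n 1) = X.hL (F n) := by
    change X.hL (seqSum F (lp.single 1 n 1)) = _
    congr 1
    ext x
    rw [seqSum, tsum_eq_single n]
    · simp
    · intro k hk
      rw [lp.single_apply_ne _ _ _ hk, zero_mul]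
  have h2 := T.le_opNorm (lp.single 1 n 1)
  rw [h1, lp.norm_single (by norm_num), norm_one, mul_one] at h2
  exact absurd (hbig n) (not_lt.2 (h2.trans hn.le))

/-- Uniform boundedness of the field on sets of test functions with bounded derivatives. -/
lemma GFF.exists_bound_hL (hK : IsCompact K) (hKb : K ⊆ ball 0 1) (M : ℕ → ℝ) :
    ∃ C, 0 ≤ C ∧ ∀ f, IsTestFun f → tsupport f ⊆ K → ∀ τ, 0 ≤ τ →
      (∀ m x, ‖iteratedFDeriv ℝ m f x‖ ≤ M m * τ) → ‖X.hL f‖ ≤ C * τ := by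
  obtain ⟨C, hC, h⟩ := X.exists_bound_hL_aux hK hKb M
  refine ⟨C, hC, fun f hf hfK τ hτ hM => ?_⟩
  rcases hτ.eq_or_lt with rfl | hτ
  · have : f = 0 := by
      ext x
      have := hM 0 x
      simpa using this
    rw [this, GFF.hL_zero]; simp
  · have h1 : f = τ • (τ⁻¹ • f) := by rw [smul_smul, mul_inv_cancel₀ hτ.ne', one_smul]
    have h2 : ‖X.hL (τ⁻¹ • f)‖ ≤ C := by
      refine h _ (hf.smul _) ((closure_mono (Function.support_const_smul_subset _ _)).trans hfK)
        fun m x => ?_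
      rw [iteratedFDeriv_const_smul_apply (hf.1.contDiffAt.of_le (by exact_mod_cast le_top)),
        norm_smul, norm_inv, Real.norm_of_nonneg hτ.le, inv_mul_le_iff₀ hτ, mul_comm]
      exact hM m x
    rw [h1, GFF.hL_smul _ (hf.smul _), norm_smul, Real.norm_of_nonneg hτ.le, mul_comm]
    gcongr

end Superposition

section IntegralMultilinear

variable {E L : Type*} [MeasurableSpace E] [NormedAddCommGroup L]

lemma MeasureTheory.StronglyMeasurable.comp_coords {X : E → L} (hX : StronglyMeasurable X)
    (n : ℕ) : StronglyMeasurable fun (z : Fin n → E) (i : Fin n) => X (z i) := by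
  induction n with
  | zero =>
    have h : (fun (z : Fin 0 → E) (i : Fin 0) => X (z i)) = fun _ => Fin.elim0 := by
      funext z; exact Subsingleton.elim _ _
    rw [h]; exact stronglyMeasurable_const
  | succ n ih =>
    have h1 : StronglyMeasurable fun z : Fin (n + 1) → E => (X (z 0), fun i : Fin n => X (z i.succ)) :=
      (hX.comp_measurable (measurable_pi_apply 0)).prodMk
        (ih.comp_measurable (measurable_pi_lambda _ fun i => measurable_pi_apply i.succ))
    have hc : Continuous fun p : L × (Fin n → L) => (Fin.cons p.1 p.2 : Fin (n + 1) → L) := by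
      refine continuous_pi fun i => ?_
      refine Fin.cases ?_ (fun j => ?_) i
      · simpa using continuous_fst
      · simpa [Function.comp_def] using (continuous_apply j).comp (continuous_snd (X := L) (Y := Fin n → L))
    have h2 := hc.comp_stronglyMeasurable h1
    convert h2 using 1
    funext z i
    refine Fin.cases ?_ (fun j => ?_) i <;> simp

variable [NormedSpace ℝ L] [CompleteSpace L]

/-- A continuous multilinear form of an integral is the integral over the product measure. -/
lemma integral_multilinear {n : ℕ} (M : ContinuousMultilinearMap ℝ (fun _ : Fin n => L) ℝ)
    {σ : Measure E} [IsProbabilityMeasure σ] {X : E → L} (hX : StronglyMeasurable X) {C : ℝ}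
    (hC : ∀ x, ‖X x‖ ≤ C) :
    M (fun _ => ∫ x, X x ∂σ) = ∫ z, M (fun i => X (z i)) ∂(Measure.pi fun _ : Fin n => σ) := by
  have hXi : Integrable X σ :=
    Integrable.of_bound hX.aestronglyMeasurable C (ae_of_all _ hC)
  induction n with
  | zero =>
    have h : (fun z : Fin 0 → E => M fun i => X (z i)) = fun _ => M fun _ => ∫ x, X x ∂σ := by
      funext z; congr 1; exact Subsingleton.elim _ _
    rw [h]; simp
  | succ n ih =>
    have hC0 : 0 ≤ C := by
      have : Nonempty E := σ.nonempty_of_neZero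
      exact (norm_nonneg _).trans (hC (Classical.arbitrary E))
    set Y := ∫ x, X x ∂σ with hY
    have h1 : M (fun _ => Y) = M.curryLeft Y (fun _ => Y) := by
      rw [ContinuousMultilinearMap.curryLeft_apply]
      congr 1
      funext i
      refine Fin.cases rfl (fun j => rfl) i
    let T : L →L[ℝ] ℝ :=
      (ContinuousMultilinearMap.apply ℝ (fun _ : Fin n => L) ℝ (fun _ => Y)).comp M.curryLeft
    have hT : ∀ x, T x = M.curryLeft x (fun _ => Y) := fun x => rfl
    have hmeas : StronglyMeasurable fun z : Fin (n + 1) → E => M fun i => X (z i) := by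
      exact M.cont.comp_stronglyMeasurable (hX.comp_coords (n + 1))
    have hMint : Integrable (fun z : Fin (n + 1) → E => M fun i => X (z i))
        (Measure.pi fun _ : Fin (n + 1) => σ) := by
      refine Integrable.of_bound hmeas.aestronglyMeasurable (‖M‖ * ∏ _i : Fin (n + 1), C)
        (ae_of_all _ fun z => (M.le_opNorm _).trans ?_)
      gcongr with i
      exact hC _
    have hmp := measurePreserving_piFinSuccAbove (fun _ : Fin (n + 1) => σ) 0
    have h2 := hmp.symm.integral_comp'
      (g := fun z : Fin (n + 1) → E => M fun i => X (z i))
    rw [← h2, h1, ← hT, hY, ← ContinuousLinearMap.integral_comp_comm T hXi, integral_prod]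
    · refine integral_congr_ae (ae_of_all _ fun x => ?_)
      beta_reduce
      rw [hT, ih]
      refine integral_congr_ae (ae_of_all _ fun z => ?_)
      beta_reduce
      rw [ContinuousMultilinearMap.curryLeft_apply]
      congr 1
      funext i
      refine Fin.cases ?_ (fun j => ?_) i
      · simp [MeasurableEquiv.piFinSuccAbove]
      · simp [MeasurableEquiv.piFinSuccAbove]
    · exact hmp.symm.integrable_comp_of_integrable hMint

end IntegralMultilinear

section Smear

set_option linter.unusedSectionVars false

variable {α E G : Type*} [MeasurableSpace α] {σ : Measure α} [IsFiniteMeasure σ]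
  [NormedAddCommGroup E] [NormedSpace ℝ E] [MeasurableSpace E] [BorelSpace E]
  [SecondCountableTopology E]
  [NormedAddCommGroup G] [NormedSpace ℝ G] [CompleteSpace G] {φ : α → E} {θ : E → G}

/-- Average of translates of `θ`. -/
def smear (σ : Measure α) (φ : α → E) (θ : E → G) (x : E) : G := ∫ z, θ (x - φ z) ∂σ

lemma aestronglyMeasurable_translate (hφ : Measurable φ) {θ : E → G} (hθ : Continuous θ) (x : E) :
    AEStronglyMeasurable (fun z => θ (x - φ z)) σ :=
  (hθ.stronglyMeasurable.comp_measurable (measurable_const.sub hφ)).aestronglyMeasurable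

lemma integrable_translate (hφ : Measurable φ) {θ : E → G} (hθ : Continuous θ)
    (hc : HasCompactSupport θ) (x : E) : Integrable (fun z => θ (x - φ z)) σ := by
  obtain ⟨C, hC⟩ := hθ.bounded_above_of_compact_support hc
  exact Integrable.of_bound (aestronglyMeasurable_translate hφ hθ x) C (ae_of_all _ fun z => hC _)

lemma hasFDerivAt_smear (hφ : Measurable φ) (hθ : ContDiff ℝ 1 θ) (hc : HasCompactSupport θ)
    (x : E) : HasFDerivAt (smear σ φ θ) (smear σ φ (fderiv ℝ θ) x) x := by
  have hd : Continuous (fderiv ℝ θ) := hθ.continuous_fderiv one_ne_zero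
  obtain ⟨C, hC⟩ := hd.bounded_above_of_compact_support (hc.fderiv ℝ)
  exact hasFDerivAt_integral_of_dominated_of_fderiv_le
    (F := fun x z => θ (x - φ z)) (F' := fun x z => fderiv ℝ θ (x - φ z))
    (bound := fun _ => C) univ_mem
    (Eventually.of_forall fun x => aestronglyMeasurable_translate hφ hθ.continuous x)
    (integrable_translate (σ := σ) hφ hθ.continuous hc x)
    (aestronglyMeasurable_translate hφ hd x)
    (ae_of_all _ fun z y _ => hC _) (integrable_const C)
    (ae_of_all _ fun z y _ => by
      simpa using! (hθ.differentiable one_ne_zero).differentiableAt.hasFDerivAt.comp y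
        ((hasFDerivAt_id y).sub (hasFDerivAt_const (φ z) y)))

lemma fderiv_smear (hφ : Measurable φ) (hθ : ContDiff ℝ 1 θ) (hc : HasCompactSupport θ) :
    fderiv ℝ (smear σ φ θ) = smear σ φ (fderiv ℝ θ) :=
  funext fun x => (hasFDerivAt_smear hφ hθ hc x).fderiv

lemma iteratedFDeriv_smear (hφ : Measurable φ) (hθ : ContDiff ℝ (⊤ : ℕ∞) θ)
    (hc : HasCompactSupport θ) (n : ℕ) :
    iteratedFDeriv ℝ n (smear σ φ θ) = smear σ φ (iteratedFDeriv ℝ n θ) := by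
  induction n with
  | zero =>
    funext x
    simp only [iteratedFDeriv_zero_eq_comp, smear, Function.comp_apply]
    exact ((continuousMultilinearCurryFin0 ℝ E G).symm.toContinuousLinearEquiv.toContinuousLinearMap.integral_comp_comm
      (integrable_translate (σ := σ) hφ hθ.continuous hc x)).symm
  | succ n ih =>
    have h1 : ContDiff ℝ 1 (iteratedFDeriv ℝ n θ) :=
      hθ.iteratedFDeriv_right (by exact_mod_cast le_top)
    have h2 : HasCompactSupport (iteratedFDeriv ℝ n θ) := hc.iteratedFDeriv n
    funext x
    rw [iteratedFDeriv_succ_eq_comp_left, ih, fderiv_smear hφ h1 h2]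
    simp only [smear, iteratedFDeriv_succ_eq_comp_left, Function.comp_apply]
    exact ((continuousMultilinearCurryLeftEquiv ℝ (fun _ : Fin (n + 1) => E) G).symm.toContinuousLinearEquiv.toContinuousLinearMap.integral_comp_comm
      (integrable_translate (σ := σ) hφ (h1.continuous_fderiv one_ne_zero) (h2.fderiv ℝ) x)).symm

lemma differentiable_iteratedFDeriv_smear (hφ : Measurable φ) (hθ : ContDiff ℝ (⊤ : ℕ∞) θ)
    (hc : HasCompactSupport θ) (n : ℕ) :
    Differentiable ℝ (iteratedFDeriv ℝ n (smear σ φ θ)) := by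
  rw [iteratedFDeriv_smear hφ hθ hc]
  exact fun x => (hasFDerivAt_smear (σ := σ) hφ (hθ.iteratedFDeriv_right (by exact_mod_cast le_top))
    (hc.iteratedFDeriv n) x).differentiableAt

lemma contDiff_smear (hφ : Measurable φ) (hθ : ContDiff ℝ (⊤ : ℕ∞) θ)
    (hc : HasCompactSupport θ) : ContDiff ℝ (⊤ : ℕ∞) (smear σ φ θ) :=
  contDiff_of_differentiable_iteratedFDeriv
    fun n _ => differentiable_iteratedFDeriv_smear (σ := σ) hφ hθ hc n

lemma tsupport_smear_subset {S K : Set E} (hφS : ∀ᵐ z ∂σ, φ z ∈ S) (hK : IsClosed K)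
    (hSK : ∀ z ∈ S, ∀ x ∈ tsupport θ, x + z ∈ K) : tsupport (smear σ φ θ) ⊆ K := by
  refine closure_minimal (fun x hx => ?_) hK
  by_contra hxK
  refine hx ?_
  refine (integral_congr_ae ?_).trans (integral_zero _ _)
  filter_upwards [hφS] with z hz
  refine image_eq_zero_of_notMem_tsupport fun h => hxK ?_
  simpa using hSK _ hz _ h

end Smear

section Translates

variable {d : ℕ} {θ : Euc d → ℝ}

lemma IsTestFun.translate (hθ : IsTestFun θ) (z : Euc d) : IsTestFun fun x => θ (x - z) :=
  ⟨hθ.1.comp (contDiff_id.sub contDiff_const),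
    hθ.2.comp_homeomorph (Homeomorph.subRight z)⟩

lemma tsupport_translate_subset {δ r : ℝ} (hθδ : tsupport θ ⊆ closedBall 0 δ) {z : Euc d}
    (hz : z ∈ closedBall 0 r) : tsupport (fun x => θ (x - z)) ⊆ closedBall 0 (r + δ) := by
  refine closure_minimal (fun x hx => ?_) isClosed_closedBall
  have h := hθδ (subset_tsupport _ (show x - z ∈ Function.support θ from hx))
  rw [mem_closedBall_zero_iff] at *
  calc ‖x‖ = ‖z + (x - z)‖ := by congr 1; abel
    _ ≤ ‖z‖ + ‖x - z‖ := norm_add_le _ _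
    _ ≤ r + δ := add_le_add hz h

lemma IsTestFun.exists_iteratedFDeriv_bound (hθ : IsTestFun θ) :
    ∃ M : ℕ → ℝ, ∀ n x, ‖iteratedFDeriv ℝ n θ x‖ ≤ M n := by
  choose M hM using fun n : ℕ =>
    (hθ.1.continuous_iteratedFDeriv (m := n) (by exact_mod_cast le_top)).bounded_above_of_compact_support
      (hθ.2.iteratedFDeriv n)
  exact ⟨M, hM⟩

lemma IsTestFun.norm_iteratedFDeriv_sub_le (hθ : IsTestFun θ) {M : ℕ → ℝ}
    (hM : ∀ n x, ‖iteratedFDeriv ℝ n θ x‖ ≤ M n) (n : ℕ) (x y : Euc d) :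
    ‖iteratedFDeriv ℝ n θ x - iteratedFDeriv ℝ n θ y‖ ≤ M (n + 1) * ‖x - y‖ := by
  refine Convex.norm_image_sub_le_of_norm_fderiv_le (𝕜 := ℝ) (s := univ) (fun z _ => ?_) (fun z _ => ?_)
    convex_univ (mem_univ _) (mem_univ _)
  · exact (hθ.1.differentiable_iteratedFDeriv (m := n) (by exact_mod_cast WithTop.coe_lt_top _)).differentiableAt
  · rw [norm_fderiv_iteratedFDeriv]; exact hM _ _

lemma IsTestFun.norm_iteratedFDeriv_translate_sub_le (hθ : IsTestFun θ) {M : ℕ → ℝ}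
    (hM : ∀ n x, ‖iteratedFDeriv ℝ n θ x‖ ≤ M n) (n : ℕ) (z w x : Euc d) :
    ‖iteratedFDeriv ℝ n ((fun x => θ (x - z)) - fun x => θ (x - w)) x‖ ≤ M (n + 1) * ‖z - w‖ := by
  rw [iteratedFDeriv_sub_apply ((hθ.translate z).1.contDiffAt.of_le (by exact_mod_cast le_top))
    ((hθ.translate w).1.contDiffAt.of_le (by exact_mod_cast le_top)),
    iteratedFDeriv_comp_sub, iteratedFDeriv_comp_sub]
  refine (hθ.norm_iteratedFDeriv_sub_le hM _ _ _).trans_eq ?_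
  rw [sub_sub_sub_cancel_left, norm_sub_rev]

lemma IsTestFun.smear {α : Type*} [MeasurableSpace α] {σ : Measure α} [IsFiniteMeasure σ]
    (hθ : IsTestFun θ) {φ : α → Euc d} (hφ : Measurable φ) {R δ : ℝ}
    (hφR : ∀ᵐ z ∂σ, φ z ∈ closedBall 0 R) (hθδ : tsupport θ ⊆ closedBall 0 δ) :
    IsTestFun (smear σ φ θ) ∧ tsupport (smear σ φ θ) ⊆ closedBall 0 (R + δ) := by
  have h : tsupport (_root_.smear σ φ θ) ⊆ closedBall 0 (R + δ) := by
    refine tsupport_smear_subset hφR isClosed_closedBall fun z hz x hx => ?_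
    have h := hθδ hx
    rw [mem_closedBall_zero_iff] at *
    exact (norm_add_le _ _).trans (by linarith)
  exact ⟨⟨contDiff_smear hφ hθ.1 hθ.2,
    (isCompact_closedBall 0 (R + δ)).of_isClosed_subset (isClosed_tsupport _) h⟩, h⟩

lemma integral_comp_simpleFunc {α E L : Type*} [MeasurableSpace α] {σ : Measure α}
    [IsFiniteMeasure σ] [MeasurableSpace E] [NormedAddCommGroup L] [NormedSpace ℝ L]
    [CompleteSpace L] (φ : SimpleFunc α E) (g : E → L) :
    ∫ z, g (φ z) ∂σ = ∑ y ∈ φ.range, σ.real (φ ⁻¹' {y}) • g y := by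
  classical
  have h : ∀ z, g (φ z) = ∑ y ∈ φ.range, (φ ⁻¹' {y}).indicator (fun _ => g y) z := by
    intro z
    rw [Finset.sum_eq_single (φ z)]
    · simp
    · intro y _ hy
      exact indicator_of_notMem (fun h => hy h.symm) _
    · intro h; exact absurd (SimpleFunc.mem_range_self φ z) h
  simp_rw [h]
  rw [integral_finsetSum]
  · refine Finset.sum_congr rfl fun y _ => ?_
    rw [integral_indicator_const _ (φ.measurableSet_fiber y)]
  · intro y _
    exact (integrable_const _).indicator (φ.measurableSet_fiber y)

variable {Ω : Type} [MeasurableSpace Ω] {X : GFF d Ω}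

lemma GFF.hL_sum {ι : Type*} (s : Finset ι) (c : ι → ℝ) (F : ι → Euc d → ℝ)
    (hF : ∀ i, IsTestFun (F i)) :
    IsTestFun (∑ i ∈ s, c i • F i) ∧
      X.hL (∑ i ∈ s, c i • F i) = ∑ i ∈ s, c i • X.hL (F i) := by
  classical
  induction s using Finset.induction_on with
  | empty => exact ⟨by simpa using IsTestFun.zero, by simpa using GFF.hL_zero⟩
  | insert a s ha ih =>
    rw [Finset.sum_insert ha, Finset.sum_insert ha]
    refine ⟨((hF a).smul _).add ih.1, ?_⟩
    rw [GFF.hL_add ((hF a).smul _) ih.1, ih.2, GFF.hL_smul _ (hF a)]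

variable (X)

lemma GFF.exists_lipschitz_translate (hθ : IsTestFun θ) {R δ : ℝ} (hRδ : R + δ < 1)
    (hθδ : tsupport θ ⊆ closedBall 0 δ) :
    ∃ C, 0 ≤ C ∧ ∀ z ∈ closedBall (0 : Euc d) R, ∀ w ∈ closedBall (0 : Euc d) R,
      ‖X.hL (fun x => θ (x - z)) - X.hL (fun x => θ (x - w))‖ ≤ C * ‖z - w‖ := by
  obtain ⟨M, hM⟩ := hθ.exists_iteratedFDeriv_bound
  obtain ⟨C, hC, h⟩ := X.exists_bound_hL (isCompact_closedBall (0 : Euc d) (R + δ))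
    (closedBall_subset_ball hRδ) fun n => M (n + 1)
  refine ⟨C, hC, fun z hz w hw => ?_⟩
  rw [← GFF.hL_sub (hθ.translate z) (hθ.translate w)]
  refine h _ ((hθ.translate z).sub (hθ.translate w)) ?_ _ (norm_nonneg _) fun m x =>
    hθ.norm_iteratedFDeriv_translate_sub_le hM _ _ _ _
  exact (tsupport_sub _ _).trans (union_subset (tsupport_translate_subset hθδ hz)
    (tsupport_translate_subset hθδ hw))

lemma GFF.continuousOn_translate (hθ : IsTestFun θ) {R δ : ℝ} (hRδ : R + δ < 1)
    (hθδ : tsupport θ ⊆ closedBall 0 δ) :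
    ContinuousOn (fun z => X.hL fun x => θ (x - z)) (closedBall 0 R) := by
  obtain ⟨C, hC, h⟩ := X.exists_lipschitz_translate hθ hRδ hθδ
  refine (LipschitzOnWith.of_dist_le_mul (K := ⟨C, hC⟩) fun z hz w hw => ?_).continuousOn
  rw [dist_eq_norm, dist_eq_norm]
  exact h z hz w hw

lemma GFF.hL_smear_simpleFunc {σ : Measure (Euc d)} [IsFiniteMeasure σ] (hθ : IsTestFun θ)
    (φ : SimpleFunc (Euc d) (Euc d)) :
    X.hL (smear σ φ θ) = ∫ z, X.hL (fun x => θ (x - φ z)) ∂σ := by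
  have h1 : smear σ φ θ = ∑ y ∈ φ.range, σ.real (φ ⁻¹' {y}) • fun x => θ (x - y) := by
    funext x
    rw [smear, integral_comp_simpleFunc φ fun y => θ (x - y)]
    simp
  rw [h1, (GFF.hL_sum φ.range _ _ fun y => hθ.translate y).2,
    integral_comp_simpleFunc φ fun y => X.hL fun x => θ (x - y)]

/-- The field tested against an average of translates is the Bochner average. -/
lemma GFF.hL_smear {σ : Measure (Euc d)} [IsProbabilityMeasure σ] (hθ : IsTestFun θ) {R δ : ℝ}
    (hR : 0 ≤ R) (hRδ : R + δ < 1)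
    (hθδ : tsupport θ ⊆ closedBall 0 δ) (hσ : ∀ᵐ z ∂σ, z ∈ closedBall (0 : Euc d) R) :
    X.hL (smear σ id θ) =
      ∫ z, (closedBall (0 : Euc d) R).indicator (fun z => X.hL fun x => θ (x - z)) z ∂σ := by
  set S := closedBall (0 : Euc d) R with hS
  have h0 : (0 : Euc d) ∈ S := mem_closedBall_self hR
  let s : ℕ → SimpleFunc (Euc d) (Euc d) := SimpleFunc.approxOn id measurable_id S 0 h0
  have hsS : ∀ k z, s k z ∈ S := fun k z => SimpleFunc.approxOn_mem measurable_id h0 k z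
  have hsz : ∀ z ∈ S, Tendsto (fun k => s k z) atTop (𝓝 z) := fun z hz =>
    SimpleFunc.tendsto_approxOn measurable_id h0 (subset_closure hz)
  obtain ⟨C, hC, hLip⟩ := X.exists_lipschitz_translate hθ hRδ hθδ
  obtain ⟨M, hM⟩ := hθ.exists_iteratedFDeriv_bound
  obtain ⟨B, hB, hBd⟩ := X.exists_bound_hL (isCompact_closedBall (0 : Euc d) (R + δ))
    (closedBall_subset_ball hRδ) fun n => M (n + 1)
  have hmeas : ∀ k, AEStronglyMeasurable (fun z => ‖s k z - z‖) σ := fun k =>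
    ((s k).measurable.sub measurable_id).norm.aestronglyMeasurable
  have hbd : ∀ k, ∀ᵐ z ∂σ, ‖‖s k z - z‖‖ ≤ 2 * R := fun k => by
    filter_upwards [hσ] with z hz
    have h1 := hsS k z
    rw [hS, mem_closedBall_zero_iff] at h1 hz
    rw [norm_norm]
    exact (norm_sub_le _ _).trans (by linarith)
  have hτ : Tendsto (fun k => ∫ z, ‖s k z - z‖ ∂σ) atTop (𝓝 0) := by
    have h := tendsto_integral_of_dominated_convergence (μ := σ) (F := fun k z => ‖s k z - z‖)
      (f := fun _ => (0 : ℝ)) (fun _ => 2 * R) hmeas (integrable_const _) hbd ?_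
    · simpa using h
    · filter_upwards [hσ] with z hz
      simpa using ((hsz z hz).sub_const z).norm
  have hid := hθ.smear (σ := σ) measurable_id hσ hθδ
  have hsm := fun k => hθ.smear (σ := σ) (s k).measurable (ae_of_all _ (hsS k)) hθδ
  have hlim1 : Tendsto (fun k => X.hL (smear σ (s k) θ)) atTop (𝓝 (X.hL (smear σ id θ))) := by
    rw [tendsto_iff_norm_sub_tendsto_zero]
    refine squeeze_zero (fun _ => norm_nonneg _) (fun k => ?_) (by simpa using hτ.const_mul B)
    rw [← GFF.hL_sub (hsm k).1 hid.1]
    refine hBd _ ((hsm k).1.sub hid.1) ((tsupport_sub _ _).trans (union_subset (hsm k).2 hid.2)) _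
      (integral_nonneg fun _ => norm_nonneg _) fun m x => ?_
    have hcm : Continuous (iteratedFDeriv ℝ m θ) :=
      hθ.1.continuous_iteratedFDeriv (by exact_mod_cast le_top)
    rw [iteratedFDeriv_sub_apply ((hsm k).1.1.contDiffAt.of_le (by exact_mod_cast le_top))
      (hid.1.1.contDiffAt.of_le (by exact_mod_cast le_top)),
      iteratedFDeriv_smear (s k).measurable hθ.1 hθ.2, iteratedFDeriv_smear measurable_id hθ.1 hθ.2,
      smear, smear, ← integral_sub (integrable_translate (s k).measurable hcm (hθ.2.iteratedFDeriv m) x)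
        (integrable_translate measurable_id hcm (hθ.2.iteratedFDeriv m) x), ← integral_const_mul]
    refine norm_integral_le_of_norm_le ((Integrable.of_bound (hmeas k) _ (hbd k)).const_mul _)
      (ae_of_all _ fun z => ?_)
    refine (hθ.norm_iteratedFDeriv_sub_le hM _ _ _).trans_eq ?_
    rw [sub_sub_sub_cancel_left, norm_sub_rev]
    rfl
  have hlim2 : Tendsto (fun k => X.hL (smear σ (s k) θ)) atTop
      (𝓝 (∫ z, S.indicator (fun z => X.hL fun x => θ (x - z)) z ∂σ)) := by
    simp_rw [X.hL_smear_simpleFunc hθ]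
    obtain ⟨D, hD⟩ := (isCompact_closedBall (0 : Euc d) R).exists_bound_of_continuousOn
      (X.continuousOn_translate hθ hRδ hθδ)
    refine tendsto_integral_of_dominated_convergence (fun _ => D) (fun k => ?_)
      (integrable_const _) (fun k => ae_of_all _ fun z => hD _ (hsS k z)) ?_
    · exact ((s k).map fun y => X.hL fun x => θ (x - y)).stronglyMeasurable.aestronglyMeasurable
    · filter_upwards [hσ] with z hz
      rw [indicator_of_mem hz, tendsto_iff_norm_sub_tendsto_zero]
      refine squeeze_zero (fun _ => norm_nonneg _) (fun k => hLip _ (hsS k z) _ hz) ?_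
      simpa using ((hsz z hz).sub_const z).norm.const_mul C
  exact tendsto_nhds_unique hlim1 hlim2

lemma ae_pi_of_ae {E : Type*} [MeasurableSpace E] {σ : Measure E} [IsProbabilityMeasure σ]
    {p : E → Prop} (h : ∀ᵐ z ∂σ, p z) :
    ∀ᵐ z ∂(Measure.pi fun _ : Fin 4 => σ), ∀ i, p (z i) :=
  ae_all_iff.2 fun i => (measurePreserving_eval (fun _ : Fin 4 => σ) i).quasiMeasurePreserving.ae h

/-- Fourth moments of averages of translates. -/
lemma GFF.norm_hL_smear_pow_four {σ : Measure (Euc d)} [IsProbabilityMeasure σ]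
    (hθ : IsTestFun θ) {R δ : ℝ} (hR : 0 ≤ R) (hRδ : R + δ < 1)
    (hθδ : tsupport θ ⊆ closedBall 0 δ) (hσ : ∀ᵐ z ∂σ, z ∈ closedBall (0 : Euc d) R) :
    AEStronglyMeasurable (fun z : Fin 4 → Euc d => mixedMoment X.P
      fun i => X.hL fun x => θ (x - z i)) (Measure.pi fun _ : Fin 4 => σ) ∧
    ‖X.hL (smear σ id θ)‖ ^ 4 = ∫ z, mixedMoment X.P (fun i => X.hL fun x => θ (x - z i))
      ∂(Measure.pi fun _ : Fin 4 => σ) := by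
  set S := closedBall (0 : Euc d) R with hS
  set T := S.indicator (fun z => X.hL fun x => θ (x - z)) with hT
  have hTm : StronglyMeasurable T := by
    have hmS : MeasurableSet S := measurableSet_closedBall
    have h1 := (continuousOn_iff_continuous_domRestrict.1
      (X.continuousOn_translate hθ hRδ hθδ)).stronglyMeasurable
    have h2 := (MeasurableEmbedding.subtype_coe hmS).stronglyMeasurable_extend h1
      (stronglyMeasurable_const (b := (0 : Lp ℝ 4 X.P)))
    convert h2 using 1
    funext z
    by_cases hz : z ∈ S
    · rw [hT, indicator_of_mem hz]
      exact (Subtype.val_injective.extend_apply (S.domRestrict fun z => X.hL fun x => θ (x - z)) _ (⟨z, hz⟩ : S)).symm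
    · rw [hT, indicator_of_notMem hz, Function.extend_apply' _ _ _ (by simpa using hz)]
  obtain ⟨D, hD⟩ := (isCompact_closedBall (0 : Euc d) R).exists_bound_of_continuousOn
      (X.continuousOn_translate hθ hRδ hθδ)
  have hTD : ∀ z, ‖T z‖ ≤ D := by
    intro z
    by_cases hz : z ∈ S
    · rw [hT, indicator_of_mem hz]; exact hD z hz
    · rw [hT, indicator_of_notMem hz, norm_zero]
      exact (norm_nonneg _).trans (hD 0 (mem_closedBall_self hR))
  have hae : (fun z : Fin 4 → Euc d => mixedMoment X.P fun i => T (z i))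
      =ᵐ[Measure.pi fun _ : Fin 4 => σ]
      fun z => mixedMoment X.P fun i => X.hL fun x => θ (x - z i) := by
    filter_upwards [ae_pi_of_ae hσ] with z hz
    congr 1
    funext i
    rw [hT, indicator_of_mem (hz i)]
  refine ⟨((mixedMoment X.P).cont.comp_stronglyMeasurable (hTm.comp_coords 4)).aestronglyMeasurable.congr
    hae, ?_⟩
  rw [← integral_congr_ae hae, ← integral_multilinear (mixedMoment X.P) hTm hTD, mixedMoment_diag,
    X.hL_smear hθ hR hRδ hθδ hσ]

end Translates

section Bump

variable {d : ℕ}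

/-- An unnormalised radial bump function supported in the ball of radius `1 / 2`. -/
def bumpAux (x : Euc d) : ℝ := Real.smoothTransition (1 - 4 * ‖x‖ ^ 2)

lemma contDiff_bumpAux : ContDiff ℝ (⊤ : ℕ∞) (bumpAux (d := d)) :=
  Real.smoothTransition.contDiff.comp
    (contDiff_const.sub (contDiff_const.mul (contDiff_norm_sq ℝ)))

lemma bumpAux_nonneg (x : Euc d) : 0 ≤ bumpAux x := Real.smoothTransition.nonneg _

lemma bumpAux_eq_zero {x : Euc d} (hx : 1 / 2 ≤ ‖x‖) : bumpAux x = 0 :=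
  Real.smoothTransition.zero_of_nonpos (by nlinarith)

lemma hasCompactSupport_bumpAux : HasCompactSupport (bumpAux (d := d)) :=
  HasCompactSupport.intro (isCompact_closedBall (0 : Euc d) (1 / 2)) fun x hx =>
    bumpAux_eq_zero (by simpa using (not_le.1 (fun h => hx (mem_closedBall_zero_iff.2 h))).le)

lemma integral_bumpAux_pos : 0 < ∫ x : Euc d, bumpAux x := by
  refine (contDiff_bumpAux.continuous.integral_pos_of_hasCompactSupport_nonneg_nonzero
    hasCompactSupport_bumpAux bumpAux_nonneg (x := 0) ?_)
  simp [bumpAux, Real.smoothTransition.one_of_one_le]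

/-- The radial mollifier of unit mass supported in the ball of radius `ε / 2`. -/
def bump (ε : ℝ) (x : Euc d) : ℝ := (ε ^ d * ∫ y : Euc d, bumpAux y)⁻¹ * bumpAux (ε⁻¹ • x)

variable {ε : ℝ}

lemma bump_nonneg (hε : 0 < ε) (x : Euc d) : 0 ≤ bump ε x :=
  mul_nonneg (inv_nonneg.2 (mul_nonneg (pow_pos hε _).le integral_bumpAux_pos.le))
    (bumpAux_nonneg _)

lemma bump_eq_zero (hε : 0 < ε) {x : Euc d} (hx : ε / 2 ≤ ‖x‖) : bump ε x = 0 := by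
  rw [bump, bumpAux_eq_zero, mul_zero]
  rw [norm_smul, norm_inv, Real.norm_of_nonneg hε.le, le_inv_mul_iff₀ hε]
  linarith

lemma bump_radial (ε : ℝ) {x y : Euc d} (h : ‖x‖ = ‖y‖) : bump ε x = bump ε y := by
  simp only [bump, bumpAux, norm_smul, h]

lemma tsupport_bump_subset (hε : 0 < ε) : tsupport (bump (d := d) ε) ⊆ closedBall 0 (ε / 2) :=
  closure_minimal (fun x hx => by
    rw [mem_closedBall_zero_iff]
    by_contra h
    exact hx (bump_eq_zero hε (not_le.1 h).le)) isClosed_closedBall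

lemma isTestFun_bump (hε : 0 < ε) : IsTestFun (bump (d := d) ε) :=
  ⟨contDiff_const.mul (contDiff_bumpAux.comp (contDiff_const_smul _)),
    (isCompact_closedBall 0 (ε / 2)).of_isClosed_subset (isClosed_tsupport _)
      (tsupport_bump_subset hε)⟩

lemma integral_bump (hε : 0 < ε) : ∫ x : Euc d, bump ε x = 1 := by
  have h := Measure.integral_comp_inv_smul_of_nonneg (volume : Measure (Euc d)) bumpAux hε.le
  simp only [bump]
  rw [integral_const_mul, h, finrank_euclideanSpace_fin, smul_eq_mul]
  exact inv_mul_cancel₀ (mul_ne_zero (pow_pos hε _).ne' integral_bumpAux_pos.ne')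

lemma bump_mul {ρ : ℝ} (hρ : 0 < ρ) (ε : ℝ) (x : Euc d) :
    bump (ρ * ε) (ρ • x) = (ρ ^ d)⁻¹ * bump ε x := by
  simp only [bump]
  have h : (ρ * ε)⁻¹ * ρ = ε⁻¹ := by
    rw [mul_inv, mul_comm ρ⁻¹, mul_assoc, inv_mul_cancel₀ hρ.ne', mul_one]
  rw [smul_smul, h, mul_pow, mul_assoc, mul_inv, mul_assoc]

end Bump

section Shell

variable {m : ℕ} {r ε : ℝ}

/-- The average of mollifiers centred on the sphere of radius `r`. -/
def shell (m : ℕ) (r ε : ℝ) : Euc (m + 1) → ℝ := smear (sphereUniform (m + 1) r) id (bump ε)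

lemma shell_nonneg (hε : 0 < ε) (x : Euc (m + 1)) : 0 ≤ shell m r ε x :=
  integral_nonneg fun _ => bump_nonneg hε _

lemma ae_sphereUniform_mem_closedBall (m : ℕ) (r : ℝ) :
    ∀ᵐ x ∂sphereUniform (m + 1) r, x ∈ closedBall (0 : Euc (m + 1)) r := by
  filter_upwards [ae_sphereUniform_mem m r] with x hx using sphere_subset_closedBall hx

lemma isTestFun_shell (hr : 0 < r) (hε : 0 < ε) : IsTestFun (shell m r ε) := by
  have := isProbabilityMeasure_sphereUniform m hr
  exact ((isTestFun_bump hε).smear measurable_id (ae_sphereUniform_mem_closedBall m r)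
    (tsupport_bump_subset hε)).1

lemma shell_radial (hr : 0 < r) {x y : Euc (m + 1)} (h : ‖x‖ = ‖y‖) :
    shell m r ε x = shell m r ε y := by
  have := isProbabilityMeasure_sphereUniform m hr
  obtain ⟨L, hL⟩ : ∃ L : Euc (m + 1) ≃ₗᵢ[ℝ] Euc (m + 1), L x = y :=
    ⟨_, Submodule.reflection_sub h⟩
  have hmp := measurePreserving_sphereUniform m r L
  have h1 := hmp.integral_comp L.toHomeomorph.measurableEmbedding (fun z => bump ε (y - z))
  rw [shell, smear, smear]
  simp only [id]
  rw [← h1]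
  refine integral_congr_ae (ae_of_all _ fun z => bump_radial _ ?_)
  rw [← hL]
  rw [← map_sub, L.norm_map]

lemma shell_ne_zero (hε : 0 < ε) {x : Euc (m + 1)} (h : shell m r ε x ≠ 0) :
    r - ε / 2 ≤ ‖x‖ ∧ ‖x‖ ≤ r + ε / 2 := by
  contrapose! h
  refine (integral_congr_ae ?_).trans (integral_zero _ _)
  filter_upwards [ae_sphereUniform_mem m r] with z hz
  rw [mem_sphere_zero_iff_norm] at hz
  refine bump_eq_zero hε ?_
  have h1 := norm_sub_norm_le x z
  have h2 := norm_sub_norm_le z x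
  rw [norm_sub_rev] at h2
  simp only [id]
  by_cases h3 : r - ε / 2 ≤ ‖x‖
  · have := h h3; linarith
  · linarith

lemma integral_shell (hr : 0 < r) (hε : 0 < ε) : ∫ x, shell m r ε x = 1 := by
  have := isProbabilityMeasure_sphereUniform m hr
  have hb := (isTestFun_bump (d := m + 1) hε)
  simp only [shell, smear]
  rw [integral_integral_swap]
  · simp_rw [integral_sub_right_eq_self (μ := (volume : Measure (Euc (m + 1)))), integral_bump hε]
    simp
  · have h2 : Measurable (Function.uncurry fun x z : Euc (m + 1) => bump ε (x - id z)) :=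
      hb.1.continuous.measurable.comp (measurable_fst.sub measurable_snd)
    rw [integrable_prod_iff' h2.aestronglyMeasurable]
    refine ⟨ae_of_all _ fun z => hb.integrable.comp_sub_right z, ?_⟩
    have h3 : ∀ z : Euc (m + 1), ∫ x, ‖Function.uncurry (fun x z : Euc (m + 1) =>
        bump ε (x - id z)) (x, z)‖ = ∫ x : Euc (m + 1), ‖bump ε x‖ := fun z => by
      simpa using integral_sub_right_eq_self (μ := (volume : Measure (Euc (m + 1))))
        (fun x => ‖bump ε x‖) z
    simp_rw [h3]
    exact integrable_const _

end Shell

section Dilate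

variable {d : ℕ}

/-- The function `f` seen from the ball of radius `ρ` about `a`. -/
def dilate (a : Euc d) (ρ : ℝ) (f : Euc d → ℝ) (x : Euc d) : ℝ := f (a + ρ • x)

variable {f : Euc d → ℝ} {a : Euc d} {ρ : ℝ}

lemma IsTestFun.dilate (hf : IsTestFun f) (a : Euc d) (hρ : 0 < ρ) :
    IsTestFun (dilate a ρ f) :=
  ⟨hf.1.comp (contDiff_const.add (contDiff_const_smul ρ)),
    hf.2.comp_homeomorph ((Homeomorph.smulOfNeZero ρ hρ.ne').trans (Homeomorph.addLeft a))⟩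

lemma dilate_inv_smul (f : Euc d → ℝ) (a : Euc d) (hρ : 0 < ρ) :
    (fun x => dilate a ρ f (ρ⁻¹ • (x - a))) = f := by
  funext x
  rw [dilate, smul_inv_smul₀ hρ.ne', add_sub_cancel]

lemma integral_dilate (f : Euc d → ℝ) (a : Euc d) (hρ : 0 < ρ) :
    ∫ x, dilate a ρ f x = (ρ ^ d)⁻¹ * ∫ x, f x := by
  have h := Measure.integral_comp_smul (volume : Measure (Euc d)) (fun x => f (a + x)) ρ
  rw [integral_add_left_eq_self, finrank_euclideanSpace_fin, smul_eq_mul,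
    abs_of_nonneg (by positivity)] at h
  exact h

end Dilate

section Markov

variable {d : ℕ} {Ω : Type} [MeasurableSpace Ω] {X : GFF d Ω} {a : Euc d} {ρ : ℝ}
  {f g : Euc d → ℝ}

lemma GFF.identDistrib_H (hρ : 0 < ρ) (hb : ball a ρ ⊆ ball 0 1) (hf : IsTestFun f) :
    IdentDistrib (X.H a ρ f) (fun ω => ρ ^ (1 + (d : ℝ) / 2) * X.h 0 1 (dilate a ρ f) ω)
      X.P X.P := by
  refine ⟨(X.meas_H a ρ f).aemeasurable, ((X.meas_h 0 1 _).const_mul _).aemeasurable, ?_⟩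
  have h1 := X.dmp_law a ρ hρ hb 1 (fun _ => f) fun _ => hf
  have h2 := X.scaling a ρ hρ 1 (fun _ => dilate a ρ f) fun _ => hf.dilate a hρ
  rw [dilate_inv_smul f a hρ] at h2
  have h3 := congrArg (Measure.map fun v : Fin 1 → ℝ => v 0) (h1.trans h2)
  rw [Measure.map_map (measurable_pi_apply 0) (measurable_pi_lambda _ fun _ => X.meas_H a ρ f),
    Measure.map_map (measurable_pi_apply 0)
      (measurable_pi_lambda _ fun _ => (X.meas_h 0 1 _).const_mul _)] at h3
  exact h3

lemma GFF.memLp_H (hρ : 0 < ρ) (hb : ball a ρ ⊆ ball 0 1) (hf : IsTestFun f) :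
    MemLp (X.H a ρ f) 4 X.P :=
  (X.identDistrib_H hρ hb hf).symm.memLp_snd ((X.memLp_h (hf.dilate a hρ)).const_mul _)

lemma GFF.integral_H (hρ : 0 < ρ) (hb : ball a ρ ⊆ ball 0 1) (hf : IsTestFun f) :
    ∫ ω, X.H a ρ f ω ∂X.P = 0 := by
  rw [(X.identDistrib_H hρ hb hf).integral_eq, integral_const_mul,
    X.centered 0 1 _ (hf.dilate a hρ), mul_zero]

lemma GFF.integral_H_sq (hρ : 0 < ρ) (hb : ball a ρ ⊆ ball 0 1) (hf : IsTestFun f) :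
    ∫ ω, X.H a ρ f ω ^ 2 ∂X.P =
      (ρ ^ (1 + (d : ℝ) / 2)) ^ 2 * ∫ ω, X.h 0 1 (dilate a ρ f) ω ^ 2 ∂X.P := by
  rw [(X.identDistrib_H hρ hb hf).sq.integral_eq, ← integral_const_mul]
  simp only [mul_pow]

lemma GFF.norm_toLp_H (hρ : 0 < ρ) (hb : ball a ρ ⊆ ball 0 1) (hf : IsTestFun f) :
    ‖(X.memLp_H hρ hb hf).toLp _‖ = ρ ^ (1 + (d : ℝ) / 2) * ‖X.hL (dilate a ρ f)‖ := by
  rw [Lp.norm_toLp, (X.identDistrib_H hρ hb hf).eLpNorm_eq, GFF.hL_of_isTestFun (hf.dilate a hρ),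
    Lp.norm_toLp]
  have h : (fun ω => ρ ^ (1 + (d : ℝ) / 2) * X.h 0 1 (dilate a ρ f) ω) =
      (ρ ^ (1 + (d : ℝ) / 2)) • X.h 0 1 (dilate a ρ f) := rfl
  rw [h, eLpNorm_const_smul, ENNReal.toReal_mul, toReal_enorm,
    Real.norm_of_nonneg (Real.rpow_nonneg hρ.le _)]

lemma GFF.H_eq_zero (hρ : 0 < ρ) (hb : ball a ρ ⊆ ball 0 1) (hf : IsTestFun f)
    (hs : tsupport f ⊆ (ball a ρ)ᶜ) : ∀ᵐ ω ∂X.P, X.H a ρ f ω = 0 := by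
  have h0 : ∀ᵐ ω ∂X.P, X.h 0 1 (dilate a ρ f) ω = 0 := by
    refine X.zero_outside _ (hf.dilate a hρ) ?_
    refine closure_minimal (fun x hx => ?_) isOpen_ball.isClosed_compl
    have h1 := hs (subset_tsupport _ (show a + ρ • x ∈ Function.support f from hx))
    rw [mem_compl_iff, mem_ball_iff_norm, add_sub_cancel_left, norm_smul,
      Real.norm_of_nonneg hρ.le] at h1
    rw [mem_compl_iff, mem_ball_zero_iff]
    intro h2
    exact h1 (by nlinarith)
  refine (X.identDistrib_H hρ hb hf).symm.ae_snd (p := fun y => y = 0)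
    (measurableSet_singleton 0) ?_
  filter_upwards [h0] with ω hω
  rw [hω, mul_zero]

variable (X) in
/-- The σ-algebra generated by the harmonic part of the Markov decomposition in a ball. -/
@[reducible]
def GFF.outer (a : Euc d) (ρ : ℝ) : MeasurableSpace Ω :=
  (⨆ f : {f : Euc d → ℝ // IsTestFun f}, MeasurableSpace.comap (X.Φ a ρ f.1) inferInstance) ⊔
    (⨆ z : Euc d, MeasurableSpace.comap (fun ω => X.φharm a ρ ω z) inferInstance)

variable (X) in
lemma GFF.outer_le (a : Euc d) (ρ : ℝ) : X.outer a ρ ≤ (inferInstance : MeasurableSpace Ω) :=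
  sup_le (iSup_le fun f => (X.meas_Φ a ρ f.1).comap_le)
    (iSup_le fun z => (X.meas_φharm a ρ z).comap_le)

lemma GFF.measurable_outer_Φ (hf : IsTestFun f) : Measurable[X.outer a ρ] (X.Φ a ρ f) := by
  have h1 : Measurable[MeasurableSpace.comap (X.Φ a ρ f) inferInstance] (X.Φ a ρ f) :=
    comap_measurable _
  refine h1.mono ?_ le_rfl
  exact (le_iSup (fun f : {f : Euc d → ℝ // IsTestFun f} =>
    MeasurableSpace.comap (X.Φ a ρ f.1) inferInstance) ⟨f, hf⟩).trans le_sup_left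

lemma GFF.h_eq_Φ (hρ : 0 < ρ) (hb : ball a ρ ⊆ ball 0 1) (hf : IsTestFun f)
    (hs : tsupport f ⊆ (ball a ρ)ᶜ) : X.h 0 1 f =ᵐ[X.P] X.Φ a ρ f := by
  filter_upwards [X.dmp_decomp a ρ hρ hb f hf, X.H_eq_zero hρ hb hf hs] with ω h1 h2
  rw [h1, h2, zero_add]

lemma GFF.aestronglyMeasurable_outer_h (hρ : 0 < ρ) (hb : ball a ρ ⊆ ball 0 1) (hf : IsTestFun f)
    (hs : tsupport f ⊆ (ball a ρ)ᶜ) : AEStronglyMeasurable[X.outer a ρ] (X.h 0 1 f) X.P :=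
  ⟨X.Φ a ρ f, (X.measurable_outer_Φ hf).stronglyMeasurable, X.h_eq_Φ hρ hb hf hs⟩

/-- The inner field is orthogonal to functionals of the harmonic part. -/
lemma GFF.integral_H_mul_eq_zero (hρ : 0 < ρ) (hb : ball a ρ ⊆ ball 0 1) (hf : IsTestFun f)
    {W : Ω → ℝ} (hW : AEStronglyMeasurable[X.outer a ρ] W X.P) :
    ∫ ω, X.H a ρ f ω * W ω ∂X.P = 0 := by
  obtain ⟨W', hW', hWW'⟩ := hW
  have h1 : ∫ ω, X.H a ρ f ω * W ω ∂X.P = ∫ ω, X.H a ρ f ω * W' ω ∂X.P := by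
    refine integral_congr_ae ?_
    filter_upwards [hWW'] with ω hω
    rw [hω]
  have hind : IndepFun (X.H a ρ f) W' X.P := by
    rw [IndepFun_iff_Indep]
    refine indep_of_indep_of_le_left (indep_of_indep_of_le_right (X.dmp_indep a ρ hρ hb)
      hW'.measurable.comap_le) ?_
    exact le_iSup (fun f : {f : Euc d → ℝ // IsTestFun f} =>
      MeasurableSpace.comap (X.H a ρ f.1) inferInstance) ⟨f, hf⟩
  rw [h1, hind.integral_fun_mul_eq_mul_integral (X.meas_H a ρ f).aestronglyMeasurable
    (hW'.mono (X.outer_le a ρ)).aestronglyMeasurable, X.integral_H hρ hb hf, zero_mul]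

lemma GFF.mixedMoment_update_eq_zero (hρ : 0 < ρ) (hb : ball a ρ ⊆ ball 0 1) (hf : IsTestFun f)
    {Y : Lp ℝ 4 X.P} (hY : Y =ᵐ[X.P] X.H a ρ f) (W : Fin 4 → Lp ℝ 4 X.P) (i : Fin 4)
    (hW : ∀ j, j ≠ i → AEStronglyMeasurable[X.outer a ρ] (W j) X.P) :
    mixedMoment X.P (Function.update W i Y) = 0 := by
  have h : AEStronglyMeasurable[X.outer a ρ] (fun ω => ∏ j ∈ Finset.univ.erase i, W j ω) X.P := by
    have : ∀ s : Finset (Fin 4), i ∉ s →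
        AEStronglyMeasurable[X.outer a ρ] (fun ω => ∏ j ∈ s, W j ω) X.P := by
      intro s
      induction s using Finset.induction_on with
      | empty => exact fun _ => by simpa using stronglyMeasurable_const.aestronglyMeasurable
      | insert k s hk ih =>
        intro hi
        simp only [Finset.prod_insert hk]
        exact (hW k fun h => hi (h ▸ Finset.mem_insert_self k s)).mul
          (ih fun h => hi (Finset.mem_insert_of_mem h))
    exact this _ (Finset.notMem_erase _ _)
  rw [mixedMoment_apply, ← X.integral_H_mul_eq_zero hρ hb hf h]
  refine integral_congr_ae ?_
  filter_upwards [hY] with ω hω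
  rw [← Finset.mul_prod_erase Finset.univ _ (Finset.mem_univ i), Function.update_self, hω]
  congr 1
  exact Finset.prod_congr rfl fun j hj => by
    rw [Function.update_of_ne (Finset.ne_of_mem_erase hj)]

/-- Exchanging all arguments of a mixed moment one at a time. -/
lemma mixedMoment_eq_of_swap {P : Measure Ω} {U V : Fin 4 → Lp ℝ 4 P}
    (h : ∀ i, ∀ W : Fin 4 → Lp ℝ 4 P, (∀ j, j ≠ i → W j = U j ∨ W j = V j) →
      mixedMoment P (Function.update W i (U i - V i)) = 0) :
    mixedMoment P U = mixedMoment P V := by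
  have key : ∀ s : Finset (Fin 4), mixedMoment P (s.piecewise V U) = mixedMoment P U := by
    intro s
    induction s using Finset.induction_on with
    | empty => rw [Finset.piecewise_empty]
    | insert i s hi ih =>
      rw [← ih]
      have h1 := h i (s.piecewise V U) fun j _ => by
        by_cases hj : j ∈ s
        · exact Or.inr (Finset.piecewise_eq_of_mem _ _ _ hj)
        · exact Or.inl (Finset.piecewise_eq_of_notMem _ _ _ hj)
      rw [ContinuousMultilinearMap.map_update_sub, sub_eq_zero] at h1
      rw [Finset.piecewise_insert, ← h1]
      congr 1
      have h2 := Function.update_eq_self i (s.piecewise V U)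
      rw [Finset.piecewise_eq_of_notMem s V U hi] at h2
      exact h2
  rw [← key Finset.univ, Finset.piecewise_univ]

end Markov

section MarkovRadial

variable {m : ℕ} {Ω : Type} [MeasurableSpace Ω] {X : GFF (m + 1) Ω} {a : Euc (m + 1)} {ρ ρ' : ℝ}
  {f g : Euc (m + 1) → ℝ}

/-- `f` is a radial test function about `a`, vanishing off the ball of radius `ρ'`. -/
structure IsRadialTestFun (a : Euc (m + 1)) (ρ' : ℝ) (f : Euc (m + 1) → ℝ) : Prop where
  test : IsTestFun f
  radial : ∀ x y, ‖x - a‖ = ‖y - a‖ → f x = f y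
  zero : ∀ x, ρ' ≤ ‖x - a‖ → f x = 0

lemma IsRadialTestFun.sub (hf : IsRadialTestFun a ρ' f) (hg : IsRadialTestFun a ρ' g) :
    IsRadialTestFun a ρ' (f - g) where
  test := hf.test.sub hg.test
  radial x y h := by rw [Pi.sub_apply, Pi.sub_apply, hf.radial x y h, hg.radial x y h]
  zero x h := by rw [Pi.sub_apply, hf.zero x h, hg.zero x h, sub_zero]

lemma IsRadialTestFun.mono (hf : IsRadialTestFun a ρ' f) (h : ρ' ≤ ρ) : IsRadialTestFun a ρ f :=
  ⟨hf.test, hf.radial, fun x hx => hf.zero x (h.trans hx)⟩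

lemma IsRadialTestFun.tsupport_subset (hf : IsRadialTestFun a ρ' f) :
    tsupport f ⊆ closedBall a ρ' :=
  closure_minimal (fun x hx => by
    rw [mem_closedBall_iff_norm]
    by_contra h
    exact hx (hf.zero x (not_le.1 h).le)) isClosed_closedBall

lemma GFF.h_eq_H_add (hρ : 0 < ρ) (hb : ball a ρ ⊆ ball 0 1) (hf : IsRadialTestFun a ρ' f)
    (hρ'0 : 0 < ρ') (hρ' : ρ' < ρ) :
    ∀ᵐ ω ∂X.P, X.h 0 1 f ω = X.H a ρ f ω + X.φharm a ρ ω a * ∫ x, f x := by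
  filter_upwards [X.dmp_decomp a ρ hρ hb f hf.test, X.dmp_harm a ρ hρ hb] with ω h1 h2
  rw [h1, h2.2 f hf.test (hf.tsupport_subset.trans (closedBall_subset_ball hρ')),
    h2.1.integral_mul_radial hf.test.1.continuous hρ'0 hρ' hf.zero hf.radial]

lemma isRadialTestFun_bump (a : Euc (m + 1)) {ε : ℝ} (hε : 0 < ε) :
    IsRadialTestFun a (ε / 2) fun x => bump ε (x - a) where
  test := (isTestFun_bump hε).translate a
  radial _ _ h := bump_radial _ h
  zero _ h := bump_eq_zero hε h

lemma integral_bump_sub (a : Euc (m + 1)) {ε : ℝ} (hε : 0 < ε) :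
    ∫ x, bump ε (x - a) = 1 := by
  rw [integral_sub_right_eq_self (μ := (volume : Measure (Euc (m + 1)))), integral_bump hε]

lemma isRadialTestFun_shell (a : Euc (m + 1)) {r ε : ℝ} (hr : 0 < r) (hε : 0 < ε) :
    IsRadialTestFun a (r + ε) fun x => shell m r ε (x - a) where
  test := (isTestFun_shell hr hε).translate a
  radial _ _ h := shell_radial hr h
  zero x h := by
    by_contra h1
    linarith [(shell_ne_zero hε h1).2]

lemma integral_shell_sub (a : Euc (m + 1)) {r ε : ℝ} (hr : 0 < r) (hε : 0 < ε) :
    ∫ x, shell m r ε (x - a) = 1 := by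
  rw [integral_sub_right_eq_self (μ := (volume : Measure (Euc (m + 1)))), integral_shell hr hε]

lemma GFF.φharm_ae_eq (hρ : 0 < ρ) (hb : ball a ρ ⊆ ball 0 1) (hf : IsRadialTestFun a ρ' f)
    (hρ'0 : 0 < ρ') (hρ' : ρ' < ρ) (h1 : ∫ x, f x = 1) :
    (fun ω => X.φharm a ρ ω a) =ᵐ[X.P] X.h 0 1 f - X.H a ρ f := by
  filter_upwards [X.h_eq_H_add hρ hb hf hρ'0 hρ'] with ω hω
  rw [Pi.sub_apply, hω, h1, mul_one, add_sub_cancel_left]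

lemma GFF.memLp_φharm (hρ : 0 < ρ) (hb : ball a ρ ⊆ ball 0 1) :
    MemLp (fun ω => X.φharm a ρ ω a) 4 X.P := by
  have hf := isRadialTestFun_bump a hρ
  exact ((X.memLp_h hf.test).sub (X.memLp_H hρ hb hf.test)).ae_eq
    (X.φharm_ae_eq hρ hb hf (by linarith) (by linarith) (integral_bump_sub a hρ)).symm

end MarkovRadial

section ZeroBoundary

variable {m : ℕ} {Ω : Type} [MeasurableSpace Ω] {X : GFF (m + 1) Ω} {a : Euc (m + 1)}

/-- Inner fields tested against radial functions concentrating on the boundary tend to zero. -/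
lemma GFF.tendsto_integral_H_sq {ρ A B : ℕ → ℝ} {f : ℕ → Euc (m + 1) → ℝ} {ρ₀ : ℝ} (hρ₀ : 0 < ρ₀)
    (hρ : ∀ n, ρ₀ ≤ ρ n) (hρ1 : ∀ n, ρ n ≤ 1) (hb : ∀ n, ball a (ρ n) ⊆ ball 0 1)
    (hf : ∀ n, IsRadialTestFun a (B n) (f n)) (hnn : ∀ n x, 0 ≤ f n x)
    (h1 : ∀ n, ∫ x, f n x = 1) (hA : ∀ n x, f n x ≠ 0 → A n ≤ ‖x - a‖)
    (hAl : Tendsto (fun n => A n / ρ n) atTop (𝓝 1))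
    (hBl : Tendsto (fun n => B n / ρ n) atTop (𝓝 1)) :
    Tendsto (fun n => ∫ ω, X.H a (ρ n) (f n) ω ^ 2 ∂X.P) atTop (𝓝 0) := by
  have hρp : ∀ n, 0 < ρ n := fun n => hρ₀.trans_le (hρ n)
  have hlim : Tendsto (fun n => ∫ ω, X.h 0 1 (dilate a (ρ n) (f n)) ω ^ 2 ∂X.P) atTop (𝓝 0) := by
    refine X.zero_bdry _ (fun n => (hf n).test.dilate a (hρp n)) (fun n x => hnn n _)
      ⟨(ρ₀ ^ (m + 1))⁻¹, fun n => ?_⟩ ?_ ⟨1, fun n x y hxy _ => ?_⟩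
    · rw [integral_dilate _ _ (hρp n), h1, mul_one]
      gcongr
      exact hρ n
    · have hne : ∀ n, ∃ x, dilate a (ρ n) (f n) x ≠ 0 := by
        intro n
        by_contra! h
        have h2 := integral_dilate (f n) a (hρp n)
        rw [h1, mul_one, integral_congr_ae (ae_of_all _ h), integral_zero] at h2
        exact (inv_pos.2 (pow_pos (hρp n) _)).ne h2
      have hnorm : ∀ n (x : Euc (m + 1)), ‖a + ρ n • x - a‖ = ρ n * ‖x‖ := fun n x => by
        rw [add_sub_cancel_left, norm_smul, Real.norm_of_nonneg (hρp n).le]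
      refine tendsto_of_tendsto_of_tendsto_of_le_of_le hAl hBl (fun n => ?_) (fun n => ?_)
      · obtain ⟨x, hx⟩ := hne n
        refine (le_infDist ⟨x, subset_tsupport _ hx⟩).2 fun y hy => ?_
        have h2 : tsupport (dilate a (ρ n) (f n)) ⊆ {y | A n / ρ n ≤ ‖y‖} := by
          refine closure_minimal (fun y hy => ?_) (isClosed_le continuous_const continuous_norm)
          have h3 := hA n _ (show f n (a + ρ n • y) ≠ 0 from hy)
          rw [hnorm] at h3
          exact (div_le_iff₀' (hρp n)).2 h3
        rw [dist_zero_left]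
        exact h2 hy
      · obtain ⟨x, hx⟩ := hne n
        refine (infDist_le_dist_of_mem (subset_tsupport _ hx)).trans ?_
        rw [dist_zero_left, le_div_iff₀' (hρp n), ← hnorm]
        exact (not_le.1 fun h => hx ((hf n).zero _ h)).le
    · rw [one_mul]
      refine ((hf n).radial _ _ ?_).le
      rw [add_sub_cancel_left, add_sub_cancel_left, norm_smul, norm_smul, hxy]
  refine squeeze_zero (fun n => integral_nonneg fun ω => sq_nonneg _) (fun n => ?_) hlim
  rw [X.integral_H_sq (hρp n) (hb n) (hf n).test]
  refine mul_le_of_le_one_left (integral_nonneg fun ω => sq_nonneg _) ?_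
  exact pow_le_one₀ (Real.rpow_nonneg (hρp n).le _)
    (Real.rpow_le_one (hρp n).le (hρ1 n) (by positivity))

lemma tendsto_of_tendsto_integral_sq {P : Measure Ω} {g : ℕ → Ω → ℝ} (hg : ∀ n, MemLp (g n) 2 P)
    (h : Tendsto (fun n => ∫ ω, g n ω ^ 2 ∂P) atTop (𝓝 0)) :
    Tendsto (fun n => (hg n).toLp _) atTop (𝓝 0) := by
  rw [tendsto_zero_iff_norm_tendsto_zero]
  have h2 : ∀ n, ‖(hg n).toLp _‖ = Real.sqrt (∫ ω, g n ω ^ 2 ∂P) := by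
    intro n
    rw [Lp.norm_toLp, (hg n).eLpNorm_eq_integral_rpow_norm two_ne_zero ENNReal.ofNat_ne_top,
      ENNReal.toReal_ofReal (by positivity), Real.sqrt_eq_rpow]
    simp
  simp_rw [h2]
  simpa using h.sqrt


/-- Radial test functions of unit mass concentrating on the boundary of the ball of radius `t`. -/
def annulus (m : ℕ) (t : ℝ) (n : ℕ) : Euc (m + 1) → ℝ :=
  shell m (t * (1 - 2 / (n + 4))) (t * (1 / (n + 4)))

section Annulus

variable {t : ℝ}

lemma annulus_radius_pos (ht : 0 < t) (n : ℕ) : 0 < t * (1 - 2 / ((n : ℝ) + 4)) := by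
  refine mul_pos ht (sub_pos.2 ((div_lt_one (by positivity)).2 ?_))
  linarith [(n.cast_nonneg : (0 : ℝ) ≤ n)]

lemma isRadialTestFun_annulus (a : Euc (m + 1)) (ht : 0 < t) (n : ℕ) :
    IsRadialTestFun a (t * (1 - 1 / (n + 4))) fun x => annulus m t n (x - a) := by
  refine (isRadialTestFun_shell a (annulus_radius_pos ht n) (by positivity)).mono (le_of_eq ?_)
  ring

lemma annulus_nonneg (ht : 0 < t) (n : ℕ) (x : Euc (m + 1)) : 0 ≤ annulus m t n x :=
  shell_nonneg (by positivity) x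

lemma le_norm_of_annulus_ne_zero (ht : 0 < t) {n : ℕ} {x : Euc (m + 1)}
    (h : annulus m t n x ≠ 0) : t * (1 - 3 / (n + 4)) ≤ ‖x‖ := by
  refine le_trans ?_ (shell_ne_zero (by positivity) h).1
  have h2 : 0 < t * (1 / ((n : ℝ) + 4)) := by positivity
  have h3 : t * (1 - 3 / ((n : ℝ) + 4)) =
    t * (1 - 2 / (n + 4)) - t * (1 / ((n : ℝ) + 4)) := by ring
  linarith

lemma integral_annulus_sub (a : Euc (m + 1)) (ht : 0 < t) (n : ℕ) :
    ∫ x, annulus m t n (x - a) = 1 :=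
  integral_shell_sub a (annulus_radius_pos ht n) (by positivity)

lemma tendsto_one_sub_div (c : ℝ) : Tendsto (fun n : ℕ => 1 - c / ((n : ℝ) + 4)) atTop (𝓝 1) := by
  have h : Tendsto (fun n : ℕ => c / ((n : ℝ) + 4)) atTop (𝓝 0) :=
    tendsto_const_nhds.div_atTop (tendsto_natCast_atTop_atTop.atTop_add tendsto_const_nhds)
  simpa using h.const_sub 1

lemma GFF.tendsto_integral_H_annulus_sq (ht : 0 < t) (ht1 : t ≤ 1) (hb : ball a t ⊆ ball 0 1) :
    Tendsto (fun n => ∫ ω, X.H a t (fun x => annulus m t n (x - a)) ω ^ 2 ∂X.P) atTop (𝓝 0) := by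
  have h (c : ℝ) : Tendsto (fun n : ℕ => t * (1 - c / ((n : ℝ) + 4)) / t) atTop (𝓝 1) :=
    (tendsto_one_sub_div c).congr fun n => by rw [mul_div_cancel_left₀ _ ht.ne']
  exact X.tendsto_integral_H_sq ht (fun _ => le_rfl) (fun _ => ht1) (fun _ => hb)
    (isRadialTestFun_annulus a ht) (fun n x => annulus_nonneg ht n _) (integral_annulus_sub a ht)
    (fun n x hx => le_norm_of_annulus_ne_zero ht hx) (h 3) (h 1)

lemma mul_one_sub_pos (ht : 0 < t) (n : ℕ) : 0 < t * (1 - 1 / ((n : ℝ) + 4)) := by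
  refine mul_pos ht (sub_pos.2 ((div_lt_one (by positivity)).2 ?_))
  linarith [(n.cast_nonneg : (0 : ℝ) ≤ n)]

lemma mul_one_sub_lt (ht : 0 < t) (n : ℕ) : t * (1 - 1 / ((n : ℝ) + 4)) < t :=
  mul_lt_of_lt_one_right ht (sub_lt_self _ (by positivity))

lemma GFF.tendsto_h_annulus (ht : 0 < t) (ht1 : t ≤ 1) (hb : ball a t ⊆ ball 0 1) :
    Tendsto (fun n => (((X.memLp_h (isRadialTestFun_annulus a ht n).test).mono_exponent
      (by norm_num : (2 : ENNReal) ≤ 4)).toLp _ : Lp ℝ 2 X.P)) atTop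
      (𝓝 (((X.memLp_φharm ht hb).mono_exponent (by norm_num : (2 : ENNReal) ≤ 4)).toLp _)) := by
  have hH n := (X.memLp_H ht hb (isRadialTestFun_annulus a ht n).test).mono_exponent
    (by norm_num : (2 : ENNReal) ≤ 4)
  have h := (tendsto_of_tendsto_integral_sq hH (X.tendsto_integral_H_annulus_sq ht ht1 hb)).const_add
    (((X.memLp_φharm ht hb).mono_exponent (by norm_num : (2 : ENNReal) ≤ 4)).toLp _)
  rw [add_zero] at h
  refine h.congr fun n => ?_
  rw [← MemLp.toLp_add]
  refine MemLp.toLp_congr _ _ ?_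
  filter_upwards [X.φharm_ae_eq ht hb (isRadialTestFun_annulus a ht n) (mul_one_sub_pos ht n)
    (mul_one_sub_lt ht n) (integral_annulus_sub a ht n)] with ω hω
  rw [Pi.add_apply, hω, Pi.sub_apply, sub_add_cancel]

lemma GFF.aestronglyMeasurable_outer_φharm {ρ : ℝ} {z : Euc (m + 1)} (hρ : 0 < ρ)
    (hb : ball a ρ ⊆ ball 0 1) (ht : 0 < t) (ht1 : t ≤ 1) (hz : ball z t ⊆ ball 0 1)
    (hd : ball z t ⊆ (ball a ρ)ᶜ) :
    AEStronglyMeasurable[X.outer a ρ] (fun ω => X.φharm z t ω z) X.P := by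
  have hcl := isClosed_aestronglyMeasurable (F := ℝ) (p := 2) (μ := X.P) (X.outer_le a ρ)
  have h := hcl.mem_of_tendsto (X.tendsto_h_annulus ht ht1 hz) (Eventually.of_forall fun n =>
    (X.aestronglyMeasurable_outer_h hρ hb (isRadialTestFun_annulus z ht n).test
      (((isRadialTestFun_annulus z ht n).tsupport_subset.trans
        (closedBall_subset_ball (mul_one_sub_lt ht n))).trans hd)).congr (MemLp.coeFn_toLp _).symm)
  exact AEStronglyMeasurable.congr h (MemLp.coeFn_toLp _)

end Annulus

end ZeroBoundary

section MixedMoments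

variable {m : ℕ} {Ω : Type} [MeasurableSpace Ω] {X : GFF (m + 1) Ω}

/-- The difference of the mollifiers at two scales. -/
def bumpDiff {d : ℕ} (s t : ℝ) : Euc d → ℝ := bump s - bump t

variable (X) in
/-- The field mollified at scale `ε`, at the point `z`. -/
def GFF.mol (ε : ℝ) (z : Euc (m + 1)) : Lp ℝ 4 X.P := X.hL fun x => bump ε (x - z)

variable {a z : Euc (m + 1)} {ε s t ρ : ℝ}

lemma GFF.coeFn_mol (hε : 0 < ε) : X.mol ε z =ᵐ[X.P] X.h 0 1 fun x => bump ε (x - z) :=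
  X.coeFn_hL ((isTestFun_bump hε).translate z)

lemma closedBall_subset_compl_ball (h : ρ + s ≤ dist a z) : closedBall z s ⊆ (ball a ρ)ᶜ :=
  fun x hx hx' => by
    rw [mem_closedBall] at hx
    rw [mem_ball] at hx'
    linarith [dist_triangle_left a z x]

lemma GFF.aestronglyMeasurable_outer_mol (hρ : 0 < ρ) (hb : ball a ρ ⊆ ball 0 1) (hε : 0 < ε)
    (hd : ρ + ε / 2 ≤ dist a z) : AEStronglyMeasurable[X.outer a ρ] (X.mol ε z) X.P :=
  (X.aestronglyMeasurable_outer_h hρ hb (isRadialTestFun_bump z hε).test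
    ((isRadialTestFun_bump z hε).tsupport_subset.trans
      (closedBall_subset_compl_ball hd))).congr (X.coeFn_mol hε).symm

lemma GFF.mol_sub_mol (hs : 0 < s) (ht : 0 < t) :
    X.mol s z - X.mol t z = X.hL fun x => bumpDiff s t (x - z) :=
  (X.hL_sub ((isTestFun_bump hs).translate z) ((isTestFun_bump ht).translate z)).symm

lemma GFF.mol_sub_mol_ae_eq (hs : 0 < s) (ht : 0 < t) (hsρ : s ≤ ρ) (htρ : t ≤ ρ)
    (hb : ball z ρ ⊆ ball 0 1) :
    X.mol s z - X.mol t z =ᵐ[X.P] X.H z ρ fun x => bumpDiff s t (x - z) := by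
  have hf : IsRadialTestFun z (ρ / 2) fun x => bumpDiff s t (x - z) :=
    ((isRadialTestFun_bump z hs).mono (by linarith)).sub
      ((isRadialTestFun_bump z ht).mono (by linarith))
  have h0 : ∫ x, bumpDiff s t (x - z) = 0 := by
    have h := integral_sub ((isTestFun_bump hs).translate z).integrable
      ((isTestFun_bump ht).translate z).integrable
    rw [integral_bump_sub z hs, integral_bump_sub z ht, sub_self] at h
    exact h
  rw [X.mol_sub_mol hs ht]
  filter_upwards [X.coeFn_hL hf.test, X.h_eq_H_add (by linarith) hb hf (by linarith)
    (by linarith)] with ω h1 h2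
  rw [h1, h2, h0, mul_zero, add_zero]

/-- Mixed moments of mollified fields do not depend on the scales, while the scales are small
compared with the distances between the points. -/
lemma GFF.mixedMoment_mol_eq {z : Fin 4 → Euc (m + 1)} {s t : Fin 4 → ℝ} (hs : ∀ i, 0 < s i)
    (hst : ∀ i, s i ≤ t i) (hb : ∀ i, s i ≠ t i → ball (z i) (t i) ⊆ ball 0 1)
    (hd : ∀ i, s i ≠ t i → ∀ j, j ≠ i → t i + t j / 2 ≤ dist (z i) (z j)) :
    mixedMoment X.P (fun i => X.mol (s i) (z i)) = mixedMoment X.P fun i => X.mol (t i) (z i) := by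
  have ht i : 0 < t i := (hs i).trans_le (hst i)
  refine mixedMoment_eq_of_swap fun i W hW => ?_
  by_cases hi : s i = t i
  · rw [hi, sub_self]
    exact (mixedMoment X.P).map_update_zero _ _
  have hf : IsTestFun fun x => bumpDiff (s i) (t i) (x - z i) :=
    ((isTestFun_bump (hs i)).translate (z i)).sub ((isTestFun_bump (ht i)).translate (z i))
  refine X.mixedMoment_update_eq_zero (ht i) (hb i hi) hf ?_ W i fun j hj => ?_
  · exact (X.mol_sub_mol_ae_eq (hs i) (ht i) (hst i) le_rfl (hb i hi))
  · have hdj := hd i hi j hj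
    rcases hW j hj with h | h <;> rw [h]
    · exact X.aestronglyMeasurable_outer_mol (ht i) (hb i hi) (hs j) (by linarith [hst j])
    · exact X.aestronglyMeasurable_outer_mol (ht i) (hb i hi) (ht j) hdj

lemma GFF.mixedMoment_mol_sub_eq_zero {z : Fin 4 → Euc (m + 1)} (hs : 0 < s) (hst : s ≤ t)
    (i : Fin 4) (hb : ball (z i) t ⊆ ball 0 1)
    (hd : ∀ j, j ≠ i → t + t / 2 ≤ dist (z i) (z j)) :
    mixedMoment X.P (fun i => X.mol t (z i) - X.mol s (z i)) = 0 := by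
  have ht : 0 < t := hs.trans_le hst
  have hf : IsTestFun fun x => bumpDiff t s (x - z i) :=
    ((isTestFun_bump ht).translate (z i)).sub ((isTestFun_bump hs).translate (z i))
  have h := X.mixedMoment_update_eq_zero ht hb hf
    (X.mol_sub_mol_ae_eq ht hs le_rfl hst hb)
    (fun i => X.mol t (z i) - X.mol s (z i)) i fun j hj => ?_
  · rwa [Function.update_eq_self] at h
  · have hdj := hd j hj
    exact ((X.aestronglyMeasurable_outer_mol ht hb ht hdj).sub
      (X.aestronglyMeasurable_outer_mol ht hb hs (by linarith))).congr (Lp.coeFn_sub _ _).symm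

lemma k4eps_le_dist {z : Fin 4 → Euc (m + 1)} {i j : Fin 4} (h : j ≠ i) :
    k4eps z i ≤ dist (z i) (z j) / 4 := by
  have h1 : nnDist z i ≤ dist (z i) (z j) := nnDist_le z h
  have h2 : k4eps z i ≤ nnDist z i / 2 / 2 :=
    div_le_div_of_nonneg_right (min_le_left _ _) zero_le_two
  linarith

lemma k4eps_le_norm (z : Fin 4 → Euc (m + 1)) (i : Fin 4) : k4eps z i ≤ (1 - ‖z i‖) / 2 :=
  div_le_div_of_nonneg_right (min_le_right _ _) zero_le_two

lemma ball_subset_unit_ball (h : ρ ≤ 1 - ‖z‖) : ball z ρ ⊆ ball 0 1 :=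
  ball_subset_ball' (by rw [dist_zero_right]; linarith)

/-- The four-point function is the mixed moment of mollified fields. -/
lemma GFF.k4_eq_mixedMoment {z : Fin 4 → Euc (m + 1)} (hε : 0 < ε)
    (hεz : ∀ i, ε / 2 < k4eps z i) :
    X.k4 z = mixedMoment X.P fun i => X.mol ε (z i) := by
  have hk i : 0 < k4eps z i := (half_pos hε).trans (hεz i)
  have hk1 i : k4eps z i ≤ 1 := by linarith [k4eps_le_norm z i, norm_nonneg (z i)]
  have hb i : ball (z i) (k4eps z i) ⊆ ball 0 1 :=
    ball_subset_unit_ball (by linarith [k4eps_le_norm z i, hk i])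
  have hd i j (h : j ≠ i) : k4eps z i + k4eps z j ≤ dist (z i) (z j) := by
    have h1 := k4eps_le_dist (z := z) h
    have h2 := k4eps_le_dist (z := z) h.symm
    rw [dist_comm] at h2
    linarith [dist_nonneg (x := z i) (y := z j)]
  rw [GFF.k4, ← mixedMoment_toLp fun i => X.memLp_φharm (hk i) (hb i)]
  refine (mixedMoment_eq_of_swap fun i W hW => ?_).symm
  refine X.mixedMoment_update_eq_zero (hk i) (hb i) (isRadialTestFun_bump (z i) hε).test ?_ W i
    fun j hj => ?_
  · filter_upwards [Lp.coeFn_sub (X.mol ε (z i)) ((X.memLp_φharm (hk i) (hb i)).toLp _),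
      X.coeFn_mol (z := z i) hε, (X.memLp_φharm (hk i) (hb i)).coeFn_toLp,
      X.φharm_ae_eq (hk i) (hb i) (isRadialTestFun_bump (z i) hε) (half_pos hε) (hεz i)
        (integral_bump_sub (z i) hε)] with ω h1 h2 h3 h4
    rw [h1, Pi.sub_apply, h2, h3, h4, Pi.sub_apply, sub_sub_cancel]
  · rcases hW j hj with h | h <;> rw [h]
    · exact X.aestronglyMeasurable_outer_mol (hk i) (hb i) hε (by linarith [hd i j hj, hεz j])
    · exact (X.aestronglyMeasurable_outer_φharm (hk i) (hb i) (hk j) (hk1 j) (hb j)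
        (ball_subset_closedBall.trans (closedBall_subset_compl_ball (hd i j hj)))).congr
          (MemLp.coeFn_toLp _).symm

end MixedMoments

/-- The dyadic mollification scales for points of norm at most `r`. -/
def scale (r : ℝ) (n : ℕ) : ℝ := (1 - r) / 2 / 2 ^ n

section Scale

variable {r : ℝ}

lemma scale_pos (hr : r < 1) (n : ℕ) : 0 < scale r n := by
  have : 0 < 1 - r := sub_pos.2 hr
  unfold scale
  positivity

lemma scale_succ (r : ℝ) (n : ℕ) : scale r (n + 1) = scale r n / 2 := by
  rw [scale, scale, pow_succ]
  ring

lemma scale_antitone (hr : r < 1) : Antitone (scale r) :=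
  antitone_nat_of_succ_le fun n => by linarith [scale_succ r n, scale_pos hr n]

lemma scale_le (hr : r < 1) (n : ℕ) : scale r n ≤ (1 - r) / 2 :=
  (scale_antitone hr n.zero_le).trans (by simp [scale])

lemma tendsto_scale (r : ℝ) : Tendsto (scale r) atTop (𝓝 0) :=
  tendsto_const_nhds.div_atTop (tendsto_pow_atTop_atTop_of_one_lt one_lt_two)

end Scale

section Ladder

variable {m : ℕ} {Ω : Type} [MeasurableSpace Ω] {X : GFF (m + 1) Ω} {z : Euc (m + 1)} {r : ℝ}

lemma dilate_bumpDiff (z : Euc (m + 1)) {ε : ℝ} (hε : 0 < ε) :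
    dilate z ε (fun x => bumpDiff ε (ε / 2) (x - z)) =
      (ε ^ (m + 1))⁻¹ • (bumpDiff 1 (1 / 2) : Euc (m + 1) → ℝ) := by
  funext x
  have h1 := bump_mul hε 1 x
  have h2 := bump_mul hε (1 / 2) x
  rw [mul_one] at h1
  rw [mul_one_div] at h2
  rw [dilate, add_sub_cancel_left, bumpDiff, Pi.sub_apply, h1, h2, Pi.smul_apply, bumpDiff,
    Pi.sub_apply, smul_eq_mul, mul_sub]

lemma GFF.norm_mol_sub {ε : ℝ} (hε : 0 < ε) (hz : ball z ε ⊆ ball 0 1) :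
    ‖X.mol ε z - X.mol (ε / 2) z‖ =
      ε ^ (-((m - 1 : ℝ) / 2)) * ‖X.hL (bumpDiff 1 (1 / 2))‖ := by
  have hf : IsTestFun fun x => bumpDiff ε (ε / 2) (x - z) :=
    ((isTestFun_bump hε).translate z).sub ((isTestFun_bump (half_pos hε)).translate z)
  have h1 : X.mol ε z - X.mol (ε / 2) z = (X.memLp_H hε hz hf).toLp _ :=
    Lp.ext ((X.mol_sub_mol_ae_eq hε (half_pos hε) le_rfl (by linarith) hz).trans
      (MemLp.coeFn_toLp _).symm)
  have htest : IsTestFun (bumpDiff 1 (1 / 2) : Euc (m + 1) → ℝ) :=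
    (isTestFun_bump one_pos).sub (isTestFun_bump one_half_pos)
  rw [h1, X.norm_toLp_H hε hz hf, dilate_bumpDiff z hε, X.hL_smul _ htest, norm_smul, norm_inv,
    Real.norm_of_nonneg (pow_pos hε _).le, ← mul_assoc, ← Real.rpow_natCast, ← Real.rpow_neg hε.le,
    ← Real.rpow_add hε]
  congr 2
  push_cast
  ring

lemma ball_scale_subset (hr : r < 1) (hz : ‖z‖ ≤ r) (n : ℕ) :
    ball z (scale r n) ⊆ ball 0 1 :=
  ball_subset_unit_ball (by linarith [scale_le hr n])

lemma GFF.norm_mol_scale_sub (hr : r < 1) (hz : ‖z‖ ≤ r) (n : ℕ) :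
    ‖X.mol (scale r n) z - X.mol (scale r (n + 1)) z‖ =
      scale r n ^ (-((m - 1 : ℝ) / 2)) * ‖X.hL (bumpDiff 1 (1 / 2))‖ := by
  rw [scale_succ]
  exact X.norm_mol_sub (scale_pos hr n) (ball_scale_subset hr hz n)

variable (X) in
/-- The mollified field grows at most like a power of the inverse scale. -/
lemma GFF.exists_norm_mol_le (hm : 1 ≤ m) (hr0 : 0 < r) (hr : r < 1) :
    ∃ A, 0 ≤ A ∧ ∀ n, ∀ z : Euc (m + 1), ‖z‖ ≤ r →
      ‖X.mol (scale r n) z‖ ≤ A * scale r n ^ (-((m - 1 : ℝ) / 2 + 1 / 8)) := by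
  have hm' : (1 : ℝ) ≤ m := by exact_mod_cast hm
  set α : ℝ := (m - 1) / 2 + 1 / 8 with hα
  have hα0 : 0 < α := by linarith
  set C := ‖X.hL (bumpDiff 1 (1 / 2))‖ with hC
  have hC0 : 0 ≤ C := norm_nonneg _
  have h2 : 0 < (2 : ℝ) ^ α - 1 := sub_pos.2 (Real.one_lt_rpow one_lt_two hα0)
  have hs1 n : scale r n ≤ 1 := by linarith [scale_le hr n]
  obtain ⟨M, hM⟩ := (isCompact_closedBall (0 : Euc (m + 1)) r).exists_bound_of_continuousOn
    (X.continuousOn_translate (isTestFun_bump (scale_pos hr 0))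
      (by linarith [scale_le hr 0] : r + scale r 0 / 2 < 1)
      (tsupport_bump_subset (scale_pos hr 0)))
  have hM0 : 0 ≤ M := (norm_nonneg _).trans (hM 0 (mem_closedBall_self hr0.le))
  have hp n : 0 < scale r n ^ (-α) := Real.rpow_pos_of_pos (scale_pos hr n) _
  refine ⟨C / (2 ^ α - 1) + M * scale r 0 ^ α, by positivity [scale_pos hr 0], fun n => ?_⟩
  set A := C / (2 ^ α - 1) + M * scale r 0 ^ α with hA
  have hA0 : 0 ≤ M * scale r 0 ^ α := mul_nonneg hM0 (Real.rpow_pos_of_pos (scale_pos hr 0) _).le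
  induction n with
  | zero =>
    intro z hz
    refine (hM z (mem_closedBall_zero_iff.2 hz)).trans ?_
    have : M = M * scale r 0 ^ α * scale r 0 ^ (-α) := by
      rw [mul_assoc, ← Real.rpow_add (scale_pos hr 0), add_neg_cancel, Real.rpow_zero, mul_one]
    rw [this]
    gcongr
    · exact (hp 0).le
    · exact le_add_of_nonneg_left (by positivity)
  | succ n ih =>
    intro z hz
    have h3 : ‖X.mol (scale r (n + 1)) z‖ ≤ ‖X.mol (scale r n) z‖ +
        ‖X.mol (scale r n) z - X.mol (scale r (n + 1)) z‖ := by
      rw [norm_sub_rev]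
      exact norm_le_norm_add_norm_sub' _ _
    have h4 : scale r n ^ (-((m - 1 : ℝ) / 2)) ≤ scale r n ^ (-α) :=
      Real.rpow_le_rpow_of_exponent_ge (scale_pos hr n) (hs1 n) (by linarith)
    have h5 : scale r (n + 1) ^ (-α) = 2 ^ α * scale r n ^ (-α) := by
      rw [scale_succ, Real.div_rpow (scale_pos hr n).le zero_le_two, Real.rpow_neg zero_le_two,
        div_inv_eq_mul, mul_comm]
    have h6 : C ≤ A * (2 ^ α - 1) := by
      rw [hA, add_mul, div_mul_cancel₀ _ h2.ne']
      exact le_add_of_nonneg_right (mul_nonneg hA0 h2.le)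
    rw [X.norm_mol_scale_sub hr hz] at h3
    rw [h5]
    nlinarith [ih z hz, mul_le_mul_of_nonneg_right h4 hC0, mul_le_mul_of_nonneg_right h6 (hp n).le]

end Ladder

section MomentBounds

variable {m : ℕ} {Ω : Type} [MeasurableSpace Ω] {X : GFF (m + 1) Ω} {z : Fin 4 → Euc (m + 1)} {r : ℝ}

lemma prod_rpow_neg_le {α c A : ℝ} (hα : 0 ≤ α) (hc : 0 < c) (hA : 0 ≤ A) {x : Fin 4 → ℝ}
    {t : Fin 4 → ℝ} (hx : ∀ i, 0 < x i) (ht : ∀ i, c * x i ≤ t i) :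
    ∏ i, A * t i ^ (-α) ≤ (A * c ^ (-α)) ^ 4 * ∏ i, x i ^ (-α) := by
  have h : (A * c ^ (-α)) ^ 4 * ∏ i, x i ^ (-α) = ∏ i, A * (c * x i) ^ (-α) := by
    have h1 i : A * (c * x i) ^ (-α) = A * c ^ (-α) * x i ^ (-α) := by
      rw [Real.mul_rpow hc.le (hx i).le, mul_assoc]
    simp only [h1]
    rw [Finset.prod_mul_distrib, Finset.prod_const, Finset.card_univ, Fintype.card_fin]
  have ht0 i : 0 < t i := (mul_pos hc (hx i)).trans_le (ht i)
  rw [h]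
  refine Finset.prod_le_prod (fun i _ => mul_nonneg hA (Real.rpow_pos_of_pos (ht0 i) _).le)
    fun i _ => mul_le_mul_of_nonneg_left ?_ hA
  exact Real.rpow_le_rpow_of_nonpos (mul_pos hc (hx i)) (ht i) (neg_nonpos.2 hα)

variable (X) in
lemma GFF.exists_mixedMoment_mol_le (hm : 1 ≤ m) (hr0 : 0 < r) (hr : r < 1) :
    ∃ C, ∀ N, ∀ z : Fin 4 → Euc (m + 1), Function.Injective z → (∀ i, ‖z i‖ ≤ r) →
      |mixedMoment X.P fun i => X.mol (scale r N) (z i)| ≤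
        C * ∏ i, nnDist z i ^ (-((m - 1 : ℝ) / 2 + 1 / 8)) := by
  obtain ⟨A, hA0, hA⟩ := X.exists_norm_mol_le hm hr0 hr
  have hm' : (1 : ℝ) ≤ m := by exact_mod_cast hm
  have hc : 0 < (1 - r) / 16 := by linarith
  refine ⟨(A * ((1 - r) / 16) ^ (-((m - 1 : ℝ) / 2 + 1 / 8))) ^ 4, fun N z hz hzr => ?_⟩
  have hex : ∀ i, ∃ k, k ≤ N ∧ (k ≠ N → scale r k ≤ nnDist z i / 4) ∧
      (1 - r) / 16 * nnDist z i ≤ scale r k := by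
    intro i
    classical
    have hp : ∃ k, N ≤ k ∨ scale r k ≤ nnDist z i / 4 := ⟨N, Or.inl le_rfl⟩
    refine ⟨Nat.find hp, Nat.find_min' hp (Or.inl le_rfl), fun hne => ?_, ?_⟩
    · exact (Nat.find_spec hp).resolve_left fun h =>
        hne ((Nat.find_min' hp (Or.inl le_rfl)).antisymm h)
    · rcases hk : Nat.find hp with _ | k
      · obtain ⟨j, -, hj⟩ := exists_nnDist_eq z i
        have h1 : nnDist z i ≤ 2 := by
          rw [hj]
          linarith [dist_le_norm_add_norm (z i) (z j), hzr i, hzr j]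
        have h2 : scale r 0 = (1 - r) / 2 := by simp [scale]
        rw [h2]
        nlinarith
      · have h1 := Nat.find_min hp (m := k) (by omega)
        rw [not_or, not_le] at h1
        rw [scale_succ]
        nlinarith [nnDist_nonneg z i]
  choose k hkN hk1 hk2 using hex
  have hne i (h : scale r N ≠ scale r (k i)) : scale r (k i) ≤ nnDist z i / 4 :=
    hk1 i fun h' => h (by rw [h'])
  rw [X.mixedMoment_mol_eq (s := fun _ => scale r N) (t := fun i => scale r (k i))
    (fun _ => scale_pos hr N) (fun i => scale_antitone hr (hkN i))
    (fun i _ => ball_scale_subset hr (hzr i) _) fun i hi j hj => ?_]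
  · refine (abs_mixedMoment_le _).trans (le_trans ?_
      (prod_rpow_neg_le (by linarith) hc hA0 (nnDist_pos hz) hk2))
    exact Finset.prod_le_prod (fun i _ => norm_nonneg _) fun i _ => hA _ _ (hzr i)
  · have h1 := hne i hi
    have h2 := nnDist_le z hj
    have h3 := nnDist_le z hj.symm
    have h4 : scale r N ≤ scale r (k i) := scale_antitone hr (hkN i)
    rw [dist_comm] at h3
    have h5 := nnDist_nonneg z i
    by_cases h : scale r N = scale r (k j)
    · linarith
    · linarith [hne j h]

variable (X) in
lemma GFF.exists_mixedMoment_mol_sub_le (hm : 1 ≤ m) (hr : r < 1) :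
    ∃ C, 0 ≤ C ∧ ∀ n, ∀ z : Fin 4 → Euc (m + 1), Function.Injective z → (∀ i, ‖z i‖ ≤ r) →
      |mixedMoment X.P fun i => X.mol (scale r n) (z i) - X.mol (scale r (n + 1)) (z i)| ≤
        C * scale r n ^ (1 / 2 : ℝ) * ∏ i, nnDist z i ^ (-((m - 1 : ℝ) / 2 + 1 / 8)) := by
  have hm' : (1 : ℝ) ≤ m := by exact_mod_cast hm
  set A := ‖X.hL (bumpDiff 1 (1 / 2))‖ with hA
  have hA0 : 0 ≤ A := norm_nonneg _
  refine ⟨(A * (2 / 3 : ℝ) ^ (-((m - 1 : ℝ) / 2 + 1 / 8))) ^ 4, by positivity,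
    fun n z hz hzr => ?_⟩
  have hs := scale_pos hr n
  by_cases h : ∃ i, ∀ j, j ≠ i → scale r n + scale r n / 2 ≤ dist (z i) (z j)
  · obtain ⟨i, hi⟩ := h
    rw [X.mixedMoment_mol_sub_eq_zero (scale_pos hr (n + 1)) (scale_antitone hr n.le_succ) i
      (ball_scale_subset hr (hzr i) n) hi, abs_zero]
    exact mul_nonneg (mul_nonneg (by positivity) (by positivity))
      (Finset.prod_nonneg fun i _ => Real.rpow_nonneg (nnDist_nonneg z i) _)
  · push Not at h
    have h1 i : 2 / 3 * nnDist z i ≤ scale r n := by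
      obtain ⟨j, hj, hlt⟩ := h i
      linarith [nnDist_le z hj]
    refine (abs_mixedMoment_le _).trans ?_
    have h2 : ∏ i, ‖X.mol (scale r n) (z i) - X.mol (scale r (n + 1)) (z i)‖ =
        scale r n ^ (1 / 2 : ℝ) *
          ∏ _i : Fin 4, A * scale r n ^ (-((m - 1 : ℝ) / 2 + 1 / 8)) := by
      have h3 i := X.norm_mol_scale_sub hr (hzr i) n
      have h4 : scale r n ^ (-((m - 1 : ℝ) / 2)) =
          scale r n ^ (1 / 8 : ℝ) * scale r n ^ (-((m - 1 : ℝ) / 2 + 1 / 8)) := by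
        rw [← Real.rpow_add hs]
        congr 1
        ring
      have h5 : scale r n ^ (1 / 2 : ℝ) = (scale r n ^ (1 / 8 : ℝ)) ^ 4 := by
        rw [← Real.rpow_natCast, ← Real.rpow_mul hs.le]
        norm_num
      simp only [h3, h4, h5, Finset.prod_const, Finset.card_univ, Fintype.card_fin, ← hA]
      ring
    rw [h2, mul_comm _ (scale r n ^ (1 / 2 : ℝ)), mul_assoc]
    exact mul_le_mul_of_nonneg_left
      (prod_rpow_neg_le (by linarith) (by norm_num) hA0 (nnDist_pos hz) h1) (by positivity)

end MomentBounds

section SphericalAverage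

variable {m : ℕ} {Ω : Type} [MeasurableSpace Ω] {X : GFF (m + 1) Ω} {r : ℝ}

variable (m r) in
/-- The law of four independent uniform points on the sphere of radius `r`. -/
abbrev sphereFour : Measure (Fin 4 → Euc (m + 1)) :=
  Measure.pi fun _ : Fin 4 => sphereUniform (m + 1) r

variable (X r) in
/-- The mollified field averaged over the sphere of radius `r`. -/
def GFF.shellAvg (n : ℕ) : Lp ℝ 4 X.P := X.hL (shell m r (scale r n))

lemma GFF.norm_shellAvg_pow_four (hr0 : 0 < r) (hr : r < 1) (n : ℕ) :
    AEStronglyMeasurable (fun z => mixedMoment X.P fun i => X.mol (scale r n) (z i))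
      (sphereFour m r) ∧
    ‖X.shellAvg r n‖ ^ 4 =
      ∫ z, mixedMoment X.P (fun i => X.mol (scale r n) (z i)) ∂sphereFour m r := by
  have := isProbabilityMeasure_sphereUniform m hr0
  exact X.norm_hL_smear_pow_four (isTestFun_bump (scale_pos hr n)) hr0.le
    (by linarith [scale_le hr n]) (tsupport_bump_subset (scale_pos hr n))
    (ae_sphereUniform_mem_closedBall m r)

lemma GFF.norm_shellAvg_sub_pow_four (hr0 : 0 < r) (hr : r < 1) (n : ℕ) :
    ‖X.shellAvg r n - X.shellAvg r (n + 1)‖ ^ 4 =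
      ∫ z, mixedMoment X.P
        (fun i => X.mol (scale r n) (z i) - X.mol (scale r (n + 1)) (z i)) ∂sphereFour m r := by
  have := isProbabilityMeasure_sphereUniform m hr0
  have h0 := scale_pos hr n
  have h1 := scale_pos hr (n + 1)
  have h2 := scale_antitone hr n.le_succ
  have hθ : IsTestFun (bumpDiff (scale r n) (scale r (n + 1)) : Euc (m + 1) → ℝ) :=
    (isTestFun_bump h0).sub (isTestFun_bump h1)
  have hθδ : tsupport (bumpDiff (scale r n) (scale r (n + 1)) : Euc (m + 1) → ℝ) ⊆
      closedBall 0 (scale r n / 2) :=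
    (tsupport_sub _ _).trans (union_subset (tsupport_bump_subset h0)
      ((tsupport_bump_subset h1).trans (closedBall_subset_closedBall (by linarith))))
  have h := (X.norm_hL_smear_pow_four hθ hr0.le (by linarith [scale_le hr n]) hθδ
    (ae_sphereUniform_mem_closedBall m r)).2
  have hsm : smear (sphereUniform (m + 1) r) id
      (bumpDiff (scale r n) (scale r (n + 1)) : Euc (m + 1) → ℝ) =
      shell m r (scale r n) - shell m r (scale r (n + 1)) := by
    funext x
    exact integral_sub (integrable_translate measurable_id (isTestFun_bump h0).1.continuous
      (isTestFun_bump h0).2 x) (integrable_translate measurable_id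
        (isTestFun_bump h1).1.continuous (isTestFun_bump h1).2 x)
  rw [hsm, X.hL_sub (isTestFun_shell hr0 h0) (isTestFun_shell hr0 h1)] at h
  simp only [X.mol_sub_mol h0 h1]
  exact h

lemma ae_sphereFour (hm : 1 ≤ m) (hr0 : 0 < r) :
    ∀ᵐ z ∂sphereFour m r, Function.Injective z ∧ ∀ i, ‖z i‖ ≤ r := by
  have := isProbabilityMeasure_sphereUniform m hr0
  filter_upwards [ae_injective_pi _ (nullSingleton_sphereUniform hm r),
    ae_pi_of_ae (ae_sphereUniform_mem_closedBall m r)] with z h1 h2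
  exact ⟨h1, fun i => mem_closedBall_zero_iff.1 (h2 i)⟩

variable (X) in
lemma GFF.cauchySeq_shellAvg (hm : 1 ≤ m) (hr0 : 0 < r) (hr : r < 1) :
    CauchySeq (X.shellAvg r) := by
  have hm' : (1 : ℝ) ≤ m := by exact_mod_cast hm
  obtain ⟨C, hC0, hC⟩ := X.exists_mixedMoment_mol_sub_le hm hr
  obtain ⟨G, hG, hGle⟩ := exists_integrable_dominating hm
    (α := (m - 1 : ℝ) / 2 + 1 / 8) (by linarith) (by linarith) hr0
  set I := C * ∫ z, G z ∂sphereFour m r with hI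
  set q : ℝ := (1 / 2) ^ (1 / 8 : ℝ) with hq
  have hq0 : 0 < q := by positivity
  have hq1 : q < 1 := Real.rpow_lt_one (by norm_num) (by norm_num) (by norm_num)
  have hs n : scale r n ^ (1 / 2 : ℝ) ≤ (q ^ n) ^ 4 := by
    have h1 : scale r n ≤ (1 / 2) ^ n := by
      rw [scale, one_div_pow]
      exact div_le_div_of_nonneg_right (by linarith) (by positivity)
    refine (Real.rpow_le_rpow (scale_pos hr n).le h1 (by norm_num)).trans (le_of_eq ?_)
    rw [hq, ← pow_mul, ← Real.rpow_natCast, ← Real.rpow_natCast, ← Real.rpow_mul (by norm_num),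
      ← Real.rpow_mul (by norm_num)]
    congr 1
    push_cast
    ring
  have hb n : ‖X.shellAvg r n - X.shellAvg r (n + 1)‖ ^ 4 ≤ scale r n ^ (1 / 2 : ℝ) * I := by
    rw [X.norm_shellAvg_sub_pow_four hr0 hr, hI, ← mul_assoc, ← integral_const_mul]
    refine (Real.le_norm_self _).trans (norm_integral_le_of_norm_le (hG.const_mul _) ?_)
    filter_upwards [ae_sphereFour hm hr0] with z hz
    refine (hC n z hz.1 hz.2).trans ?_
    rw [mul_comm C]
    exact mul_le_mul_of_nonneg_left (hGle z hz.1)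
      (mul_nonneg (Real.rpow_nonneg (scale_pos hr n).le _) hC0)
  refine cauchySeq_of_le_geometric q (1 + |I|) hq1 fun n => ?_
  rw [dist_eq_norm]
  refine (pow_le_pow_iff_left₀ (norm_nonneg _) (by positivity) four_ne_zero).1 ?_
  have h1 : I ≤ (1 + |I|) ^ 4 := by
    have h2 : (1 + |I|) ^ 1 ≤ (1 + |I|) ^ 4 :=
      pow_le_pow_right₀ (by linarith [abs_nonneg I]) (by norm_num)
    linarith [le_abs_self I]
  calc _ ≤ scale r n ^ (1 / 2 : ℝ) * I := hb n
    _ ≤ (q ^ n) ^ 4 * (1 + |I|) ^ 4 :=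
        (mul_le_mul_of_nonneg_left h1 (Real.rpow_nonneg (scale_pos hr n).le _)).trans
          (mul_le_mul_of_nonneg_right (hs n) (by positivity))
    _ = _ := by ring

end SphericalAverage

section SphericalAverageLimit

variable {m : ℕ} {Ω : Type} [MeasurableSpace Ω] {X : GFF (m + 1) Ω} {r : ℝ}

lemma two_le_four : (2 : ENNReal) ≤ 4 := by norm_num

/-- The field averaged over mollified spheres converges to the spherical average. -/
lemma GFF.tendstoInMeasure_shellAvg (hr0 : 0 < r) (hr : r < 1) :
    TendstoInMeasure X.P (fun n => (X.shellAvg r n : Ω → ℝ)) atTop (X.sphAvg 0 r) := by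
  have hs := scale_pos hr
  set R : ℕ → ℝ := fun n => r + 2 * scale r n with hR
  have hR1 n : R n ≤ 1 := by
    simp only [hR]
    linarith [scale_le hr n]
  have hRr n : r ≤ R n := by linarith [hs n]
  have hRp n : 0 < R n := hr0.trans_le (hRr n)
  have hbR n : ball (0 : Euc (m + 1)) (R n) ⊆ ball 0 1 := ball_subset_ball (hR1 n)
  have hbr : ball (0 : Euc (m + 1)) r ⊆ ball 0 1 := ball_subset_ball hr.le
  have hF n := isRadialTestFun_shell (m := m) 0 hr0 (hs n)
  have hg n := isRadialTestFun_annulus (m := m) 0 hr0 n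
  have hRl : Tendsto R atTop (𝓝 r) := by
    simpa using ((tendsto_scale r).const_mul 2).const_add r
  have hdiv {u : ℕ → ℝ} (hu : Tendsto u atTop (𝓝 r)) : Tendsto (fun n => u n / R n) atTop (𝓝 1) := by
    have := hu.div hRl hr0.ne'
    rwa [div_self hr0.ne'] at this
  have hsub (c : ℝ) : Tendsto (fun n : ℕ => r * (1 - c / ((n : ℝ) + 4))) atTop (𝓝 r) := by
    simpa using (tendsto_one_sub_div c).const_mul r
  have hL1 n := (X.memLp_H (hRp n) (hbR n) (hF n).test).mono_exponent two_le_four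
  have hL2 n := (X.memLp_H (hRp n) (hbR n) (hg n).test).mono_exponent two_le_four
  have hL3 n := (X.memLp_H hr0 hbr (hg n).test).mono_exponent two_le_four
  have h1 := tendsto_of_tendsto_integral_sq hL1 (X.tendsto_integral_H_sq (A := fun n => r - scale r n)
    hr0 hRr hR1 hbR hF
    (fun n x => shell_nonneg (hs n) _) (fun n => integral_shell_sub 0 hr0 (hs n))
    (fun n x hx => by linarith [(shell_ne_zero (hs n) hx).1, hs n])
    (hdiv (by simpa using (tendsto_scale r).const_sub r))
    (hdiv (by simpa using (tendsto_scale r).const_add r)))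
  have h2 := tendsto_of_tendsto_integral_sq hL2 (X.tendsto_integral_H_sq hr0 hRr hR1 hbR hg
    (fun n x => annulus_nonneg hr0 n _) (integral_annulus_sub 0 hr0)
    (fun n x hx => le_norm_of_annulus_ne_zero hr0 hx) (hdiv (hsub 3)) (hdiv (hsub 1)))
  have h3 := tendsto_of_tendsto_integral_sq hL3 (X.tendsto_integral_H_annulus_sq hr0 hr.le hbr)
  have hφ := (X.memLp_φharm hr0 hbr).mono_exponent two_le_four
  have h4 := ((h1.sub h2).add h3).add_const (hφ.toLp _)
  rw [sub_zero, zero_add, zero_add] at h4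
  refine (tendstoInMeasure_of_tendsto_Lp h4).congr (fun n => ?_) hφ.coeFn_toLp
  filter_upwards [X.coeFn_hL (isTestFun_shell (m := m) hr0 (hs n)),
    Lp.coeFn_add ((hL1 n).toLp _ - (hL2 n).toLp _ + (hL3 n).toLp _) (hφ.toLp _),
    Lp.coeFn_add ((hL1 n).toLp _ - (hL2 n).toLp _) ((hL3 n).toLp _),
    Lp.coeFn_sub ((hL1 n).toLp _) ((hL2 n).toLp _),
    (hL1 n).coeFn_toLp, (hL2 n).coeFn_toLp, (hL3 n).coeFn_toLp, hφ.coeFn_toLp,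
    X.h_eq_H_add (hRp n) (hbR n) (hF n) (by linarith [hs n]) (by simp only [hR]; linarith [hs n]),
    X.h_eq_H_add (hRp n) (hbR n) (hg n) (mul_one_sub_pos hr0 n)
      ((mul_one_sub_lt hr0 n).trans_le (hRr n)),
    X.h_eq_H_add hr0 hbr (hg n) (mul_one_sub_pos hr0 n) (mul_one_sub_lt hr0 n)]
    with ω e0 e1 e2 e3 e4 e5 e6 e7 e8 e9 e10
  rw [integral_shell_sub 0 hr0 (hs n)] at e8
  rw [integral_annulus_sub 0 hr0] at e9 e10
  simp only [sub_zero] at e0 e1 e2 e3 e4 e5 e6 e7 e8 e9 e10 ⊢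
  simp only [Pi.add_apply, Pi.sub_apply] at e1 e2 e3 ⊢
  rw [GFF.shellAvg, e0, e1, e2, e3, e4, e5, e6, e7]
  linarith

variable (X) in
lemma GFF.tendsto_norm_shellAvg (hm : 1 ≤ m) (hr0 : 0 < r) (hr : r < 1) :
    Tendsto (fun n => ‖X.shellAvg r n‖ ^ 4) atTop (𝓝 (∫ ω, X.sphAvg 0 r ω ^ 4 ∂X.P)) := by
  obtain ⟨Y, hY⟩ := cauchySeq_tendsto_of_complete (X.cauchySeq_shellAvg hm hr0 hr)
  have h1 : Y =ᵐ[X.P] X.sphAvg 0 r :=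
    tendstoInMeasure_ae_unique (tendstoInMeasure_of_tendsto_Lp hY)
      (X.tendstoInMeasure_shellAvg hr0 hr)
  have h2 : ∫ ω, X.sphAvg 0 r ω ^ 4 ∂X.P = ‖Y‖ ^ 4 := by
    rw [norm_pow_four]
    refine integral_congr_ae ?_
    filter_upwards [h1] with ω hω
    rw [hω]
  rw [h2]
  exact hY.norm.pow 4

variable (X) in
/-- The four-point function is integrable over the sphere, with integral the fourth moment of the
spherical average. -/
lemma GFF.integrable_k4 (hm : 1 ≤ m) (hr0 : 0 < r) (hr : r < 1) :
    Integrable X.k4 (sphereFour m r) ∧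
      ∫ z, X.k4 z ∂sphereFour m r = ∫ ω, X.sphAvg 0 r ω ^ 4 ∂X.P := by
  have hm' : (1 : ℝ) ≤ m := by exact_mod_cast hm
  obtain ⟨C, hC⟩ := X.exists_mixedMoment_mol_le hm hr0 hr
  obtain ⟨G, hG, hGle⟩ := exists_integrable_dominating hm
    (α := (m - 1 : ℝ) / 2 + 1 / 8) (by linarith) (by linarith) hr0
  have hmeas n := (X.norm_shellAvg_pow_four hr0 hr n).1
  have hbound n : ∀ᵐ z ∂sphereFour m r,
      ‖mixedMoment X.P fun i => X.mol (scale r n) (z i)‖ ≤ |C| * G z := by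
    filter_upwards [ae_sphereFour hm hr0] with z hz
    have h0 : 0 ≤ ∏ i, nnDist z i ^ (-((m - 1 : ℝ) / 2 + 1 / 8)) :=
      Finset.prod_nonneg fun i _ => Real.rpow_nonneg (nnDist_nonneg z i) _
    exact (hC n z hz.1 hz.2).trans ((mul_le_mul_of_nonneg_right (le_abs_self C) h0).trans
      (mul_le_mul_of_nonneg_left (hGle z hz.1) (abs_nonneg C)))
  have hlim : ∀ᵐ z ∂sphereFour m r,
      Tendsto (fun n => mixedMoment X.P fun i => X.mol (scale r n) (z i)) atTop (𝓝 (X.k4 z)) := by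
    filter_upwards [ae_sphereFour hm hr0] with z hz
    refine tendsto_const_nhds.congr' ?_
    have hk i : 0 < k4eps z i :=
      half_pos (lt_min (half_pos (nnDist_pos hz.1 i)) (by linarith [hz.2 i]))
    have hev : ∀ᶠ n in atTop, ∀ i, scale r n / 2 < k4eps z i :=
      eventually_all.2 fun i => by
        have := (tendsto_scale r).div_const 2
        rw [zero_div] at this
        exact this.eventually_lt_const (hk i)
    filter_upwards [hev] with n hn
    exact X.k4_eq_mixedMoment (scale_pos hr n) hn
  have hkm := aestronglyMeasurable_of_tendsto_ae atTop hmeas hlim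
  refine ⟨(hG.const_mul |C|).mono' hkm ?_, ?_⟩
  · filter_upwards [hlim, ae_all_iff.2 hbound] with z h1 h2
    exact le_of_tendsto h1.norm (Eventually.of_forall h2)
  · refine tendsto_nhds_unique (tendsto_integral_of_dominated_convergence _ hmeas
      (hG.const_mul |C|) hbound hlim) ?_
    exact (X.tendsto_norm_shellAvg hm hr0 hr).congr fun n => (X.norm_shellAvg_pow_four hr0 hr n).2

/-- The integral off a neighbourhood of the diagonal exhausts the integral. -/
lemma tendsto_setIntegral_lt_dist {E : Type*} [MetricSpace E] [MeasurableSpace E]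
    [BorelSpace E] [SecondCountableTopology E] {μ : Measure (Fin 4 → E)} {k : (Fin 4 → E) → ℝ}
    (hk : Integrable k μ) (hμ : ∀ᵐ z ∂μ, Function.Injective z) :
    Tendsto (fun a : ℝ => ∫ z in {z : Fin 4 → E | ∀ i j, i ≠ j → a < dist (z i) (z j)}, k z ∂μ)
      (𝓝[>] 0) (𝓝 (∫ z, k z ∂μ)) := by
  have hms (a : ℝ) :
      MeasurableSet {z : Fin 4 → E | ∀ i j, i ≠ j → a < dist (z i) (z j)} := by
    simp only [ofPred_forall]
    exact .iInter fun i => .iInter fun j => .iInter fun _ => (isOpen_lt continuous_const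
      ((continuous_apply i).dist (continuous_apply j))).measurableSet
  simp only [← integral_indicator (hms _)]
  refine tendsto_integral_filter_of_dominated_convergence (fun z => ‖k z‖)
    (Eventually.of_forall fun a => hk.1.indicator (hms a))
    (Eventually.of_forall fun a => ae_of_all _ fun z => norm_indicator_le_norm_self _ _) hk.norm ?_
  filter_upwards [hμ] with z hz
  refine tendsto_const_nhds.congr' ?_
  have hev : ∀ᶠ a : ℝ in 𝓝[>] 0, ∀ i j, i ≠ j → a < dist (z i) (z j) := by
    refine eventually_all.2 fun i => eventually_all.2 fun j => ?_
    by_cases hij : i = j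
    · exact Eventually.of_forall fun a h => absurd hij h
    · have := (tendsto_id (α := ℝ) (x := 𝓝 0)).mono_left (nhdsWithin_le_nhds (s := Ioi 0))
      filter_upwards [this.eventually_lt_const (dist_pos.2 fun h => hij (hz h))] with a ha _ using ha
  filter_upwards [hev] with a ha
  exact (indicator_of_mem (s := {z : Fin 4 → E | ∀ i j, i ≠ j → a < dist (z i) (z j)}) ha k).symm

end SphericalAverageLimit

/-- the fourth moment of the spherical average is the off-diagonal limit of the
integral of the four-point function over the sphere. -/
theorem statement12 (d : ℕ) (hd : 2 ≤ d) (Ω : Type) [MeasurableSpace Ω] (X : GFF d Ω) (r : ℝ) (hr : r ∈ Set.Ioo (0 : ℝ) 1) :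
    Tendsto
      (fun a : ℝ => ∫ z in {z : Fin 4 → Euc d | ∀ i j, i ≠ j → a < dist (z i) (z j)},
        X.k4 z ∂(Measure.pi fun _ : Fin 4 => sphereUniform d r))
      (𝓝[>] (0 : ℝ))
      (𝓝 (∫ ω, (X.sphAvg 0 r ω) ^ 4 ∂X.P)) := by
  obtain ⟨m, rfl⟩ : ∃ m, d = m + 1 := ⟨d - 1, by omega⟩
  have hm : 1 ≤ m := by omega
  obtain ⟨hk, hk4⟩ := X.integrable_k4 hm hr.1 hr.2
  rw [← hk4]
  exact tendsto_setIntegral_lt_dist hk ((ae_sphereFour hm hr.1).mono fun z hz => hz.1)
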